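/- Let (R,m) be an analytically normal Cohen-Macaulay local domain of dimension d and I an ideal with dim R/I ≥ 2 such that the punctured spectrum Spec(R/I) − {m/I} is disconnected. Then Hom_R(R/I, H^{d-1}_I(R)) is not finitely generated; consequently H^{d-1}_I(R) is not I-cofinite. -/

import Mathlib

open CategoryTheory

noncomputable section

universe u

/-- The Krull dimension of a module: `dim R/ann(M)`. -/
def moduleDim (R : Type u) [CommRing R] (M : Type*) [AddCommGroup M] [Module R M] :
    WithBot (WithTop ℕ) :=
  ringKrullDim (R ⧸ Module.annihilator R M)

/-- The depth of `M` with respect to an ideal `J`: the supremum of the lengths of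
`M`-regular sequences consisting of elements of `J`. -/
def moduleDepth (R : Type u) [CommRing R] (J : Ideal R) (M : Type*) [AddCommGroup M]
    [Module R M] : ℕ∞ :=
  sSup {n : ℕ∞ | ∃ rs : List R, (rs.length : ℕ∞) = n ∧ (∀ r ∈ rs, r ∈ J) ∧
    RingTheory.Sequence.IsRegular M rs}

/-- Serre's condition `S_ℓ` : for every prime `p` in the support of `M`,
`depth M_p ≥ min (ℓ, dim M_p)`. -/
def SerreCondition (R : Type u) [CommRing R] (ℓ : ℕ) (M : Type u) [AddCommGroup M]
    [Module R M] : Prop :=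
  ∀ p ∈ Module.support R M,
    min ((ℓ : ℕ∞) : WithBot ℕ∞)
        (moduleDim (Localization.AtPrime p.asIdeal) (LocalizedModule p.asIdeal.primeCompl M)) ≤
      ((moduleDepth (Localization.AtPrime p.asIdeal)
          (IsLocalRing.maximalIdeal (Localization.AtPrime p.asIdeal))
          (LocalizedModule p.asIdeal.primeCompl M) : ℕ∞) : WithBot ℕ∞)

/-- A module `N` over `S` is `J`-cofinite if its support is contained in `V(J)` and all the
modules `Ext^i_S(S/J, N)` are finitely generated. -/
def IsCofinite (S : Type u) [CommRing S] (J : Ideal S) (N : ModuleCat.{u} S) : Prop :=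
  Module.support S N ⊆ PrimeSpectrum.zeroLocus (J : Set S) ∧
  ∀ i : ℕ, Module.Finite S
    (((Ext S (ModuleCat.{u} S) i).obj (Opposite.op (ModuleCat.of S (S ⧸ J)))).obj N)

/-- A ring is catenary if any two saturated chains of primes with the same endpoints have
the same length. -/
def IsCatenaryRing (R : Type u) [CommRing R] : Prop :=
  ∀ c₁ c₂ : LTSeries (PrimeSpectrum R),
    c₁.head = c₂.head → c₁.last = c₂.last →
    (∀ i : Fin c₁.length, c₁.toFun i.castSucc ⋖ c₁.toFun i.succ) →
    (∀ i : Fin c₂.length, c₂.toFun i.castSucc ⋖ c₂.toFun i.succ) →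
    c₁.length = c₂.length

/-- A module is indecomposable if it is nonzero and is not the internal direct sum of two
nonzero submodules. -/
def ModuleIndecomposable (R : Type u) [CommRing R] (M : Type*) [AddCommGroup M]
    [Module R M] : Prop :=
  Nontrivial M ∧ ∀ N₁ N₂ : Submodule R M, IsCompl N₁ N₂ → N₁ = ⊥ ∨ N₂ = ⊥

/-- A module is equidimensional if `dim R/P = dim M` for every minimal prime `P`
of its support (equivalently, of its annihilator). -/
def Equidimensional (R : Type u) [CommRing R] (M : Type*) [AddCommGroup M]
    [Module R M] : Prop :=
  ∀ P ∈ (Module.annihilator R M).minimalPrimes, ringKrullDim (R ⧸ P) = moduleDim R M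

/-- A local ring is Cohen-Macaulay if its depth equals its Krull dimension. -/
def IsCMLocalRing (S : Type u) [CommRing S] [IsLocalRing S] : Prop :=
  ((moduleDepth S (IsLocalRing.maximalIdeal S) S : ℕ∞) : WithBot ℕ∞) = ringKrullDim S

/-- A ring is Cohen-Macaulay if all its localizations at primes are Cohen-Macaulay local
rings. -/
def IsCMRing (S : Type u) [CommRing S] : Prop :=
  ∀ p : PrimeSpectrum S, IsCMLocalRing (Localization.AtPrime p.asIdeal)

namespace LocCoh

section Torsion

variable {R : Type*} [CommRing R] {N N' : Type*} [AddCommGroup N] [Module R N]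
  [AddCommGroup N'] [Module R N']

/-- The submodule of elements of `N` annihilated by the ideal `J`. -/
def kill (J : Ideal R) (N : Type*) [AddCommGroup N] [Module R N] : Submodule R N :=
  Submodule.torsionBySet R N (J : Set R)

theorem mem_kill {J : Ideal R} {x : N} : x ∈ kill J N ↔ ∀ r ∈ J, r • x = 0 := by
  simp [kill, Submodule.mem_torsionBySet_iff]

theorem kill_anti {J K : Ideal R} (h : J ≤ K) : kill K N ≤ kill J N :=
  fun _ hx => mem_kill.2 fun r hr => mem_kill.1 hx r (h hr)

theorem kill_top : kill (⊤ : Ideal R) N = ⊥ :=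
  eq_bot_iff.2 fun x hx => by simpa using mem_kill.1 hx 1 trivial

theorem kill_sup (J K : Ideal R) : kill (J ⊔ K) N = kill J N ⊓ kill K N := by
  refine le_antisymm (le_inf (kill_anti le_sup_left) (kill_anti le_sup_right)) ?_
  rintro x ⟨h1, h2⟩
  refine mem_kill.2 fun r hr => ?_
  obtain ⟨a, ha, b, hb, rfl⟩ := Submodule.mem_sup.1 hr
  rw [add_smul, mem_kill.1 h1 a ha, mem_kill.1 h2 b hb, add_zero]

theorem mem_kill_span_singleton {a : R} {x : N} : x ∈ kill (Ideal.span {a}) N ↔ a • x = 0 := by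
  refine ⟨fun h => mem_kill.1 h a (Ideal.mem_span_singleton_self a), fun h => mem_kill.2 ?_⟩
  intro r hr
  obtain ⟨b, rfl⟩ := Ideal.mem_span_singleton'.1 hr
  rw [mul_smul, h, smul_zero]

theorem map_mem_kill {J : Ideal R} (f : N →ₗ[R] N') {x : N} (hx : x ∈ kill J N) :
    f x ∈ kill J N' :=
  mem_kill.2 fun r hr => by rw [← map_smul, mem_kill.1 hx r hr, map_zero]

theorem mem_kill_of_injective {J : Ideal R} (f : N →ₗ[R] N') (hf : Function.Injective f) {x : N}
    (hx : f x ∈ kill J N') : x ∈ kill J N :=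
  mem_kill.2 fun r hr => hf (by rw [map_smul, mem_kill.1 hx r hr, map_zero])

theorem mem_kill_mul {J K : Ideal R} {x : N} :
    x ∈ kill (J * K) N ↔ ∀ r ∈ J, r • x ∈ kill K N := by
  refine ⟨fun h r hr => mem_kill.2 fun s hs => ?_, fun h => mem_kill.2 fun t ht => ?_⟩
  · rw [smul_smul, mul_comm]
    exact mem_kill.1 h _ (Ideal.mul_mem_mul hr hs)
  · induction ht using Submodule.mul_induction_on' with
    | mem_mul_mem r hr s hs => rw [mul_comm, mul_smul]; exact mem_kill.1 (h r hr) s hs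
    | add a _ b _ ha hb => rw [add_smul, ha, hb, add_zero]

theorem kill_pow_mono (J : Ideal R) {a b : ℕ} (h : a ≤ b) : kill (J ^ a) N ≤ kill (J ^ b) N :=
  kill_anti (Ideal.pow_le_pow_right h)

/-- The `J`-power torsion submodule of `N`. -/
def gam (J : Ideal R) (N : Type*) [AddCommGroup N] [Module R N] : Submodule R N where
  carrier := {x | ∃ k, x ∈ kill (J ^ k) N}
  zero_mem' := ⟨0, zero_mem _⟩
  add_mem' := by
    rintro x y ⟨a, ha⟩ ⟨b, hb⟩
    exact ⟨max a b, add_mem (kill_pow_mono J (le_max_left a b) ha)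
      (kill_pow_mono J (le_max_right a b) hb)⟩
  smul_mem' := by
    rintro r x ⟨a, ha⟩
    exact ⟨a, Submodule.smul_mem _ r ha⟩

theorem mem_gam {J : Ideal R} {x : N} : x ∈ gam J N ↔ ∃ k, x ∈ kill (J ^ k) N := Iff.rfl

theorem kill_le_gam (J : Ideal R) (k : ℕ) : kill (J ^ k) N ≤ gam J N := fun _ hx => ⟨k, hx⟩

theorem gam_anti_of_pow_le {J K : Ideal R} {k : ℕ} (h : J ^ k ≤ K) : gam K N ≤ gam J N := by
  rintro x ⟨a, ha⟩
  refine ⟨k * a, kill_anti ?_ ha⟩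
  rw [pow_mul]
  exact Ideal.pow_right_mono h a

theorem gam_anti_of_le_radical [IsNoetherianRing R] {J K : Ideal R} (h : J ≤ K.radical) :
    gam K N ≤ gam J N := by
  obtain ⟨k, hk⟩ := Ideal.exists_pow_le_of_le_radical_of_fg h (IsNoetherian.noetherian J)
  exact gam_anti_of_pow_le hk

theorem gam_anti {J K : Ideal R} (h : J ≤ K) : gam K N ≤ gam J N :=
  gam_anti_of_pow_le (k := 1) (by simpa using h)

theorem gam_sup (J K : Ideal R) : gam (J ⊔ K) N = gam J N ⊓ gam K N := by
  refine le_antisymm (le_inf (gam_anti le_sup_left) (gam_anti le_sup_right)) ?_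
  rintro x ⟨⟨a, ha⟩, ⟨b, hb⟩⟩
  refine ⟨a + b, kill_anti Ideal.sup_pow_add_le_pow_sup_pow ?_⟩
  rw [kill_sup]
  exact ⟨ha, hb⟩

theorem mem_gam_span_singleton {a : R} {x : N} :
    x ∈ gam (Ideal.span {a}) N ↔ ∃ k, a ^ k • x = 0 := by
  simp only [mem_gam, Ideal.span_singleton_pow, mem_kill_span_singleton]

theorem gam_bot : gam (⊥ : Ideal R) N = ⊤ :=
  eq_top_iff.2 fun x _ => ⟨1, mem_kill.2 fun r hr => by
    rw [pow_one, Ideal.mem_bot] at hr; rw [hr, zero_smul]⟩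

theorem map_mem_gam {J : Ideal R} (f : N →ₗ[R] N') {x : N} (hx : x ∈ gam J N) :
    f x ∈ gam J N' := hx.imp fun _ h => map_mem_kill f h

theorem mem_gam_of_injective {J : Ideal R} (f : N →ₗ[R] N') (hf : Function.Injective f) {x : N}
    (hx : f x ∈ gam J N') : x ∈ gam J N := hx.imp fun _ h => mem_kill_of_injective f hf h

theorem exists_kill_of_finite [IsNoetherianRing R] {J : Ideal R} (F : Submodule R N)
    (hF : F.FG) (h : F ≤ gam J N) : ∃ k, F ≤ kill (J ^ k) N := by
  obtain ⟨s, hs⟩ := hF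
  have h' : ∀ x ∈ s, ∃ n, x ∈ kill (J ^ n) N := fun x hx => h (hs ▸ Submodule.subset_span hx)
  choose! n hn using h'
  refine ⟨s.sup n, ?_⟩
  rw [← hs, Submodule.span_le]
  exact fun x hx => kill_pow_mono J (Finset.le_sup hx) (hn x hx)

end Torsion

end LocCoh

namespace LocCoh

section DualHilbert

variable {R : Type*} [CommRing R] {A : Type*} [AddCommGroup A] [Module R A]

/-- The monomial `z ^ α`. -/
def mon {s : ℕ} (z : Fin s → R) (α : Fin s →₀ ℕ) : R := α.prod fun i k => z i ^ k

theorem mon_add {s : ℕ} (z : Fin s → R) (α β : Fin s →₀ ℕ) :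
    mon z (α + β) = mon z α * mon z β :=
  Finsupp.prod_add_index' (by simp) (by simp [pow_add])

theorem mon_single {s : ℕ} (z : Fin s → R) (i : Fin s) : mon z (Finsupp.single i 1) = z i := by
  simp [mon]

theorem mem_kill_pow_of_mon {s : ℕ} (z : Fin s → R) (n : ℕ) (x : A)
    (h : ∀ α : Fin s →₀ ℕ, α.degree = n → mon z α • x = 0) :
    x ∈ kill (Ideal.span (Set.range z) ^ n) A := by
  induction n generalizing x with
  | zero =>
    simpa [mon, mem_kill] using fun r => by
      rw [show x = 0 by simpa [mon] using h 0 rfl, smul_zero]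
  | succ n ih =>
    rw [pow_succ', mem_kill_mul]
    intro r hr
    induction hr using Submodule.span_induction with
    | mem r hr =>
      obtain ⟨i, rfl⟩ := hr
      refine ih _ fun α hα => ?_
      have := h (α + Finsupp.single i 1) (by rw [map_add, hα, Finsupp.degree_single])
      rwa [mon_add, mon_single, mul_smul] at this
    | zero => rw [zero_smul]; exact zero_mem _
    | add a b _ _ ha hb => rw [add_smul]; exact add_mem ha hb
    | smul c a _ ha => rw [smul_assoc]; exact Submodule.smul_mem _ c ha

theorem mon_smul_mem {s : ℕ} (z : Fin s → R) (U : ℕ → Submodule R A)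
    (hz : ∀ n i, ∀ x ∈ U (n + 1), z i • x ∈ U n) (α : Fin s →₀ ℕ) (n : ℕ) :
    ∀ x ∈ U (n + α.degree), mon z α • x ∈ U n := by
  induction α using Finsupp.induction_linear generalizing n with
  | zero => simp [mon]
  | add f g hf hg =>
    intro x hx
    rw [mon_add, mul_smul]
    rw [map_add, ← add_assoc] at hx
    exact hf n _ (hg _ x hx)
  | single i k =>
    induction k generalizing n with
    | zero => simp [mon]
    | succ k ih =>
      intro x hx
      rw [Finsupp.single_add, mon_add, mon_single, mul_smul]
      rw [Finsupp.degree_single, ← add_assoc] at hx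
      refine ih n _ ?_
      rw [Finsupp.degree_single]
      exact hz _ i x hx

/-- The leading coefficient submodule attached to the exponent `α`. -/
def leadCoeff {s : ℕ} (z : Fin s → R) (U : ℕ → Submodule R A) (α : Fin s →₀ ℕ) :
    Submodule R A where
  carrier := {y | ∃ x ∈ U α.degree, (∀ β : Fin s →₀ ℕ, β.degree = α.degree →
    MonomialOrder.lex.toSyn α < MonomialOrder.lex.toSyn β → mon z β • x = 0) ∧ mon z α • x = y}
  zero_mem' := ⟨0, zero_mem _, by simp, by simp⟩
  add_mem' := by
    rintro _ _ ⟨x, hx, h, rfl⟩ ⟨y, hy, h', rfl⟩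
    exact ⟨x + y, add_mem hx hy, fun β hβ hl => by rw [smul_add, h β hβ hl, h' β hβ hl, add_zero],
      smul_add _ _ _⟩
  smul_mem' := by
    rintro r _ ⟨x, hx, h, rfl⟩
    exact ⟨r • x, Submodule.smul_mem _ _ hx,
      fun β hβ hl => by rw [smul_comm, h β hβ hl, smul_zero], smul_comm _ _ _⟩

theorem leadCoeff_mono {s : ℕ} (z : Fin s → R) {U V : ℕ → Submodule R A} (h : ∀ n, U n ≤ V n)
    (α : Fin s →₀ ℕ) : leadCoeff z U α ≤ leadCoeff z V α := by
  rintro _ ⟨x, hx, h', rfl⟩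
  exact ⟨x, h _ hx, h', rfl⟩

theorem leadCoeff_anti {s : ℕ} (z : Fin s → R) (U : ℕ → Submodule R A)
    (hz : ∀ n i, ∀ x ∈ U (n + 1), z i • x ∈ U n) : Antitone (leadCoeff z U) := by
  intro α α' hα
  obtain ⟨γ, rfl⟩ := exists_add_of_le hα
  rintro _ ⟨x, hx, h, rfl⟩
  refine ⟨mon z γ • x, mon_smul_mem z U hz γ _ x (by rwa [← map_add]), fun β hβ hl => ?_, ?_⟩
  · rw [smul_smul, ← mon_add]
    refine h _ (by rw [map_add, map_add, hβ]) ?_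
    rw [map_add, map_add]
    exact add_lt_add_left hl _
  · rw [smul_smul, ← mon_add]

theorem exists_leadCoeff_stable {s : ℕ} (z : Fin s → R) (U : ℕ → ℕ → Submodule R A)
    (hU : ∀ n, Antitone fun t => U t n)
    (hz : ∀ t n i, ∀ x ∈ U t (n + 1), z i • x ∈ U t n)
    (S : Submodule R A) [IsArtinian R S]
    (hS : ∀ α : Fin s →₀ ℕ, ∀ x ∈ U 0 α.degree, mon z α • x ∈ S) :
    ∃ t₀, ∀ t, t₀ ≤ t → ∀ α, leadCoeff z (U t₀) α = leadCoeff z (U t) α := by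
  have hle : ∀ t α, leadCoeff z (U t) α ≤ S := by
    rintro t α _ ⟨x, hx, -, rfl⟩
    exact hS α x (hU _ (Nat.zero_le t) hx)
  have hanti : ∀ {t t' α α'}, t ≤ t' → α ≤ α' →
      leadCoeff z (U t') α' ≤ leadCoeff z (U t) α := fun ht hα =>
    (leadCoeff_anti z _ (hz _) hα).trans (leadCoeff_mono z (fun n => hU n ht) _)
  by_contra! hcon
  choose T hT a ha using hcon
  obtain ⟨φ, hφ⟩ := (wellQuasiOrdered_le (α := Fin s →₀ ℕ)).exists_monotone_subseq a
  let g : ℕ → Submodule R A := fun j => leadCoeff z (U (φ j)) (a (φ j))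
  have hg : Antitone g := fun i j hij => hanti (φ.monotone hij) (hφ i j hij)
  obtain ⟨j₀, hj₀⟩ := IsArtinian.monotone_stabilizes (R := R) (M := S)
    ⟨fun j => OrderDual.toDual ((g j).comap S.subtype), fun i j hij =>
      Submodule.comap_mono (hg hij)⟩
  have hst : ∀ j, j₀ ≤ j → g j₀ ≤ g j := fun j hj x hx => by
    have : (⟨x, hle _ _ hx⟩ : S) ∈ (g j₀).comap S.subtype := hx
    have h2 : (g j₀).comap S.subtype = (g j).comap S.subtype := hj₀ j hj
    rw [h2] at this
    exact this
  have hj : ∃ j, j₀ ≤ j ∧ T (φ j₀) ≤ φ j :=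
    ⟨max j₀ (T (φ j₀)), le_max_left _ _, (le_max_right _ _).trans φ.strictMono.le_apply⟩
  obtain ⟨j, hj1, hj2⟩ := hj
  exact ha (φ j₀) (le_antisymm ((hst j hj1).trans (hanti hj2 (hφ _ _ hj1))) (hanti (hT _) le_rfl))

/-- A dual form of the Hilbert basis theorem. -/
theorem dual_hilbert {s : ℕ} (z : Fin s → R) (U : ℕ → ℕ → Submodule R A)
    (hU : ∀ n, Antitone fun t => U t n)
    (hz : ∀ t n i, ∀ x ∈ U t (n + 1), z i • x ∈ U t n)
    (S : Submodule R A) [IsArtinian R S]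
    (hS : ∀ α : Fin s →₀ ℕ, ∀ x ∈ U 0 α.degree, mon z α • x ∈ S) :
    ∃ t₀, ∀ t, t₀ ≤ t → ∀ n, U t₀ n ≤ U t n ⊔ kill (Ideal.span (Set.range z) ^ n) A := by
  obtain ⟨t₀, ht₀⟩ := exists_leadCoeff_stable z U hU hz S hS
  refine ⟨t₀, fun t ht n => ?_⟩
  let B : Finset (Fin s →₀ ℕ) := (Finsupp.finite_of_degree_eq (σ := Fin s) n).toFinset
  have hB : ∀ β, β ∈ B ↔ β.degree = n := by simp [B]
  have key : ∀ a : MonomialOrder.lex.syn, ∀ α : Fin s →₀ ℕ, MonomialOrder.lex.toSyn α = a →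
      α ∈ B → ∀ x ∈ U t₀ n,
      (∀ β ∈ B, mon z β • x ≠ 0 → MonomialOrder.lex.toSyn β ≤ MonomialOrder.lex.toSyn α) →
      x ∈ U t n ⊔ kill (Ideal.span (Set.range z) ^ n) A := by
    intro a
    induction a using WellFoundedLT.induction with
    | ind a ih =>
      rintro α rfl hα x hx hmax
      have hαn := (hB α).1 hα
      have h1 : mon z α • x ∈ leadCoeff z (U t₀) α := by
        refine ⟨x, hαn ▸ hx, fun β hβ hl => ?_, rfl⟩
        by_contra hne
        exact absurd hl (not_lt.2 (hmax β ((hB β).2 (hβ.trans hαn)) hne))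
      rw [ht₀ t ht α] at h1
      obtain ⟨y, hy, hy1, hy2⟩ := h1
      rw [hαn] at hy
      have hxy : x - y ∈ U t₀ n := sub_mem hx (hU n ht hy)
      have hlow : ∀ β ∈ B, mon z β • (x - y) ≠ 0 →
          MonomialOrder.lex.toSyn β < MonomialOrder.lex.toSyn α := by
        intro β hβ hne
        by_contra hge
        rcases (not_lt.1 hge).eq_or_lt with heq | hlt
        · obtain rfl := MonomialOrder.lex.toSyn.injective heq
          exact hne (by rw [smul_sub, hy2, sub_self])
        · refine hne ?_
          rw [smul_sub, hy1 β (((hB β).1 hβ).trans hαn.symm) hlt, sub_zero]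
          by_contra hne'
          exact absurd hlt (not_lt.2 (hmax β hβ hne'))
      suffices h : x - y ∈ U t n ⊔ kill (Ideal.span (Set.range z) ^ n) A by
        have := add_mem h (Submodule.mem_sup_left hy)
        rwa [sub_add_cancel] at this
      classical
      by_cases hbad : (B.filter fun β => mon z β • (x - y) ≠ 0).Nonempty
      · obtain ⟨β, hβ, hβmax⟩ := Finset.exists_max_image _ MonomialOrder.lex.toSyn hbad
        rw [Finset.mem_filter] at hβ
        exact ih _ (hlow β hβ.1 hβ.2) β rfl hβ.1 _ hxy fun γ hγ hγ' =>
          hβmax γ (Finset.mem_filter.2 ⟨hγ, hγ'⟩)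
      · refine Submodule.mem_sup_right (mem_kill_pow_of_mon z n _ fun β hβ => ?_)
        by_contra hne
        exact hbad ⟨β, Finset.mem_filter.2 ⟨(hB β).2 hβ, hne⟩⟩
  intro x hx
  classical
  by_cases hbad : (B.filter fun β => mon z β • x ≠ 0).Nonempty
  · obtain ⟨β, hβ, hβmax⟩ := Finset.exists_max_image _ MonomialOrder.lex.toSyn hbad
    rw [Finset.mem_filter] at hβ
    exact key _ β rfl hβ.1 _ hx fun γ hγ hγ' => hβmax γ (Finset.mem_filter.2 ⟨hγ, hγ'⟩)
  · refine Submodule.mem_sup_right (mem_kill_pow_of_mon z n _ fun β hβ => ?_)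
    by_contra hne
    exact hbad ⟨β, Finset.mem_filter.2 ⟨(hB β).2 hβ, hne⟩⟩

variable [IsNoetherianRing R]

/-- The dual Artin-Rees lemma. -/
theorem dual_artin_rees [IsArtinian R A] (I : Ideal R) (K : Submodule R A) :
    ∃ n, ∀ x : A, (∀ r ∈ I, r • x ∈ K) → x ∈ K ⊔ kill (I ^ n) A := by
  obtain ⟨s, z, hsz⟩ := Submodule.fg_iff_exists_fin_generating_family.1 (IsNoetherian.noetherian I)
  have hzI : ∀ i, z i ∈ I := fun i => hsz ▸ Submodule.subset_span ⟨i, rfl⟩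
  let U : ℕ → ℕ → Submodule R A := fun t n =>
    { carrier := {x | ∀ r ∈ I ^ (n - t), r • x ∈ K ⊔ kill (I ^ min n t) A}
      zero_mem' := by simp
      add_mem' := fun ha hb r hr => by rw [smul_add]; exact add_mem (ha r hr) (hb r hr)
      smul_mem' := fun c x hx r hr => by rw [smul_comm]; exact Submodule.smul_mem _ _ (hx r hr) }
  have hsup : ∀ (m : ℕ) (r : R), r ∈ I → ∀ x ∈ K ⊔ kill (I ^ (m + 1)) A,
      r • x ∈ K ⊔ kill (I ^ m) A := by
    intro m r hr x hx
    obtain ⟨a, ha, b, hb, rfl⟩ := Submodule.mem_sup.1 hx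
    rw [smul_add]
    rw [pow_succ', mem_kill_mul] at hb
    exact add_mem (Submodule.mem_sup_left (Submodule.smul_mem _ _ ha))
      (Submodule.mem_sup_right (hb r hr))
  have hU : ∀ n, Antitone fun t => U t n := by
    intro n
    refine antitone_nat_of_succ_le fun t x hx r hr => ?_
    rcases le_or_gt n t with h | h
    · have := hx r (by rwa [Nat.sub_eq_zero_of_le (h.trans (Nat.le_succ t)),
        ← Nat.sub_eq_zero_of_le h])
      rwa [min_eq_left (h.trans (Nat.le_succ t)), ← min_eq_left h] at this
    · have h1 : n - t = (n - (t + 1)) + 1 := by omega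
      rw [h1, pow_succ] at hr
      rw [min_eq_right h.le]
      induction hr using Submodule.mul_induction_on' with
      | mem_mul_mem a ha b hb =>
        rw [mul_comm, mul_smul]
        refine hsup t b hb _ ?_
        have := hx a ha
        rwa [min_eq_right h] at this
      | add a _ b _ ha hb => rw [add_smul]; exact add_mem ha hb
  have hz : ∀ t n i, ∀ x ∈ U t (n + 1), z i • x ∈ U t n := by
    intro t n i x hx r hr
    rcases le_or_gt t n with h | h
    · have := hx (r * z i) (by
        rw [Nat.sub_add_comm h, pow_succ]; exact Ideal.mul_mem_mul hr (hzI i))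
      rwa [min_eq_right (h.trans (Nat.le_succ n)), ← min_eq_right h, mul_smul] at this
    · refine Submodule.smul_mem _ _ ?_
      have := hx 1 (by rw [Nat.sub_eq_zero_of_le h]; simp)
      rw [one_smul, min_eq_left h] at this
      rw [min_eq_left h.le]
      exact hsup n _ (hzI i) _ this
  obtain ⟨t₀, ht₀⟩ := dual_hilbert z U hU hz ⊤ (by simp)
  refine ⟨t₀ + 1, fun x hx => ?_⟩
  have h1 : x ∈ U t₀ (t₀ + 1) := fun r hr => by
    rw [Nat.add_sub_cancel_left, pow_one] at hr
    exact Submodule.mem_sup_left (hx r hr)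
  have h2 := ht₀ (t₀ + 1) (Nat.le_succ _) _ h1
  have h3 : U (t₀ + 1) (t₀ + 1) ≤ K ⊔ kill (I ^ (t₀ + 1)) A := fun y hy => by
    simpa using hy 1 (by simp)
  rw [show Ideal.span (Set.range z) = I from hsz] at h2
  exact sup_le h3 le_sup_right h2

/-- Melkersson's lemma. -/
theorem isArtinian_of_kill (I : Ideal R) (hA : ∀ x : A, x ∈ gam I A) [IsArtinian R (kill I A)] :
    IsArtinian R A := by
  obtain ⟨s, z, hsz⟩ := Submodule.fg_iff_exists_fin_generating_family.1 (IsNoetherian.noetherian I)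
  have hzI : ∀ i, z i ∈ I := fun i => hsz ▸ Submodule.subset_span ⟨i, rfl⟩
  rw [← monotone_stabilizes_iff_artinian]
  intro B
  let U : ℕ → ℕ → Submodule R A := fun t n => OrderDual.ofDual (B t) ⊓ kill (I ^ (n + 1)) A
  have hU : ∀ n, Antitone fun t => U t n := fun n t t' h =>
    inf_le_inf_right _ (B.monotone h)
  have hz : ∀ t n i, ∀ x ∈ U t (n + 1), z i • x ∈ U t n := by
    rintro t n i x ⟨hx1, hx2⟩
    refine ⟨Submodule.smul_mem _ _ hx1, ?_⟩
    rw [pow_succ', SetLike.mem_coe, mem_kill_mul] at hx2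
    exact hx2 _ (hzI i)
  have hmon : ∀ α : Fin s →₀ ℕ, ∀ x ∈ U 0 α.degree, mon z α • x ∈ kill I A := by
    intro α x hx
    have := (mon_smul_mem z (U 0) (hz 0) α 0 x (by rwa [zero_add])).2
    simpa using this
  obtain ⟨t₀, ht₀⟩ := dual_hilbert z U hU hz (kill I A) hmon
  rw [show Ideal.span (Set.range z) = I from hsz] at ht₀
  refine ⟨t₀, fun t ht => ?_⟩
  have key : ∀ n, OrderDual.ofDual (B t₀) ⊓ kill (I ^ n) A ≤ OrderDual.ofDual (B t) := by
    intro n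
    induction n with
    | zero => rw [pow_zero, Ideal.one_eq_top, kill_top, inf_bot_eq]; exact bot_le
    | succ n ih =>
      intro x hx
      obtain ⟨y, hy, k, hk, rfl⟩ := Submodule.mem_sup.1 (ht₀ t ht n hx)
      refine add_mem hy.1 (ih ⟨?_, hk⟩)
      have hy' : y ∈ OrderDual.ofDual (B t₀) := B.monotone ht hy.1
      simpa using sub_mem hx.1 hy'
  refine le_antisymm (B.monotone ht) ?_
  intro x hx
  obtain ⟨n, hn⟩ := hA x
  exact key n ⟨hx, hn⟩

end DualHilbert
end LocCoh

namespace LocCoh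

section DoubleAnnihilator

variable {R : Type u} [CommRing R] {G : Type u} [AddCommGroup G] [Module R G]

/-- The homomorphism `R ⧸ K → G` sending `1` to an element killed by `K`. -/
def homOfKill {K : Ideal R} {x : G} (hx : x ∈ kill K G) : (R ⧸ K) →ₗ[R] G :=
  K.liftQ (LinearMap.toSpanSingleton R G x) fun r hr => mem_kill.1 hx r hr

theorem homOfKill_mk {K : Ideal R} {x : G} (hx : x ∈ kill K G) (r : R) :
    homOfKill hx (Ideal.Quotient.mk K r) = r • x := rfl

variable [IsLocalRing R]

open IsLocalRing in
theorem length_linearMap_le_of_socle (g₀ : G)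
    (hs : ∀ x ∈ kill (maximalIdeal R) G, ∃ r : R, x = r • g₀)
    (hg₀ : g₀ ∈ kill (maximalIdeal R) G) {X : Type u} [AddCommGroup X] [Module R X]
    (hX : IsFiniteLength R X) : Module.length R (X →ₗ[R] G) ≤ Module.length R X := by
  induction hX with
  | of_subsingleton =>
    rw [Module.length_eq_zero_iff.2 inferInstance]; exact bot_le
  | @of_simple_quotient X _ _ N hN _ ih =>
    rw [Module.length_eq_add_of_exact N.subtype N.mkQ N.injective_subtype N.mkQ_surjective
      (LinearMap.exact_subtype_mkQ N)]
    let ρ : (X →ₗ[R] G) →ₗ[R] (N →ₗ[R] G) := LinearMap.lcomp R G N.subtype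
    rw [Module.length_eq_add_of_exact (LinearMap.ker ρ).subtype ρ.rangeRestrict
      (Submodule.injective_subtype _) ρ.surjective_rangeRestrict
      (LinearMap.exact_iff.2 (by rw [LinearMap.ker_rangeRestrict, Submodule.range_subtype]))]
    rw [add_comm]
    refine add_le_add ((Module.length_le_of_injective (LinearMap.range ρ).subtype
      (Submodule.injective_subtype _)).trans ih) ?_
    rw [Module.length_eq_one R (X ⧸ N)]
    have := IsSimpleModule.nontrivial R (X ⧸ N)
    obtain ⟨y, hy⟩ := exists_ne (0 : X ⧸ N)
    obtain ⟨x, rfl⟩ := N.mkQ_surjective y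
    have hxm : ∀ r ∈ maximalIdeal R, r • x ∈ N := by
      have hmax := IsSimpleModule.toSpanSingleton_surjective R hy
      have : Ideal.IsMaximal (LinearMap.ker (LinearMap.toSpanSingleton R (X ⧸ N) (N.mkQ x))) :=
        IsSimpleModule.ker_toSpanSingleton_isMaximal R hy
      intro r hr
      rw [← IsLocalRing.eq_maximalIdeal this] at hr
      have : r • N.mkQ x = 0 := by simpa using hr
      rw [← map_smul] at this
      exact (Submodule.Quotient.mk_eq_zero N).1 this
    have hspan : ∀ x' : X, ∃ r : R, ∃ n ∈ N, x' = r • x + n := by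
      intro x'
      obtain ⟨r, hr⟩ := IsSimpleModule.toSpanSingleton_surjective R hy (N.mkQ x')
      refine ⟨r, x' - r • x, ?_, by abel⟩
      rw [← Submodule.Quotient.mk_eq_zero, Submodule.Quotient.mk_sub, sub_eq_zero]
      exact hr.symm
    have hker : ∀ φ ∈ LinearMap.ker ρ, ∀ n ∈ N, φ n = 0 := fun φ hφ n hn =>
      LinearMap.congr_fun (LinearMap.mem_ker.1 hφ) ⟨n, hn⟩
    let ev : LinearMap.ker ρ →ₗ[R] Submodule.span R {g₀} :=
      { toFun := fun φ => ⟨φ.1 x, by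
          obtain ⟨r, hr⟩ := hs (φ.1 x) (mem_kill.2 fun r hr => by
            rw [← map_smul]; exact hker _ φ.2 _ (hxm r hr))
          rw [hr]
          exact Submodule.smul_mem _ _ (Submodule.mem_span_singleton_self g₀)⟩
        map_add' := fun _ _ => rfl
        map_smul' := fun _ _ => rfl }
    have hev : Function.Injective ev := by
      rw [injective_iff_map_eq_zero]
      intro φ hφ
      have h0 : φ.1 x = 0 := congrArg Subtype.val hφ
      ext x'
      obtain ⟨r, n, hn, rfl⟩ := hspan x'
      simp [h0, hker _ φ.2 n hn]
    refine (Module.length_le_of_injective ev hev).trans ?_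
    let θ : (R ⧸ maximalIdeal R) →ₗ[R] Submodule.span R {g₀} :=
      (maximalIdeal R).liftQ (LinearMap.toSpanSingleton R _
        ⟨g₀, Submodule.mem_span_singleton_self g₀⟩) (fun r hr => by
          rw [LinearMap.mem_ker]
          exact Subtype.ext (mem_kill.1 hg₀ r hr))
    have hθ : Function.Surjective θ := by
      rintro ⟨y, hy⟩
      obtain ⟨r, rfl⟩ := Submodule.mem_span_singleton.1 hy
      exact ⟨Submodule.Quotient.mk r, rfl⟩
    refine (Module.length_le_of_surjective θ hθ).trans ?_
    have : IsSimpleModule R (R ⧸ maximalIdeal R) :=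
      isSimpleModule_iff_isCoatom.2 (Ideal.isMaximal_def.1 inferInstance)
    rw [Module.length_eq_one R (R ⧸ maximalIdeal R)]

open IsLocalRing in
theorem mem_of_forall_smul_kill_eq_zero [IsArtinian R G] [IsNoetherian R G] (g₀ : G)
    (hs : ∀ x ∈ kill (maximalIdeal R) G, ∃ r : R, x = r • g₀)
    (hg₀ : g₀ ∈ kill (maximalIdeal R) G) (J : Ideal R) (hJ : ∀ r : R, (∀ x : G, r • x = 0) → r ∈ J)
    (r : R) (hr : ∀ x ∈ kill J G, r • x = 0) : r ∈ J := by
  have hfl : ∀ (X : Type u) [AddCommGroup X] [Module R X] [IsArtinian R X] [IsNoetherian R X],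
      IsFiniteLength R X := fun X _ _ _ _ => isFiniteLength_iff_isNoetherian_isArtinian.2 ⟨‹_›, ‹_›⟩
  have hlen : ∀ (X : Type u) [AddCommGroup X] [Module R X], IsFiniteLength R X →
    Module.length R (X →ₗ[R] G) ≤ Module.length R X := fun X _ _ hX =>
      length_linearMap_le_of_socle g₀ hs hg₀ hX
  -- the quotient by the annihilator of a submodule `V`
  have h1 : ∀ V : Submodule R G, Module.length R (R ⧸ Module.annihilator R V) ≤
      Module.length R V := by
    intro V
    let f : R →ₗ[R] (V →ₗ[R] G) := LinearMap.toSpanSingleton R _ V.subtype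
    have hf : LinearMap.ker f = Module.annihilator R V := by
      ext r
      rw [LinearMap.mem_ker, Module.mem_annihilator]
      refine ⟨fun h v => Subtype.ext (LinearMap.congr_fun h v), fun h => ?_⟩
      ext v
      exact congrArg Subtype.val (h v)
    rw [← hf]
    refine le_trans ?_ (hlen V (hfl V))
    exact Module.length_le_of_injective ((LinearMap.ker f).liftQ f le_rfl)
      (LinearMap.ker_eq_bot.1 (Submodule.ker_liftQ_eq_bot _ _ _ le_rfl))
  have hannfin : ∀ V : Submodule R G, IsFiniteLength R (R ⧸ Module.annihilator R V) := fun V =>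
    Module.length_ne_top_iff.1 (ne_top_of_le_ne_top (Module.length_ne_top) (h1 V))
  have h2 : ∀ K : Ideal R, IsFiniteLength R (R ⧸ K) →
      Module.length R (kill K G) ≤ Module.length R (R ⧸ K) := by
    intro K hK
    refine le_trans ?_ (hlen _ hK)
    let f : kill K G →ₗ[R] ((R ⧸ K) →ₗ[R] G) :=
      { toFun := fun x => homOfKill x.2
        map_add' := fun x y => LinearMap.ext fun q => by
          obtain ⟨q, rfl⟩ := Ideal.Quotient.mk_surjective q
          rw [LinearMap.add_apply, homOfKill_mk, homOfKill_mk, homOfKill_mk]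
          exact smul_add _ _ _
        map_smul' := fun c x => LinearMap.ext fun q => by
          obtain ⟨q, rfl⟩ := Ideal.Quotient.mk_surjective q
          rw [RingHom.id_apply, LinearMap.smul_apply, homOfKill_mk, homOfKill_mk]
          exact smul_comm _ _ _ }
    refine Module.length_le_of_injective f ?_
    intro x y hxy
    have := LinearMap.congr_fun hxy (Ideal.Quotient.mk K 1)
    change homOfKill x.2 _ = homOfKill y.2 _ at this
    rw [homOfKill_mk, homOfKill_mk, one_smul, one_smul] at this
    exact Subtype.ext this
  set 𝔞 := Module.annihilator R (⊤ : Submodule R G) with h𝔞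
  have h𝔞J : 𝔞 ≤ J := fun s hs => hJ s fun x =>
    congrArg Subtype.val (Module.mem_annihilator.1 hs (⟨x, trivial⟩ : (⊤ : Submodule R G)))
  have h𝔞0 : ∀ s ∈ 𝔞, ∀ x : G, s • x = 0 := fun s hs x =>
    congrArg Subtype.val (Module.mem_annihilator.1 hs (⟨x, trivial⟩ : (⊤ : Submodule R G)))
  have hfin𝔞 : IsFiniteLength R (R ⧸ 𝔞) := hannfin ⊤
  let Q : Submodule R (R ⧸ 𝔞) := Submodule.map 𝔞.mkQ J
  have hQfin : IsFiniteLength R Q := hfin𝔞.of_injective (f := Q.subtype) Q.injective_subtype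
  have h3 : Module.length R (G ⧸ kill J G) ≤ Module.length R Q := by
    refine le_trans ?_ (hlen _ hQfin)
    let act : G →ₗ[R] ((R ⧸ 𝔞) →ₗ[R] G) :=
      { toFun := fun x => homOfKill (mem_kill.2 fun r hr => h𝔞0 r hr x)
        map_add' := fun x y => LinearMap.ext fun q => by
          obtain ⟨q, rfl⟩ := Ideal.Quotient.mk_surjective q
          rw [LinearMap.add_apply, homOfKill_mk, homOfKill_mk, homOfKill_mk]
          exact smul_add _ _ _
        map_smul' := fun c x => LinearMap.ext fun q => by
          obtain ⟨q, rfl⟩ := Ideal.Quotient.mk_surjective q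
          rw [RingHom.id_apply, LinearMap.smul_apply, homOfKill_mk, homOfKill_mk]
          exact smul_comm _ _ _ }
    let f : G →ₗ[R] (Q →ₗ[R] G) := (LinearMap.lcomp R G Q.subtype) ∘ₗ act
    have hf : LinearMap.ker f ≤ kill J G := by
      intro x hx
      refine mem_kill.2 fun s hs => ?_
      have := LinearMap.congr_fun (LinearMap.mem_ker.1 hx) ⟨𝔞.mkQ s, Submodule.mem_map_of_mem hs⟩
      exact this
    have hf' : kill J G ≤ LinearMap.ker f := by
      intro x hx
      rw [LinearMap.mem_ker]
      ext ⟨_, s, hs, rfl⟩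
      exact mem_kill.1 hx s hs
    exact Module.length_le_of_injective ((kill J G).liftQ f hf')
      (LinearMap.ker_eq_bot.1 (Submodule.ker_liftQ_eq_bot _ _ _ hf))
  have e1 : Module.length R G = Module.length R (kill J G) + Module.length R (G ⧸ kill J G) :=
    Module.length_eq_add_of_exact _ _ (Submodule.injective_subtype _) (Submodule.mkQ_surjective _)
      (LinearMap.exact_subtype_mkQ _)
  have hker : LinearMap.ker (Submodule.factor h𝔞J) = Q := by
    rw [Submodule.factor, Submodule.ker_mapQ]; simp [Q]
  have e2 : Module.length R (R ⧸ 𝔞) = Module.length R Q + Module.length R (R ⧸ J) :=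
    Module.length_eq_add_of_exact Q.subtype (Submodule.factor h𝔞J) Q.injective_subtype
      (Submodule.factor_surjective h𝔞J)
      (LinearMap.exact_iff.2 (by rw [hker, Submodule.range_subtype]))
  have e3 : Module.length R (R ⧸ 𝔞) ≤ Module.length R G := by
    have := h1 ⊤
    rwa [Module.length_top] at this
  have hQtop : Module.length R Q ≠ ⊤ := Module.length_ne_top_iff.2 hQfin
  have h4 : Module.length R (R ⧸ J) ≤ Module.length R (kill J G) := by
    rw [e1, e2] at e3
    have h5 := e3.trans (add_le_add_right h3 (Module.length R (kill J G)))
    rw [add_comm] at h5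
    exact (ENat.add_le_add_iff_right hQtop).1 h5
  set 𝔟 := Module.annihilator R (kill J G) with h𝔟
  have hJ𝔟 : J ≤ 𝔟 := fun s hs => Module.mem_annihilator.2 fun x =>
    Subtype.ext (mem_kill.1 x.2 s hs)
  have h5 : Module.length R (kill J G) ≤ Module.length R (R ⧸ 𝔟) := by
    refine le_trans ?_ (h2 𝔟 (hannfin _))
    refine Module.length_le_of_injective (Submodule.inclusion ?_) (Submodule.inclusion_injective _)
    intro x hx
    exact mem_kill.2 fun s hs =>
      congrArg Subtype.val (Module.mem_annihilator.1 hs (⟨x, hx⟩ : kill J G))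
  have hr𝔟 : r ∈ 𝔟 := Module.mem_annihilator.2 fun x => Subtype.ext (hr x.1 x.2)
  have h6 : Module.length R (R ⧸ J) ≠ ⊤ :=
    ne_top_of_le_ne_top (Module.length_ne_top_iff.2 (hannfin (kill J G))) (h4.trans h5)
  have e4 : Module.length R (R ⧸ J) =
      Module.length R (Submodule.map J.mkQ 𝔟) + Module.length R (R ⧸ 𝔟) :=
    Module.length_eq_add_of_exact (Submodule.map J.mkQ 𝔟).subtype (Submodule.factor hJ𝔟)
      (Submodule.injective_subtype _) (Submodule.factor_surjective hJ𝔟)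
      (LinearMap.exact_iff.2 (by
        rw [Submodule.range_subtype, Submodule.factor, Submodule.ker_mapQ]; simp))
  have h7 : Module.length R (Submodule.map J.mkQ 𝔟) = 0 := by
    have h8 := h4.trans h5
    rw [e4] at h8 h6
    have h9 : Module.length R (R ⧸ 𝔟) ≠ ⊤ := fun h => h6 (by rw [h, add_top])
    have : Module.length R (Submodule.map J.mkQ 𝔟) + Module.length R (R ⧸ 𝔟) ≤
        0 + Module.length R (R ⧸ 𝔟) := by
      rwa [zero_add]
    exact le_antisymm ((ENat.add_le_add_iff_right h9).1 this) bot_le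
  rw [Module.length_eq_zero_iff, Submodule.subsingleton_iff_eq_bot] at h7
  have : J.mkQ r ∈ Submodule.map J.mkQ 𝔟 := Submodule.mem_map_of_mem hr𝔟
  rw [h7, Submodule.mem_bot] at this
  exact (Submodule.Quotient.mk_eq_zero J).1 this

end DoubleAnnihilator
end LocCoh

namespace LocCoh

section Completion

theorem isNoetherianRing_of_isAdicComplete {S : Type*} [CommRing S] (𝔪 : Ideal S) [𝔪.IsMaximal]
    [IsAdicComplete 𝔪 S] (hfg : 𝔪.FG) : IsNoetherianRing S := by
  rw [isNoetherianRing_iff_ideal_fg]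
  by_contra! hcon
  obtain ⟨I₀, hI₀⟩ := hcon
  obtain ⟨Q, -, hQ⟩ := zorn_le_nonempty₀ {I : Ideal S | ¬ I.FG} (fun C hC hchain y hy => by
    refine ⟨sSup C, ?_, fun z hz => le_sSup hz⟩
    rintro ⟨G, hG⟩
    obtain ⟨J, hJC, hGJ⟩ : ∃ J ∈ C, (G : Set S) ⊆ J := by
      refine hchain.directedOn.exists_mem_subset_of_finset_subset_biUnion ⟨y, hy⟩ (fun _ hx ↦ ?_)
      simp only [Set.mem_iUnion, SetLike.mem_coe, exists_prop]
      exact (Submodule.mem_sSup_of_directed ⟨y, hy⟩ hchain.directedOn).1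
        (hG ▸ Submodule.subset_span hx)
    exact hC hJC ⟨G, le_antisymm (Submodule.span_le.2 hGJ) (hG ▸ le_sSup hJC)⟩) I₀ hI₀
  have hprime : Q.IsPrime := Ideal.isOka_fg.isPrime_of_maximal_not hQ
  have hQfg : ¬ Q.FG := hQ.prop
  obtain ⟨x, hx𝔪, hxQ⟩ : ∃ x ∈ 𝔪, x ∉ Q := by
    by_contra! h
    exact hQfg (Ideal.IsMaximal.eq_of_le ‹_› hprime.ne_top h ▸ hfg)
  have hsup : (Q ⊔ Ideal.span {x}).FG := by
    by_contra h
    exact hxQ (hQ.le_of_ge h le_sup_left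
      (Ideal.mem_sup_right (Ideal.mem_span_singleton_self x)))
  obtain ⟨r, f, hf⟩ := Submodule.fg_iff_exists_fin_generating_family.1 hsup
  have hf' : ∀ i, ∃ q ∈ Q, ∃ c, f i = q + c * x := by
    intro i
    have : f i ∈ Q ⊔ Ideal.span {x} := hf ▸ Submodule.subset_span ⟨i, rfl⟩
    obtain ⟨q, hq, b, hb, h⟩ := Submodule.mem_sup.1 this
    obtain ⟨c, rfl⟩ := Ideal.mem_span_singleton'.1 hb
    exact ⟨q, hq, c, h.symm⟩
  choose q hq c hc using hf'
  have step : ∀ y : Q, ∃ a : Fin r → S, ∃ y' : Q, (y : S) = ∑ i, a i * q i + x * y' := by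
    rintro ⟨y, hy⟩
    have : y ∈ Submodule.span S (Set.range f) := hf ▸ Submodule.mem_sup_left hy
    obtain ⟨a, ha⟩ := (Submodule.mem_span_range_iff_exists_fun S).1 this
    have e : y = ∑ i, a i * q i + x * ∑ i, a i * c i := by
      rw [← ha, Finset.mul_sum, ← Finset.sum_add_distrib]
      exact Finset.sum_congr rfl fun i _ => by rw [smul_eq_mul, hc i]; ring
    have hm : x * ∑ i, a i * c i ∈ Q := by
      rw [← sub_eq_iff_eq_add'.2 e]
      exact sub_mem hy (Ideal.sum_mem _ fun i _ => Ideal.mul_mem_left _ _ (hq i))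
    exact ⟨a, ⟨_, (hprime.mem_or_mem hm).resolve_left hxQ⟩, e⟩
  choose a nxt hstep using step
  classical
  refine hQfg ⟨Finset.univ.image q, le_antisymm ?_ ?_⟩
  · rw [Submodule.span_le]
    intro z hz
    obtain ⟨i, -, rfl⟩ := Finset.mem_image.1 hz
    exact hq i
  intro y hy
  let Y : ℕ → Q := fun n => nxt^[n] ⟨y, hy⟩
  let F : Fin r → ℕ → S := fun i n => ∑ k ∈ Finset.range n, x ^ k * a (Y k) i
  have hF : ∀ n, y = ∑ i, F i n * q i + x ^ n * Y n := by
    intro n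
    induction n with
    | zero => simp [F, Y]
    | succ n ih =>
      have h1 : ((Y n : Q) : S) = ∑ i, a (Y n) i * q i + x * (Y (n + 1) : Q) := by
        have h := hstep (Y n)
        rwa [show nxt (Y n) = Y (n + 1) from (Function.iterate_succ_apply' nxt n _).symm] at h
      have h2 : ∑ i, F i (n + 1) * q i = ∑ i, F i n * q i + x ^ n * ∑ i, a (Y n) i * q i := by
        rw [Finset.mul_sum, ← Finset.sum_add_distrib]
        refine Finset.sum_congr rfl fun i _ => ?_
        simp only [F, Finset.sum_range_succ]
        ring
      rw [ih, h2, h1]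
      ring
  have hx : ∀ n, x ^ n ∈ 𝔪 ^ n := fun n => Ideal.pow_mem_pow hx𝔪 n
  have hlim : ∀ i, ∃ L, ∀ n, F i n ≡ L [SMOD (𝔪 ^ n • ⊤ : Submodule S S)] := by
    intro i
    refine IsPrecomplete.prec' (I := 𝔪) (F i) fun {m n} hmn => ?_
    rw [SModEq.comm, SModEq.sub_mem, smul_eq_mul, Ideal.mul_top]
    simp only [F]
    rw [← Finset.sum_range_add_sum_Ico _ hmn, add_sub_cancel_left]
    refine Ideal.sum_mem _ fun k hk => Ideal.mul_mem_right _ _ ?_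
    exact Ideal.pow_le_pow_right (Finset.mem_Ico.1 hk).1 (hx k)
  choose L hL using hlim
  have hy0 : y - ∑ i, L i * q i = 0 := by
    refine IsHausdorff.haus' (I := 𝔪) _ fun n => ?_
    rw [SModEq.sub_mem, smul_eq_mul, Ideal.mul_top, sub_zero]
    have : y - ∑ i, L i * q i = ∑ i, (F i n - L i) * q i + x ^ n * Y n := by
      simp only [sub_mul, Finset.sum_sub_distrib]
      nth_rewrite 1 [hF n]
      ring
    rw [this]
    refine add_mem (Ideal.sum_mem _ fun i _ => Ideal.mul_mem_right _ _ ?_)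
      (Ideal.mul_mem_right _ _ (hx n))
    have := hL i n
    rwa [SModEq.sub_mem, smul_eq_mul, Ideal.mul_top] at this
  rw [sub_eq_zero.1 hy0]
  exact Ideal.sum_mem _ fun i _ => Ideal.mul_mem_left _ _ (Ideal.subset_span (by simp))

instance isNoetherianRing_adicCompletion (R : Type*) [CommRing R] [IsNoetherianRing R]
    [IsLocalRing R] : IsNoetherianRing (AdicCompletion (IsLocalRing.maximalIdeal R) R) :=
  isNoetherianRing_of_isAdicComplete
    (IsLocalRing.maximalIdeal (AdicCompletion (IsLocalRing.maximalIdeal R) R))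
    (by rw [AdicCompletion.maximalIdeal_eq_map]
        exact (IsLocalRing.maximalIdeal R).fg_of_isNoetherianRing.map _)

end Completion
end LocCoh

namespace LocCoh

section Height

variable {R S : Type*} [CommRing R] [CommRing S]

theorem exists_mem_height_add_one_le [IsNoetherianRing S] (f : R →+* S) (𝔞 : Ideal R) (J : Ideal S)
    (k : ℕ) (hJ : ∀ Q : Ideal S, Q.IsPrime → J ≤ Q → ¬ 𝔞.map f ≤ Q → (k : ℕ∞) ≤ Q.height) :
    ∃ x ∈ 𝔞, ∀ Q : Ideal S, Q.IsPrime → J ⊔ Ideal.span {f x} ≤ Q → ¬ 𝔞.map f ≤ Q →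
      ((k + 1 : ℕ) : ℕ∞) ≤ Q.height := by
  let s : Set (Ideal S) := {P | P ∈ J.minimalPrimes ∧ ¬ 𝔞.map f ≤ P}
  have hs : s.Finite := (J.finite_minimalPrimes_of_isNoetherianRing S).subset fun P h => h.1
  have hx : ∃ x ∈ 𝔞, ∀ P ∈ s, f x ∉ P := by
    by_contra! h
    have h' : ((𝔞 : Set R) ⊆ ⋃ P ∈ s, ((P.comap f : Ideal R) : Set R)) := by
      intro x hx
      obtain ⟨P, hP, hxP⟩ := h x hx
      exact Set.mem_iUnion₂.2 ⟨P, hP, hxP⟩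
    obtain ⟨P, hP, hle⟩ := (Ideal.subset_union_prime_finite hs ⊥ ⊥
      (fun P hP _ _ => by have := hP.1.1.1; exact Ideal.IsPrime.comap f)).1 h'
    exact hP.2 (Ideal.map_le_iff_le_comap.2 hle)
  obtain ⟨x, hx, hxs⟩ := hx
  refine ⟨x, hx, fun Q hQ hle h𝔞 => ?_⟩
  obtain ⟨P, hP, hPQ⟩ := Ideal.exists_minimalPrimes_le (le_sup_left.trans hle)
  have hPp := hP.1.1
  have hP𝔞 : ¬ 𝔞.map f ≤ P := fun h => h𝔞 (h.trans hPQ)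
  have hlt : P < Q := lt_of_le_of_ne hPQ fun h => hxs P ⟨hP, hP𝔞⟩
    (h ▸ hle (le_sup_right (a := J) (Ideal.mem_span_singleton_self _)))
  refine le_trans ?_ (Ideal.height_add_one_le_of_lt_of_isPrime hlt)
  push_cast
  gcongr
  exact hJ P hPp hP.1.2 hP𝔞

theorem exists_fin_height_add_le [IsNoetherianRing S] (f : R →+* S) (𝔞 : Ideal R) (n : ℕ)
    (J : Ideal S)
    (k : ℕ) (hJ : ∀ Q : Ideal S, Q.IsPrime → J ≤ Q → ¬ 𝔞.map f ≤ Q → (k : ℕ∞) ≤ Q.height) :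
    ∃ w : Fin n → R, (∀ i, w i ∈ 𝔞) ∧ ∀ Q : Ideal S, Q.IsPrime →
      J ⊔ (Ideal.span (Set.range w)).map f ≤ Q → ¬ 𝔞.map f ≤ Q → ((k + n : ℕ) : ℕ∞) ≤ Q.height := by
  induction n generalizing J k with
  | zero =>
    refine ⟨fun i => i.elim0, fun i => i.elim0, fun Q hQ hle h𝔞 => ?_⟩
    exact hJ Q hQ (le_sup_left.trans hle) h𝔞
  | succ n ih =>
    obtain ⟨x, hx, h⟩ := exists_mem_height_add_one_le f 𝔞 J k hJ
    obtain ⟨w, hw, hw'⟩ := ih _ _ h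
    refine ⟨Fin.cons x w, fun i => ?_, fun Q hQ hle h𝔞 => ?_⟩
    · refine Fin.cases hx hw i
    · have := hw' Q hQ ?_ h𝔞
      · rwa [add_assoc, add_comm 1 n] at this
      · refine le_trans (le_of_eq ?_) hle
        rw [Fin.range_cons, Set.insert_eq, Ideal.span_union, Ideal.map_sup, Ideal.map_span f {x},
          Set.image_singleton, sup_assoc]

open IsLocalRing

theorem height_maximalIdeal_adicCompletion_le [IsNoetherianRing R] [IsLocalRing R]
    [IsNoetherianRing (AdicCompletion (maximalIdeal R) R)] {d : ℕ} (hd : ringKrullDim R = d) :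
    (maximalIdeal (AdicCompletion (maximalIdeal R) R)).height ≤ d := by
  classical
  obtain ⟨s, hs, hc⟩ := (maximalIdeal R).exists_finset_card_eq_height_of_isNoetherianRing
  have hd' : (s.card : ℕ∞) = d := by
    rw [hc]
    exact_mod_cast (maximalIdeal_height_eq_ringKrullDim (R := R)).trans hd
  set f := algebraMap R (AdicCompletion (maximalIdeal R) R) with hf
  have key : maximalIdeal (AdicCompletion (maximalIdeal R) R) ∈
      (Ideal.span ((s.image f : Finset (AdicCompletion (maximalIdeal R) R)) :
        Set (AdicCompletion (maximalIdeal R) R))).minimalPrimes := by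
    rw [Finset.coe_image, ← Ideal.map_span]
    have hle : (Ideal.span (s : Set R)).map f ≤
        maximalIdeal (AdicCompletion (maximalIdeal R) R) := by
      rw [AdicCompletion.maximalIdeal_eq_map]
      exact Ideal.map_mono hs.1.2
    refine ⟨⟨inferInstance, hle⟩, fun Q hQ hQle => ?_⟩
    have := hQ.1
    rw [AdicCompletion.maximalIdeal_eq_map]
    rw [Ideal.map_le_iff_le_comap]
    exact hs.2 ⟨Ideal.IsPrime.comap f, Ideal.map_le_iff_le_comap.1 hQ.2⟩
      (le_maximalIdeal (Ideal.IsPrime.ne_top (Ideal.IsPrime.comap f)))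
  refine (Ideal.height_le_card_of_mem_minimalPrimes_span_finset key).trans ?_
  rw [← hd']
  exact_mod_cast Finset.card_image_le

theorem exists_fin_le_radical_adicCompletion [IsNoetherianRing R] [IsLocalRing R]
    [IsNoetherianRing (AdicCompletion (maximalIdeal R) R)]
    [IsDomain (AdicCompletion (maximalIdeal R) R)] {n : ℕ} (hd : ringKrullDim R = (n + 1 : ℕ))
    (s : AdicCompletion (maximalIdeal R) R) (hs : s ≠ 0) :
    ∃ w : Fin n → R, (∀ i, w i ∈ maximalIdeal R) ∧
      (maximalIdeal R).map (algebraMap R (AdicCompletion (maximalIdeal R) R)) ≤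
      (Ideal.span {s} ⊔ (Ideal.span (Set.range w)).map
        (algebraMap R (AdicCompletion (maximalIdeal R) R))).radical := by
  obtain ⟨w, hw, h⟩ := exists_fin_height_add_le
    (algebraMap R (AdicCompletion (maximalIdeal R) R)) (maximalIdeal R) n (Ideal.span {s}) 1 (by
      intro Q hQ hle _
      rw [Nat.cast_one, Order.one_le_iff_ne_zero, Ne, Ideal.height_eq_zero_iff_eq_bot]
      rintro rfl
      exact hs (hle (Ideal.mem_span_singleton_self s)))
  refine ⟨w, hw, ?_⟩
  rw [Ideal.radical_eq_sInf]
  refine le_sInf fun Q hQ => ?_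
  by_contra hcon
  have := hQ.2
  have h1 := h Q hQ.2 hQ.1 hcon
  have hlt : Q < maximalIdeal _ := lt_of_le_of_ne (le_maximalIdeal hQ.2.ne_top) (by
    rintro rfl
    exact hcon AdicCompletion.maximalIdeal_eq_map.ge)
  have h2 := (Ideal.height_add_one_le_of_lt_of_isPrime hlt).trans
    (height_maximalIdeal_adicCompletion_le hd)
  have h3 : ((1 + n : ℕ) : ℕ∞) + 1 ≤ (n + 1 : ℕ) := le_trans (by gcongr) h2
  norm_cast at h3
  omega

theorem exists_fin_and_ideal_of_le [IsNoetherianRing R] [IsLocalRing R] {n : ℕ}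
    (hd : ringKrullDim R = (n + 1 : ℕ)) (J : Ideal R) :
    ∃ y : Fin n → R, (∀ i, y i ∈ J) ∧ ∃ 𝔟 : Ideal R,
      J ⊓ 𝔟 ≤ (Ideal.span (Set.range y)).radical ∧ maximalIdeal R ≤ (J ⊔ 𝔟).radical := by
  obtain ⟨y, hy, h⟩ := exists_fin_height_add_le (RingHom.id R) J n ⊥ 0 (by simp)
  simp only [Ideal.map_id, bot_sup_eq, zero_add] at h
  let s : Set (Ideal R) := {P | P ∈ (Ideal.span (Set.range y)).minimalPrimes ∧ ¬ J ≤ P}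
  have hs : s.Finite :=
    ((Ideal.span (Set.range y)).finite_minimalPrimes_of_isNoetherianRing R).subset fun P h => h.1
  refine ⟨y, hy, sInf s, ?_, ?_⟩
  · rw [← Ideal.sInf_minimalPrimes]
    refine le_sInf fun P hP => ?_
    by_cases hJ : J ≤ P
    · exact inf_le_left.trans hJ
    · exact inf_le_right.trans (sInf_le ⟨hP, hJ⟩)
  · rw [Ideal.radical_eq_sInf]
    refine le_sInf fun P hP => ?_
    have := hP.2
    obtain ⟨Q, hQ, hQP⟩ : ∃ Q ∈ s, Q ≤ P := by
      have : hs.toFinset.inf id ≤ P := by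
        rw [Finset.inf_id_eq_sInf]; simpa using le_sup_right.trans hP.1
      obtain ⟨Q, hQ, h⟩ := (Ideal.IsPrime.inf_le' hP.2).1 this
      exact ⟨Q, hs.mem_toFinset.1 hQ, h⟩
    have := hQ.1.1.1
    have hlt : Q < P := lt_of_le_of_ne hQP fun e => hQ.2 (e ▸ le_sup_left.trans hP.1)
    by_contra hcon
    have hlt' : P < maximalIdeal R := lt_of_le_of_ne (le_maximalIdeal hP.2.ne_top) (by
      rintro rfl
      exact hcon le_rfl)
    have h1 := Ideal.height_add_one_le_of_lt_of_isPrime hlt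
    have h2 := Ideal.height_add_one_le_of_lt_of_isPrime hlt'
    have h0 := h Q hQ.1.1.1 hQ.1.1.2 hQ.2
    have h3 : (maximalIdeal R).height = ((n + 1 : ℕ) : ℕ∞) := by
      exact_mod_cast (maximalIdeal_height_eq_ringKrullDim (R := R)).trans hd
    rw [h3] at h2
    have h4 : (n : ℕ∞) + 1 + 1 ≤ (n + 1 : ℕ) :=
      le_trans (by gcongr) ((add_le_add h1 le_rfl).trans h2)
    norm_cast at h4
    omega

theorem not_maximalIdeal_le_radical_sup [IsNoetherianRing R] [IsLocalRing R] (I : Ideal R)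
    (h2 : 2 ≤ ringKrullDim (R ⧸ I)) {x : R} (hx : x ∈ maximalIdeal R) :
    ¬ maximalIdeal R ≤ (I ⊔ Ideal.span {x}).radical := by
  intro hle
  have hI : I ≠ ⊤ := by
    rintro rfl
    have : Subsingleton (R ⧸ (⊤ : Ideal R)) := Ideal.Quotient.subsingleton_iff.2 rfl
    rw [ringKrullDim_eq_bot_of_subsingleton] at h2
    exact absurd h2 (by simp)
  have := Ideal.Quotient.nontrivial_iff.2 hI
  have : IsLocalRing (R ⧸ I) := IsLocalRing.of_surjective' _ Ideal.Quotient.mk_surjective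
  have hmem : maximalIdeal (R ⧸ I) ∈ (Ideal.span {Ideal.Quotient.mk I x}).minimalPrimes := by
    refine ⟨⟨inferInstance, ?_⟩, fun Q hQ _ => ?_⟩
    · rw [Ideal.span_singleton_le_iff_mem]
      have : IsLocalHom (Ideal.Quotient.mk I) :=
        IsLocalHom.of_surjective _ Ideal.Quotient.mk_surjective
      have hle' : (maximalIdeal R).map (Ideal.Quotient.mk I) ≤ maximalIdeal (R ⧸ I) :=
        ((local_hom_TFAE (Ideal.Quotient.mk I)).out 0 2).1 this
      exact hle' (Ideal.mem_map_of_mem _ hx)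
    · have hQp := hQ.1
      have h1 : maximalIdeal R ≤ Q.comap (Ideal.Quotient.mk I) := by
        refine hle.trans ((Ideal.IsPrime.radical_le_iff (Ideal.IsPrime.comap _)).2 (sup_le ?_ ?_))
        · intro a ha
          rw [Ideal.mem_comap, Ideal.Quotient.eq_zero_iff_mem.2 ha]
          exact Q.zero_mem
        · rw [Ideal.span_singleton_le_iff_mem]
          exact hQ.2 (Ideal.mem_span_singleton_self _)
      have h3 : maximalIdeal (R ⧸ I) = (maximalIdeal R).map (Ideal.Quotient.mk I) := by
        have : IsLocalHom (Ideal.Quotient.mk I) :=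
          IsLocalHom.of_surjective _ Ideal.Quotient.mk_surjective
        refine le_antisymm ?_ (((local_hom_TFAE (Ideal.Quotient.mk I)).out 0 2).1 this)
        rw [← Ideal.map_comap_of_surjective _ Ideal.Quotient.mk_surjective (maximalIdeal (R ⧸ I))]
        exact Ideal.map_mono (le_maximalIdeal (Ideal.IsPrime.ne_top (Ideal.IsPrime.comap _)))
      rw [h3, Ideal.map_le_iff_le_comap]
      exact h1
  have h := Ideal.height_le_one_of_isPrincipal_of_mem_minimalPrimes _ _ hmem
  have h' := maximalIdeal_height_eq_ringKrullDim (R := R ⧸ I)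
  rw [← h'] at h2
  have : (2 : ℕ∞) ≤ 1 := by
    refine le_trans ?_ h
    exact WithBot.coe_le_coe.1 h2
  norm_num at this

end Height
end LocCoh

namespace LocCoh

section FiniteLength

variable {R : Type u} [CommRing R] {N : Type u} [AddCommGroup N] [Module R N]

open IsLocalRing in
theorem isArtinian_of_finite_of_kill [IsLocalRing R] [Module.Finite R N]
    (h : ∀ x : N, x ∈ kill (maximalIdeal R) N) : IsArtinian R N := by
  obtain ⟨s, x, hx⟩ := Submodule.fg_iff_exists_fin_generating_family.1
    (Module.Finite.fg_top (R := R) (M := N))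
  have : IsSimpleModule R (R ⧸ maximalIdeal R) :=
    isSimpleModule_iff_isCoatom.2 (Ideal.isMaximal_def.1 inferInstance)
  have : IsArtinian R (R ⧸ maximalIdeal R) := inferInstance
  let f : (Fin s → R ⧸ maximalIdeal R) →ₗ[R] N :=
    LinearMap.lsum R (fun _ => R ⧸ maximalIdeal R) ℕ fun i => homOfKill (h (x i))
  refine isArtinian_of_surjective _ f ?_
  rw [← LinearMap.range_eq_top, eq_top_iff, ← hx, Submodule.span_le]
  rintro _ ⟨i, rfl⟩
  refine ⟨Pi.single i (Ideal.Quotient.mk _ 1), ?_⟩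
  rw [LinearMap.lsum_piSingle, homOfKill_mk, one_smul]

variable [IsNoetherianRing R]

theorem isNoetherian_kill_pow (J : Ideal R) [h : IsNoetherian R (kill J N)] (n : ℕ) :
    IsNoetherian R (kill (J ^ n) N) := by
  induction n with
  | zero =>
    rw [pow_zero, Ideal.one_eq_top, kill_top]
    infer_instance
  | succ n ih =>
    obtain ⟨s, z, hsz⟩ :=
      Submodule.fg_iff_exists_fin_generating_family.1 (IsNoetherian.noetherian J)
    have hzJ : ∀ i, z i ∈ J := fun i => hsz ▸ Submodule.subset_span ⟨i, rfl⟩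
    let f : kill (J ^ (n + 1)) N →ₗ[R] (Fin s → kill (J ^ n) N) :=
      LinearMap.pi fun i => LinearMap.codRestrict _
        (LinearMap.lsmul R N (z i) ∘ₗ Submodule.subtype _)
        fun x => by
          have h1 : x.1 ∈ kill (J * J ^ n) N := by rw [← pow_succ']; exact x.2
          exact mem_kill_mul.1 h1 _ (hzJ i)
    let g : kill J N →ₗ[R] kill (J ^ (n + 1)) N :=
      Submodule.inclusion (by simpa using kill_pow_mono J (N := N) (Nat.le_add_left 1 n))
    have hf : LinearMap.range g = LinearMap.ker f := by
      ext x
      constructor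
      · rintro ⟨y, rfl⟩
        rw [LinearMap.mem_ker]
        ext i
        exact mem_kill.1 y.2 _ (hzJ i)
      · intro hx
        refine ⟨⟨x.1, ?_⟩, rfl⟩
        have h0 : ∀ i, z i • x.1 = 0 := fun i =>
          congrArg Subtype.val (congrFun (LinearMap.mem_ker.1 hx) i)
        have : J ≤ LinearMap.ker (LinearMap.toSpanSingleton R N x.1) := by
          refine hsz.ge.trans (Submodule.span_le.2 ?_)
          rintro _ ⟨i, rfl⟩
          exact h0 i
        exact mem_kill.2 fun r hr => this hr
    exact isNoetherian_of_range_eq_ker g f hf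

open IsLocalRing

theorem isArtinian_of_finite_of_gam [IsLocalRing R] [Module.Finite R N]
    (h : ∀ x : N, x ∈ gam (maximalIdeal R) N) : IsArtinian R N := by
  have : IsArtinian R (kill (maximalIdeal R) N) :=
    isArtinian_of_finite_of_kill fun x => mem_kill.2 fun r hr =>
      Subtype.ext (mem_kill.1 x.2 r hr)
  exact isArtinian_of_kill (maximalIdeal R) h

instance isArtinian_quotient_pow [IsLocalRing R] (j : ℕ) :
    IsArtinian R (R ⧸ maximalIdeal R ^ j) := by
  refine isArtinian_of_finite_of_gam fun x => ⟨j, mem_kill.2 fun r hr => ?_⟩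
  obtain ⟨y, rfl⟩ := Ideal.Quotient.mk_surjective x
  rw [← Ideal.Quotient.mk_eq_mk, ← Submodule.Quotient.mk_smul]
  exact (Submodule.Quotient.mk_eq_zero _).2 (Ideal.mul_mem_right _ _ hr)

end FiniteLength

section MittagLeffler

open IsLocalRing

variable {R : Type u} [CommRing R] [IsNoetherianRing R] [IsLocalRing R]

/-- A Mittag-Leffler argument: cosets of a decreasing sequence of ideals contain a compatible
sequence. -/
theorem exists_adicCauchy (p : Ideal R) (b : ℕ → Ideal R) (hb : Antitone b) (z : R)
    (hz : ∀ j, ∃ s ∈ b j, z - s ∈ p) :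
    ∃ s : ℕ → R, (∀ j, s j ∈ b j ∧ z - s j ∈ p) ∧ ∀ j, s (j + 1) - s j ∈ maximalIdeal R ^ j := by
  have hst : ∀ j, ∃ n, ∀ i, n ≤ i → ∀ a ∈ p ⊓ b n, a ∈ (p ⊓ b i) ⊔ maximalIdeal R ^ j := by
    intro j
    let f : ℕ →o (Submodule R (R ⧸ maximalIdeal R ^ j))ᵒᵈ :=
      ⟨fun i => OrderDual.toDual (Submodule.map (maximalIdeal R ^ j).mkQ (p ⊓ b i)), fun i k h =>
        Submodule.map_mono (inf_le_inf_left p (hb h))⟩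
    obtain ⟨n, hn⟩ := IsArtinian.monotone_stabilizes f
    refine ⟨n, fun i hi a ha => ?_⟩
    have h1 : Submodule.map (maximalIdeal R ^ j).mkQ (p ⊓ b n) =
      Submodule.map (maximalIdeal R ^ j).mkQ (p ⊓ b i) := hn i hi
    obtain ⟨a', ha', he⟩ := h1.le (Submodule.mem_map_of_mem ha)
    have := (Submodule.Quotient.eq _).1 he.symm
    exact Submodule.mem_sup.2 ⟨a', ha', a - a', this, by ring⟩
  choose n hn using hst
  let i : ℕ → ℕ := fun j => (∑ k ∈ Finset.range (j + 1), n k) + j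
  have hin : ∀ j, n j ≤ i j := fun j => by
    have := Finset.single_le_sum (f := n) (fun _ _ => Nat.zero_le _) (Finset.self_mem_range_succ j)
    exact this.trans (Nat.le_add_right _ _)
  have hi1 : ∀ j, i j ≤ i (j + 1) := fun j => by
    have : i (j + 1) = (∑ k ∈ Finset.range (j + 1), n k) + n (j + 1) + (j + 1) := by
      simp only [i]; rw [Finset.sum_range_succ]
    simp only [this, i]; omega
  have hij : ∀ j, j ≤ i j := fun j => Nat.le_add_left _ _
  have step : ∀ j, ∀ s : {s : R // s ∈ b (i j) ∧ z - s ∈ p},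
      ∃ t : {s : R // s ∈ b (i (j + 1)) ∧ z - s ∈ p}, t.1 - s.1 ∈ maximalIdeal R ^ j := by
    rintro j ⟨s, hs, hs'⟩
    obtain ⟨t, ht, ht'⟩ := hz (i (j + 1))
    have h1 : s - t ∈ p ⊓ b (n j) := by
      refine ⟨?_, sub_mem (hb (hin j) hs) (hb ((hin j).trans (hi1 j)) ht)⟩
      have := sub_mem ht' hs'
      rwa [sub_sub_sub_cancel_left] at this
    obtain ⟨a, ha, c, hc, hac⟩ :=
      Submodule.mem_sup.1 (hn j (i (j + 1)) ((hin j).trans (hi1 j)) _ h1)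
    refine ⟨⟨t + a, add_mem ht ha.2, ?_⟩, ?_⟩
    · rw [← sub_sub]; exact sub_mem ht' ha.1
    · have : t + a - s = -c := by linear_combination hac
      rw [this]
      exact neg_mem hc
  choose g hg using step
  obtain ⟨s0, hs0⟩ := hz (i 0)
  let s : ∀ j, {s : R // s ∈ b (i j) ∧ z - s ∈ p} := fun j => Nat.rec ⟨s0, hs0⟩ (fun j s => g j s) j
  exact ⟨fun j => (s j).1, fun j => ⟨hb (hij j) (s j).2.1, (s j).2.2⟩, fun j => hg j (s j)⟩

theorem mem_of_forall_mem_sup_pow (p : Ideal R) (z : R)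
    (hz : ∀ j, z ∈ p ⊔ maximalIdeal R ^ j) : z ∈ p := by
  have h := Ideal.iInf_pow_smul_eq_bot_of_isLocalRing (M := R ⧸ p) (maximalIdeal R)
    (Ideal.IsPrime.ne_top inferInstance)
  rw [← Ideal.Quotient.eq_zero_iff_mem, ← Submodule.mem_bot R, ← h, Submodule.mem_iInf]
  intro j
  obtain ⟨a, ha, c, hc, rfl⟩ := Submodule.mem_sup.1 (hz j)
  rw [map_add, Ideal.Quotient.eq_zero_iff_mem.2 ha, zero_add]
  have : Ideal.Quotient.mk p c = c • (1 : R ⧸ p) := by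
    rw [Algebra.smul_def, mul_one]; rfl
  rw [this]
  exact Submodule.smul_mem_smul hc trivial

end MittagLeffler

section KeyLemma

open IsLocalRing

/-- For every `b : B` and every system of parameters `w, q` of length `n + 1`, there is a bound `c`
such that `b` is divisible by all powers of `q` by elements killed by `(w) ^ c`. -/
def ParamDivisible (R : Type u) [CommRing R] [IsLocalRing R] (n : ℕ) (B : Type u) [AddCommGroup B]
    [Module R B] : Prop :=
  ∀ (w : Fin n → R) (q : R), (∀ i, w i ∈ maximalIdeal R) → q ∈ maximalIdeal R →
    maximalIdeal R ≤ (Ideal.span (Set.range w) ⊔ Ideal.span {q}).radical →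
    ∀ b : B, ∃ c, ∀ i : ℕ, ∃ b' ∈ kill (Ideal.span (Set.range w) ^ c) B, q ^ i • b' = b

variable {R : Type u} [CommRing R] [IsNoetherianRing R] [IsLocalRing R]

theorem exists_seq_of_socle {G : Type u} [AddCommGroup G] [Module R G] [IsArtinian R G] (g₀ : G)
    (hs : ∀ x ∈ kill (maximalIdeal R) G, ∃ r : R, x = r • g₀)
    (hg₀ : g₀ ∈ kill (maximalIdeal R) G) (p : Ideal R) (z : R)
    (hz : ∀ x ∈ kill p G, z • x = 0) :
    ∃ s : ℕ → R, (∀ j, z - s j ∈ p) ∧ (∀ j, s (j + 1) - s j ∈ maximalIdeal R ^ j) ∧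
      ∀ j, ∀ x ∈ kill (maximalIdeal R ^ j) G, s j • x = 0 := by
  have hn1 : IsNoetherian R (kill (maximalIdeal R) G) := by
    have hle : kill (maximalIdeal R) G ≤ Submodule.span R {g₀} := fun x hx => by
      obtain ⟨r, rfl⟩ := hs x hx
      exact Submodule.mem_span_singleton.2 ⟨r, rfl⟩
    exact isNoetherian_of_le hle
  let b : ℕ → Ideal R := fun j => Module.annihilator R (kill (maximalIdeal R ^ j) G)
  have hmem : ∀ j r, r ∈ b j ↔ ∀ x ∈ kill (maximalIdeal R ^ j) G, r • x = 0 := by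
    intro j r
    simp only [b, Module.mem_annihilator]
    exact ⟨fun h x hx => congrArg Subtype.val (h ⟨x, hx⟩), fun h x => Subtype.ext (h x.1 x.2)⟩
  have hb : Antitone b := fun i j h r hr => (hmem i r).2 fun x hx =>
    (hmem j r).1 hr x (kill_pow_mono _ h hx)
  have key : ∀ j, ∃ s ∈ b j, z - s ∈ p := by
    intro j
    by_cases hj : j = 0
    · subst hj
      refine ⟨z, (hmem 0 z).2 fun x hx => ?_, by simp⟩
      rw [pow_zero, Ideal.one_eq_top, kill_top] at hx
      rw [(Submodule.mem_bot R).1 hx, smul_zero]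
    have hnj := isNoetherian_kill_pow (N := G) (maximalIdeal R) j
    have h1 : z ∈ p ⊔ b j := by
      have hg₁ : g₀ ∈ kill (maximalIdeal R ^ j) G :=
        kill_anti (Ideal.pow_le_self hj) hg₀
      refine mem_of_forall_smul_kill_eq_zero (G := kill (maximalIdeal R ^ j) G)
        ⟨g₀, hg₁⟩ ?_ ?_ _ ?_ _ ?_
      · intro x hx
        obtain ⟨r, hr⟩ := hs x.1 (map_mem_kill (Submodule.subtype _) hx)
        exact ⟨r, Subtype.ext hr⟩
      · exact mem_kill_of_injective (Submodule.subtype _) (Submodule.injective_subtype _) hg₀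
      · intro r hr
        exact le_sup_right (a := p) (Module.mem_annihilator.2 hr)
      · intro x hx
        refine Subtype.ext (hz x.1 (map_mem_kill (Submodule.subtype _) (kill_anti le_sup_left hx)))
    obtain ⟨a, ha, s, hs, hz⟩ := Submodule.mem_sup.1 h1
    exact ⟨s, hs, by rwa [← hz, add_sub_cancel_right]⟩
  obtain ⟨s, hs1, hs2⟩ := exists_adicCauchy p b hb z key
  exact ⟨s, fun j => (hs1 j).2, hs2, fun j => (hmem j _).1 (hs1 j).1⟩

theorem exists_params_of_seq [IsDomain (AdicCompletion (maximalIdeal R) R)] {n : ℕ}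
    (hd : ringKrullDim R = (n + 1 : ℕ)) (p : Ideal R) (z : R) (hzp : z ∉ p) (s : ℕ → R)
    (hs : ∀ j, z - s j ∈ p) (hs' : ∀ j, s (j + 1) - s j ∈ maximalIdeal R ^ j) :
    ∃ w : Fin n → R, (∀ i, w i ∈ maximalIdeal R) ∧ ∀ c, ∃ e, ∀ N, maximalIdeal R ^ e ≤
      Ideal.span {s N} ⊔ Ideal.span (Set.range w) ^ c ⊔ maximalIdeal R ^ N := by
  have hcoh : ∀ j, s j ≡ s (j + 1) [SMOD (maximalIdeal R ^ j • ⊤ : Ideal R)] := by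
    intro j
    rw [SModEq.sub_mem, smul_eq_mul, Ideal.mul_top, ← neg_mem_iff, neg_sub]
    exact hs' j
  let σ : AdicCompletion (maximalIdeal R) R :=
    AdicCompletion.mk _ _ (AdicCompletion.AdicCauchySequence.mk (maximalIdeal R) R s hcoh)
  have hσ : ∀ j, AdicCompletion.evalₐ (maximalIdeal R) j σ =
      Ideal.Quotient.mk _ (s j) := fun j => by
    rw [AdicCompletion.evalₐ_mk]; rfl
  have hσ0 : σ ≠ 0 := by
    intro h0
    refine hzp (mem_of_forall_mem_sup_pow p z fun j => ?_)
    have h1 := hσ j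
    rw [h0, map_zero] at h1
    have h2 : s j ∈ maximalIdeal R ^ j := Ideal.Quotient.eq_zero_iff_mem.1 h1.symm
    exact Submodule.mem_sup.2 ⟨z - s j, hs j, s j, h2, by ring⟩
  obtain ⟨w, hw, hle⟩ := exists_fin_le_radical_adicCompletion hd σ hσ0
  refine ⟨w, hw, fun c => ?_⟩
  set W := Ideal.span (Set.range w)
  set f := algebraMap R (AdicCompletion (maximalIdeal R) R) with hf
  have h1 : (maximalIdeal R).map f ≤ (Ideal.span {σ} ⊔ (W ^ c).map f).radical := by
    refine hle.trans ?_
    rw [Ideal.radical_eq_sInf, Ideal.radical_eq_sInf]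
    refine le_sInf fun Q hQ => sInf_le ⟨sup_le (le_sup_left.trans hQ.1) ?_, hQ.2⟩
    have h2 := le_sup_right.trans hQ.1
    rw [Ideal.map_pow] at h2
    have := hQ.2
    exact Ideal.IsPrime.le_of_pow_le h2
  obtain ⟨e, he⟩ := Ideal.exists_pow_le_of_le_radical_of_fg h1 (IsNoetherian.noetherian _)
  refine ⟨e, fun N a ha => ?_⟩
  rw [← Ideal.map_pow] at he
  obtain ⟨x, hx, y, hy, hxy⟩ := Submodule.mem_sup.1 (he (Ideal.mem_map_of_mem f ha))
  obtain ⟨x, rfl⟩ := Ideal.mem_span_singleton'.1 hx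
  obtain ⟨x', hx'⟩ := Ideal.Quotient.mk_surjective (AdicCompletion.evalₐ (maximalIdeal R) N x)
  have hy' : AdicCompletion.evalₐ (maximalIdeal R) N y ∈ (W ^ c).map (Ideal.Quotient.mk _) := by
    have := Ideal.mem_map_of_mem (AdicCompletion.evalₐ (maximalIdeal R) N).toRingHom hy
    have hcomp : (AdicCompletion.evalₐ (maximalIdeal R) N).toRingHom.comp f =
        Ideal.Quotient.mk (maximalIdeal R ^ N) :=
      RingHom.ext fun r => (AdicCompletion.evalₐ (maximalIdeal R) N).commutes r
    rwa [Ideal.map_map, hcomp] at this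
  obtain ⟨y', hy', hyy⟩ := (Ideal.mem_map_iff_of_surjective _ Ideal.Quotient.mk_surjective).1 hy'
  have h3 : Ideal.Quotient.mk (maximalIdeal R ^ N) (x' * s N + y') = Ideal.Quotient.mk _ a := by
    rw [map_add, map_mul, hx', hyy, ← hσ N, ← map_mul, ← map_add, hxy]
    exact (AdicCompletion.evalₐ (maximalIdeal R) N).commutes a
  have h4 := Ideal.Quotient.eq.1 h3.symm
  have h5 : a = (x' * s N + y') + (a - (x' * s N + y')) := by ring
  rw [h5]
  exact Submodule.add_mem_sup (Submodule.add_mem_sup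
    (Ideal.mem_span_singleton'.2 ⟨x', rfl⟩) hy') h4

/-- Key vanishing lemma: a consequence of the Hartshorne-Lichtenbaum circle of ideas. -/
theorem eq_zero_of_paramDivisible [IsDomain (AdicCompletion (maximalIdeal R) R)] {n : ℕ}
    (hd : ringKrullDim R = (n + 1 : ℕ)) {A H : Type u} [AddCommGroup A] [Module R A]
    [AddCommGroup H] [Module R H] [IsArtinian R A] (hA : ∀ x : A, x ∈ gam (maximalIdeal R) A)
    (φ : A →ₗ[R] H) (hφ : Function.Surjective φ) (hH : ParamDivisible R n H) (p : Ideal R)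
    (hp : p ≤ maximalIdeal R) (z : R) (hzm : z ∈ maximalIdeal R) (hz : ∀ k, z ^ k ∉ p)
    (hzk : ∀ n, ∃ k, ∀ x ∈ kill (p ^ n) A, φ (z ^ k • x) = 0) (y : H) : y = 0 := by
  obtain ⟨h, rfl⟩ := hφ y
  by_contra hh
  obtain ⟨K, hKφ, hK⟩ : ∃ K, LinearMap.ker φ ≤ K ∧ Maximal (fun K : Submodule R A => h ∉ K) K := by
    refine zorn_le_nonempty₀ {K : Submodule R A | h ∉ K} ?_ (LinearMap.ker φ) hh
    intro c hc hchain K hK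
    refine ⟨sSup c, ?_, fun L hL => le_sSup hL⟩
    intro hmem
    obtain ⟨L, hL, hhL⟩ := (Submodule.mem_sSup_of_directed ⟨K, hK⟩ hchain.directedOn).1 hmem
    exact hc hL hhL
  have hhK : h ∉ K := hK.1
  have hmax : ∀ x ∉ K, ∃ r : R, h - r • x ∈ K := by
    intro x hx
    have : h ∈ K ⊔ Submodule.span R {x} := by
      by_contra hcon
      have := hK.2 (y := K ⊔ Submodule.span R {x}) hcon le_sup_left
      exact hx (this (Submodule.mem_sup_right (Submodule.mem_span_singleton_self x)))
    obtain ⟨a, ha, b, hb, hab⟩ := Submodule.mem_sup.1 this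
    obtain ⟨r, rfl⟩ := Submodule.mem_span_singleton.1 hb
    exact ⟨r, by rwa [← hab, add_sub_cancel_right]⟩
  let ψ := K.mkQ
  have hψ0 : ∀ x, ψ x = 0 ↔ x ∈ K := fun x => Submodule.Quotient.mk_eq_zero K
  have hsoc : ∀ g ∈ kill (maximalIdeal R) (A ⧸ K), g ≠ 0 → ∃ r : R, IsUnit r ∧ ψ h = r • g := by
    intro g hg hg0
    obtain ⟨x, rfl⟩ := K.mkQ_surjective g
    obtain ⟨r, hr⟩ := hmax x fun hx => hg0 ((hψ0 x).2 hx)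
    have hr' : ψ h = r • ψ x := by
      rw [← map_smul, ← sub_eq_zero, ← map_sub]; exact (hψ0 _).2 hr
    refine ⟨r, ?_, hr'⟩
    by_contra hu
    exact hhK ((hψ0 h).1 (hr'.trans (mem_kill.1 hg r ((mem_maximalIdeal r).2 hu))))
  obtain ⟨g₀, hg₀, hs⟩ : ∃ g₀ ∈ kill (maximalIdeal R) (A ⧸ K),
      ∀ x ∈ kill (maximalIdeal R) (A ⧸ K), ∃ r : R, x = r • g₀ := by
    by_cases hne : ∀ x ∈ kill (maximalIdeal R) (A ⧸ K), x = 0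
    · exact ⟨0, zero_mem _, fun x hx => ⟨0, by rw [hne x hx, zero_smul]⟩⟩
    · push Not at hne
      obtain ⟨g, hg, hg0⟩ := hne
      refine ⟨ψ h, ?_, fun x hx => ?_⟩
      · obtain ⟨r, -, hr⟩ := hsoc g hg hg0
        rw [hr]; exact Submodule.smul_mem _ _ hg
      · by_cases hx0 : x = 0
        · exact ⟨0, by rw [hx0, zero_smul]⟩
        · obtain ⟨r, hu, hr⟩ := hsoc x hx hx0
          exact ⟨(hu.unit⁻¹ : Rˣ), by rw [hr, smul_smul, IsUnit.val_inv_mul, one_smul]⟩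
  obtain ⟨m, hm⟩ := dual_artin_rees p K
  obtain ⟨k, hk⟩ := hzk m
  have hzG : ∀ x ∈ kill p (A ⧸ K), z ^ (k + 1) • x = 0 := by
    intro x hx
    obtain ⟨x, rfl⟩ := K.mkQ_surjective x
    have h1 : x ∈ K ⊔ kill (p ^ m) A := hm x fun r hr => (hψ0 _).1 (by
      rw [map_smul]; exact mem_kill.1 hx r hr)
    obtain ⟨a, ha, b, hb, rfl⟩ := Submodule.mem_sup.1 h1
    have h2 : z ^ k • b ∈ K := hKφ (hk b hb)
    rw [← map_smul]
    refine (hψ0 _).2 ?_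
    rw [smul_add, pow_succ', mul_smul z _ b]
    exact add_mem (Submodule.smul_mem _ _ ha) (Submodule.smul_mem _ _ h2)
  obtain ⟨s, hs1, hs2, hs3⟩ := exists_seq_of_socle g₀ hs hg₀ p (z ^ (k + 1)) hzG
  have hsm : ∀ j, s j ∈ maximalIdeal R := fun j => by
    have h1 : z ^ (k + 1) ∈ maximalIdeal R := Ideal.pow_mem_of_mem _ hzm _ k.succ_pos
    have := sub_mem h1 (hp (hs1 j))
    rwa [sub_sub_cancel] at this
  obtain ⟨w, hw, hwe⟩ := exists_params_of_seq hd p (z ^ (k + 1)) (hz _) s hs1 hs2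
  set W := Ideal.span (Set.range w)
  obtain ⟨e, he⟩ := hwe 1
  obtain ⟨q, hqs⟩ : ∃ q, q = s (e + 1) := ⟨_, rfl⟩
  have hqm : q ∈ maximalIdeal R := hqs ▸ hsm _
  have hq : maximalIdeal R ^ e ≤ Ideal.span {q} ⊔ W := by
    rw [hqs]
    refine Submodule.le_of_le_smul_of_le_jacobson_bot (I := maximalIdeal R)
      (IsNoetherian.noetherian _) ?_ ?_
    · rw [jacobson_eq_maximalIdeal _ bot_ne_top]
    · refine (he (e + 1)).trans ?_
      rw [pow_one, smul_eq_mul, ← pow_succ']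
  obtain ⟨c, hc⟩ := hH w q hw hqm (by
    intro r hr
    refine ⟨e, ?_⟩
    rw [sup_comm]
    exact hq (Ideal.pow_mem_pow hr e)) (φ h)
  obtain ⟨e', he'⟩ := hwe c
  obtain ⟨b', hb', hqb⟩ := hc e'
  obtain ⟨h', rfl⟩ := hφ b'
  obtain ⟨N, hN⟩ := hA h'
  have hN' : ψ h' ∈ kill (maximalIdeal R ^ N) (A ⧸ K) := map_mem_kill ψ hN
  have h1 : ∀ r ∈ maximalIdeal R ^ e', r • ψ h' = 0 := by
    intro r hr
    obtain ⟨x₁, hx₁, v, hv, rfl⟩ := Submodule.mem_sup.1 (he' N hr)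
    obtain ⟨x₂, hx₂, u, hu, rfl⟩ := Submodule.mem_sup.1 hx₁
    obtain ⟨x, rfl⟩ := Ideal.mem_span_singleton'.1 hx₂
    have e1 : v • ψ h' = 0 := mem_kill.1 hN' v hv
    have e2 : (x * s N) • ψ h' = 0 := by rw [mul_smul, hs3 N _ hN', smul_zero]
    have e3 : u • ψ h' = 0 := by
      rw [← map_smul]
      refine (hψ0 _).2 (hKφ ?_)
      rw [LinearMap.mem_ker, map_smul]
      exact mem_kill.1 hb' u hu
    rw [add_smul, add_smul, e1, e2, e3, add_zero, add_zero]
  have h2 : q ^ e' • h' - h ∈ LinearMap.ker φ := by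
    rw [LinearMap.mem_ker, map_sub, map_smul, hqb, sub_self]
  have h3 : ψ h = q ^ e' • ψ h' := by
    rw [← map_smul, eq_comm, ← sub_eq_zero, ← map_sub]
    exact (hψ0 _).2 (hKφ h2)
  rw [h1 _ (Ideal.pow_mem_pow hqm _)] at h3
  exact hhK ((hψ0 h).1 h3)

end KeyLemma

end LocCoh

namespace LocCoh

section Factor

theorem exists_comp_eq_of_ker_le {R A B C : Type*} [CommRing R] [AddCommGroup A] [Module R A]
    [AddCommGroup B] [Module R B] [AddCommGroup C] [Module R C] (f : A →ₗ[R] B)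
    (hf : Function.Surjective f) (g : A →ₗ[R] C) (h : LinearMap.ker f ≤ LinearMap.ker g) :
    ∃ k : B →ₗ[R] C, k ∘ₗ f = g := by
  refine ⟨(LinearMap.ker f).liftQ g h ∘ₗ (f.quotKerEquivOfSurjective hf).symm.toLinearMap, ?_⟩
  ext x
  have : (f.quotKerEquivOfSurjective hf).symm (f x) = (LinearMap.ker f).mkQ x := by
    rw [LinearEquiv.symm_apply_eq]; rfl
  simp [this]

end Factor

section Baer

variable {R : Type u} [CommRing R] {E : Type u} [AddCommGroup E] [Module R E]

theorem exists_smul_eq_of_baer (hE : Module.Baer R E) (J : Ideal R) (a : R) (e : E)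
    (h : ∀ r : R, r * a ∈ J → r • e = 0) : ∃ e' ∈ kill J E, a • e' = e := by
  let f₀ : R →ₗ[R] R ⧸ J := LinearMap.toSpanSingleton R _ (Ideal.Quotient.mk J a)
  have hker : ∀ r, r ∈ LinearMap.ker f₀ ↔ r * a ∈ J := by
    intro r
    rw [LinearMap.mem_ker, LinearMap.toSpanSingleton_apply, ← Ideal.Quotient.eq_zero_iff_mem,
      map_mul, Algebra.smul_def]
    rfl
  have he : e ∈ kill (LinearMap.ker f₀) E := mem_kill.2 fun r hr => h r ((hker r).1 hr)
  obtain ⟨g, hg⟩ := hE.extension_property ((LinearMap.ker f₀).liftQ f₀ le_rfl)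
    (LinearMap.ker_eq_bot.1 (Submodule.ker_liftQ_eq_bot _ _ _ le_rfl)) (homOfKill he)
  refine ⟨g (Ideal.Quotient.mk J 1), mem_kill.2 fun r hr => ?_, ?_⟩
  · rw [← map_smul, Algebra.smul_def, map_one, mul_one, Ideal.Quotient.algebraMap_eq,
      Ideal.Quotient.eq_zero_iff_mem.2 hr, map_zero]
  · have h1 := LinearMap.congr_fun hg (Ideal.Quotient.mk (LinearMap.ker f₀) 1)
    rw [homOfKill_mk, one_smul] at h1
    rw [← h1, ← map_smul, LinearMap.comp_apply]
    congr 1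
    change _ = (LinearMap.ker f₀).liftQ f₀ le_rfl ((LinearMap.ker f₀).mkQ 1)
    rw [Submodule.mkQ_apply, Submodule.liftQ_apply, LinearMap.toSpanSingleton_apply, one_smul,
      Algebra.smul_def, map_one, mul_one]
    rfl

theorem exists_pow_smul_eq_of_baer [IsNoetherianRing R] (hE : Module.Baer R E) (J : Ideal R)
    (q : R) :
    ∃ K, ∀ i, ∀ e ∈ kill J E, ∃ e' ∈ kill J E, q ^ (K + i) • e' = q ^ K • e := by
  let f : ℕ →o Ideal R := ⟨fun n => Submodule.comap (LinearMap.mulLeft R (q ^ n)) J, by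
    refine monotone_nat_of_le_succ fun n r hr => ?_
    have hr' : q ^ n * r ∈ J := hr
    change q ^ (n + 1) * r ∈ J
    rw [pow_succ', mul_assoc]
    exact J.mul_mem_left q hr'⟩
  obtain ⟨K, hK⟩ := monotone_stabilizes_iff_noetherian.2 (inferInstanceAs (IsNoetherian R R)) f
  refine ⟨K, fun i e he => exists_smul_eq_of_baer hE J _ _ fun r hr => ?_⟩
  have h1 : r ∈ f (K + i) := by
    change q ^ (K + i) * r ∈ J
    rwa [mul_comm]
  rw [← hK _ (Nat.le_add_right _ _)] at h1
  rw [smul_smul, mul_comm]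
  exact mem_kill.1 he _ h1

theorem kill_inf_le_of_baer (hE : Module.Baer R E) (a b : Ideal R) :
    kill (a ⊓ b) E ≤ kill a E ⊔ kill b E := by
  intro e he
  let f : (R ⧸ (a ⊓ b)) →ₗ[R] (R ⧸ a) × (R ⧸ b) :=
    (Submodule.factor inf_le_left).prod (Submodule.factor inf_le_right)
  have hf : Function.Injective f := by
    rw [injective_iff_map_eq_zero]
    intro x hx
    obtain ⟨x, rfl⟩ := (a ⊓ b).mkQ_surjective x
    have h1 : a.mkQ x = 0 := congrArg Prod.fst hx
    have h2 : b.mkQ x = 0 := congrArg Prod.snd hx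
    exact (Submodule.Quotient.mk_eq_zero _).2
      ⟨(Submodule.Quotient.mk_eq_zero _).1 h1, (Submodule.Quotient.mk_eq_zero _).1 h2⟩
  obtain ⟨g, hg⟩ := hE.extension_property f hf (homOfKill he)
  have h1 := LinearMap.congr_fun hg (Ideal.Quotient.mk _ 1)
  rw [homOfKill_mk, one_smul] at h1
  have hz : ∀ (c : Ideal R) (r : R), r ∈ c → r • (Ideal.Quotient.mk c 1) = 0 := by
    intro c r hr
    rw [Algebra.smul_def, map_one, mul_one]
    exact Ideal.Quotient.eq_zero_iff_mem.2 hr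
  refine Submodule.mem_sup.2 ⟨g (Ideal.Quotient.mk a 1, 0), mem_kill.2 fun r hr => ?_,
    g (0, Ideal.Quotient.mk b 1), mem_kill.2 fun r hr => ?_, ?_⟩
  · rw [← map_smul, Prod.smul_mk, hz a r hr, smul_zero, ← Prod.zero_eq_mk, map_zero]
  · rw [← map_smul, Prod.smul_mk, hz b r hr, smul_zero, ← Prod.zero_eq_mk, map_zero]
  · rw [← map_add, ← h1, Prod.mk_add_mk, add_zero, zero_add]
    rfl

theorem gam_inf_le_of_baer [IsNoetherianRing R] (hE : Module.Baer R E) (a b : Ideal R) :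
    gam (a ⊓ b) E ≤ gam a E ⊔ gam b E := by
  rintro e ⟨k, hk⟩
  obtain ⟨c, hc⟩ := a.exists_pow_inf_eq_pow_smul (b ^ k : Ideal R)
  have h1 : a ^ (k + c) ⊓ b ^ k ≤ (a ⊓ b) ^ k := by
    have := hc (k + c) (Nat.le_add_left _ _)
    rw [smul_eq_mul, Ideal.mul_top, Nat.add_sub_cancel] at this
    rw [this, smul_eq_mul]
    refine (Ideal.mul_mono_right inf_le_right).trans ?_
    rw [← mul_pow]
    exact Ideal.pow_right_mono Ideal.mul_le_inf k
  have h2 : kill (a ^ (k + c)) E ⊔ kill (b ^ k) E ≤ gam a E ⊔ gam b E :=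
    sup_le_sup (kill_le_gam a _) (kill_le_gam b _)
  exact h2 (kill_inf_le_of_baer hE _ _ (kill_anti h1 hk))

theorem baer_gam [IsNoetherianRing R] (hE : Module.Baer R E) (J : Ideal R) :
    Module.Baer R (gam J E) := by
  intro t g
  obtain ⟨k, hk⟩ := exists_kill_of_finite (J := J) (LinearMap.range (Submodule.subtype _ ∘ₗ g))
    (by rw [LinearMap.range_eq_map]; exact (IsNoetherian.noetherian _).map _)
    (by rintro _ ⟨x, rfl⟩; exact (g x).2)
  obtain ⟨c, hc⟩ := J.exists_pow_inf_eq_pow_smul t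
  have h1 : J ^ (k + c) ⊓ t ≤ J ^ k * t := by
    have := hc (k + c) (Nat.le_add_left _ _)
    rw [smul_eq_mul, Ideal.mul_top, Nat.add_sub_cancel] at this
    rw [this, smul_eq_mul]
    exact Ideal.mul_mono_right inf_le_right
  have h2 : ∀ x : t, x.1 ∈ J ^ k * t → g x = 0 := by
    rintro ⟨x, hx⟩ hx'
    have : ∃ y ∈ LinearMap.ker g, y.1 = x := by
      change x ∈ J ^ k * t at hx'
      clear hx
      induction hx' using Submodule.mul_induction_on' with
      | mem_mul_mem r hr s hs =>
        refine ⟨r • ⟨s, hs⟩, ?_, rfl⟩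
        rw [LinearMap.mem_ker, map_smul]
        exact Subtype.ext (mem_kill.1 (hk ⟨⟨s, hs⟩, rfl⟩) r hr)
      | add a _ b _ ha hb =>
        obtain ⟨y, hy, rfl⟩ := ha
        obtain ⟨y', hy', rfl⟩ := hb
        exact ⟨y + y', add_mem hy hy', rfl⟩
    obtain ⟨y, hy, rfl⟩ := this
    exact hy
  let f₀ : t →ₗ[R] R ⧸ J ^ (k + c) := Submodule.mkQ _ ∘ₗ t.subtype
  have hker : LinearMap.ker f₀ ≤ LinearMap.ker (Submodule.subtype _ ∘ₗ g) := by
    intro x hx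
    have hx' : x.1 ∈ J ^ (k + c) := (Submodule.Quotient.mk_eq_zero _).1 hx
    rw [LinearMap.mem_ker, LinearMap.comp_apply, h2 x (h1 ⟨hx', x.2⟩), map_zero]
  obtain ⟨g', hg'⟩ := exists_comp_eq_of_ker_le f₀.rangeRestrict f₀.surjective_rangeRestrict
    (Submodule.subtype _ ∘ₗ g) (by rwa [LinearMap.ker_rangeRestrict])
  obtain ⟨h, hh⟩ := hE.extension_property (LinearMap.range f₀).subtype
    (Submodule.injective_subtype _) g'
  have hm : h (Ideal.Quotient.mk _ 1) ∈ gam J E := ⟨k + c, mem_kill.2 fun r hr => by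
    rw [← map_smul, Algebra.smul_def, map_one, mul_one, Ideal.Quotient.algebraMap_eq,
      Ideal.Quotient.eq_zero_iff_mem.2 hr, map_zero]⟩
  refine ⟨LinearMap.toSpanSingleton R _ ⟨_, hm⟩, fun x hx => Subtype.ext ?_⟩
  have e1 := LinearMap.congr_fun hg' ⟨x, hx⟩
  have e2 := LinearMap.congr_fun hh (f₀.rangeRestrict ⟨x, hx⟩)
  have e3 : h (f₀ ⟨x, hx⟩) = (g ⟨x, hx⟩ : E) := e2.trans e1
  rw [← e3]
  change x • h (Ideal.Quotient.mk _ 1) = h (f₀ ⟨x, hx⟩)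
  rw [← map_smul, Algebra.smul_def, map_one, mul_one]
  rfl

theorem exists_retraction_of_baer {N : Type u} [AddCommGroup N] [Module R N] (Z : Submodule R N)
    (hZ : Module.Baer R Z) : ∃ p : N →ₗ[R] Z, ∀ z : Z, p z = z := by
  obtain ⟨p, hp⟩ := hZ.extension_property Z.subtype (Submodule.injective_subtype _) LinearMap.id
  exact ⟨p, fun z => LinearMap.congr_fun hp z⟩

theorem baer_of_surjective_of_baer_ker {P B : Type u} [AddCommGroup P] [Module R P]
    [AddCommGroup B] [Module R B] (f : P →ₗ[R] B) (hf : Function.Surjective f)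
    (hP : Module.Baer R P) (hk : Module.Baer R (LinearMap.ker f)) : Module.Baer R B := by
  obtain ⟨p, hp⟩ := exists_retraction_of_baer _ hk
  obtain ⟨σ, hσ⟩ := exists_comp_eq_of_ker_le f hf
    (LinearMap.id - (LinearMap.ker f).subtype ∘ₗ p) (by
      intro x hx
      have := hp ⟨x, hx⟩
      simp [this])
  have hfσ : ∀ b, f (σ b) = b := by
    intro b
    obtain ⟨x, rfl⟩ := hf b
    have := LinearMap.congr_fun hσ x
    rw [LinearMap.comp_apply] at this
    rw [this]
    have h2 : f (p x) = 0 := (p x).2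
    simp [h2]
  intro t g
  obtain ⟨h, hh⟩ := hP t (σ ∘ₗ g)
  exact ⟨f ∘ₗ h, fun x hx => by rw [LinearMap.comp_apply, hh x hx, LinearMap.comp_apply, hfσ]⟩

theorem eq_bot_of_kill_eq_bot [IsNoetherianRing R] {N : Type u} [AddCommGroup N] [Module R N]
    (J : Ideal R) (h : ∀ x ∈ kill J N, x = 0) : ∀ x ∈ gam J N, x = 0 := by
  rintro x ⟨k, hk⟩
  induction k generalizing x with
  | zero =>
    rw [pow_zero, Ideal.one_eq_top, kill_top] at hk
    exact hk
  | succ k ih =>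
    rw [pow_succ', mem_kill_mul] at hk
    exact h x (mem_kill.2 fun r hr => ih _ (hk r hr))

end Baer

end LocCoh

namespace LocCoh

/-- An injective resolution of a ring as a module over itself. -/
structure InjRes (R : Type u) [CommRing R] where
  E : ℕ → Type u
  [acg : ∀ n, AddCommGroup (E n)]
  [mod : ∀ n, Module R (E n)]
  δ : ∀ n, E n →ₗ[R] E (n + 1)
  ε : R →ₗ[R] E 0
  ε_injective : Function.Injective ε
  exact_zero : ∀ x, δ 0 x = 0 ↔ ∃ r, ε r = x
  exact_succ : ∀ n x, δ (n + 1) x = 0 ↔ ∃ y, δ n y = x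
  baer : ∀ n, Module.Baer R (E n)

namespace InjRes

attribute [instance] InjRes.acg InjRes.mod

variable {R : Type u} [CommRing R] (X : InjRes R)

@[simp] theorem δ_δ (n : ℕ) (x : X.E n) : X.δ (n + 1) (X.δ n x) = 0 :=
  (X.exact_succ n _).2 ⟨x, rfl⟩

/-- The cocycles of degree `n + 1` of a family of submodules. -/
def cyc (T : ∀ n, Submodule R (X.E n)) (n : ℕ) : Submodule R (X.E (n + 1)) :=
  T (n + 1) ⊓ LinearMap.ker (X.δ (n + 1))

/-- The coboundaries of degree `n + 1` of a family of submodules. -/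
def bd (T : ∀ n, Submodule R (X.E n)) (n : ℕ) : Submodule R (X.E (n + 1)) :=
  (T n).map (X.δ n)

/-- The cohomology in degree `n + 1` of a family of submodules. -/
abbrev hcoh (T : ∀ n, Submodule R (X.E n)) (n : ℕ) : Type u :=
  X.cyc T n ⧸ (X.bd T n).comap (X.cyc T n).subtype

/-- The torsion subcomplex. -/
abbrev G (J : Ideal R) : ∀ n, Submodule R (X.E n) := fun n => gam J (X.E n)

/-- The subcomplex of elements annihilated by an ideal. -/
abbrev K (J : Ideal R) : ∀ n, Submodule R (X.E n) := fun n => kill J (X.E n)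

/-- Vanishing of the cohomology in degree `n + 1` of a family of submodules. -/
def Acyc (T : ∀ n, Submodule R (X.E n)) (n : ℕ) : Prop :=
  ∀ x ∈ T (n + 1), X.δ (n + 1) x = 0 → ∃ y ∈ T n, X.δ n y = x

variable {X} {T T' : ∀ n, Submodule R (X.E n)} {n : ℕ}

theorem cyc_mono (h : T (n + 1) ≤ T' (n + 1)) : X.cyc T n ≤ X.cyc T' n := inf_le_inf_right _ h

theorem bd_mono (h : T n ≤ T' n) : X.bd T n ≤ X.bd T' n := Submodule.map_mono h

theorem δ_mem_gam {J : Ideal R} {y : X.E n} (hy : y ∈ gam J (X.E n)) :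
    X.δ n y ∈ X.cyc (X.G J) n := ⟨map_mem_gam _ hy, X.δ_δ n y⟩

/-- The class of a cocycle. -/
def cls : X.cyc T n →ₗ[R] X.hcoh T n := Submodule.mkQ _

theorem cls_surjective : Function.Surjective (cls : X.cyc T n →ₗ[R] X.hcoh T n) :=
  Submodule.mkQ_surjective _

theorem cls_eq_zero {x : X.cyc T n} : cls x = 0 ↔ ∃ y ∈ T n, X.δ n y = x :=
  Submodule.Quotient.mk_eq_zero _

theorem cls_eq {x x' : X.cyc T n} : cls x = cls x' ↔ ∃ y ∈ T n, X.δ n y = x - x' := by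
  rw [← sub_eq_zero, ← map_sub, cls_eq_zero]; rfl

/-- The map on cohomology induced by an inclusion of families of submodules. -/
def hmap (h : ∀ n, T n ≤ T' n) (n : ℕ) : X.hcoh T n →ₗ[R] X.hcoh T' n :=
  Submodule.mapQ _ _ (Submodule.inclusion (cyc_mono (h (n + 1)))) fun _ hx => bd_mono (h n) hx

theorem hmap_cls (h : ∀ n, T n ≤ T' n) (x : X.cyc T n) :
    hmap h n (cls x) = cls ⟨x.1, cyc_mono (h (n + 1)) x.2⟩ := rfl

theorem acyc_iff : X.Acyc T n ↔ ∀ x : X.hcoh T n, x = 0 := by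
  refine ⟨fun h x => ?_, fun h x hx hx' => ?_⟩
  · obtain ⟨x, rfl⟩ := cls_surjective x
    exact cls_eq_zero.2 (h x.1 x.2.1 x.2.2)
  · exact cls_eq_zero.1 (h (cls ⟨x, hx, hx'⟩))

section Ara

variable [IsNoetherianRing R]

theorem acyc_sup {J : Ideal R} (y : R) (h1 : X.Acyc (X.G J) n) (h2 : X.Acyc (X.G J) (n + 1)) :
    X.Acyc (X.G (J ⊔ Ideal.span {y})) (n + 1) := by
  intro c hc hc'
  change c ∈ gam _ _ at hc
  rw [gam_sup] at hc
  obtain ⟨e, he, rfl⟩ := h2 c hc.1 hc'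
  obtain ⟨L, hL⟩ := mem_gam_span_singleton.1 hc.2
  obtain ⟨f, hf, hfe⟩ := h1 (y ^ L • e) (Submodule.smul_mem _ _ he) (by rw [map_smul, hL])
  obtain ⟨k, hk⟩ := hf
  obtain ⟨N, hN⟩ := exists_pow_smul_eq_of_baer (X.baer n) (J ^ k) y
  obtain ⟨f', hf', hff'⟩ := hN L f hk
  refine ⟨e - X.δ n f', ?_, by simp⟩
  change _ ∈ gam _ _
  rw [gam_sup]
  refine ⟨sub_mem he (map_mem_gam _ (kill_le_gam J k hf')), mem_gam_span_singleton.2 ⟨N + L, ?_⟩⟩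
  rw [smul_sub, ← map_smul, hff', map_smul, hfe, smul_smul, pow_add, sub_self]

theorem acyc_span {r : ℕ} (y : Fin r → R) (h : r ≤ n) :
    X.Acyc (X.G (Ideal.span (Set.range y))) n := by
  induction r generalizing n with
  | zero =>
    intro x _ hx'
    obtain ⟨z, rfl⟩ := (X.exact_succ n x).1 hx'
    refine ⟨z, ?_, rfl⟩
    change z ∈ gam _ _
    rw [Set.range_eq_empty, Ideal.span_empty, gam_bot]
    trivial
  | succ r ih =>
    obtain ⟨n, rfl⟩ : ∃ k, n = k + 1 := ⟨n - 1, by omega⟩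
    have h1 := acyc_sup (y 0) (ih (n := n) (fun i => y i.succ) (by omega))
      (ih (n := n + 1) (fun i => y i.succ) (by omega))
    have h2 : Ideal.span (Set.range fun i : Fin r => y i.succ) ⊔ Ideal.span {y 0} =
        Ideal.span (Set.range y) := by
      rw [← Ideal.span_union, ← Fin.cons_self_tail y, Fin.range_cons]
      congr 1
      rw [Set.union_comm, Set.insert_eq]
      rfl
    rwa [h2] at h1

end Ara

end InjRes

end LocCoh

namespace LocCoh

namespace InjRes

open IsLocalRing

variable {R : Type u} [CommRing R] {X : InjRes R} {n : ℕ}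

theorem mem_gam_hcoh (J : Ideal R) (x : X.hcoh (X.G J) n) : x ∈ gam J (X.hcoh (X.G J) n) := by
  obtain ⟨c, rfl⟩ := cls_surjective x
  exact map_mem_gam cls (mem_gam_of_injective (X.cyc _ n).subtype
    (X.cyc _ n).injective_subtype c.2.1)

section Torsion

variable [IsNoetherianRing R]

theorem baer_bd {J : Ideal R} (hZ : Module.Baer R ↥(gam J (X.E n) ⊓ LinearMap.ker (X.δ n))) :
    Module.Baer R (X.bd (X.G J) n) := by
  let f : gam J (X.E n) →ₗ[R] X.bd (X.G J) n := (X.δ n).submoduleMap (gam J (X.E n))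
  refine baer_of_surjective_of_baer_ker f (LinearMap.submoduleMap_surjective _ _)
    (baer_gam (X.baer n) J) (hZ.of_equiv ?_)
  refine
    { toFun := fun x => ⟨⟨x.1, x.2.1⟩, Subtype.ext x.2.2⟩
      invFun := fun x => ⟨x.1.1, x.1.2, congrArg Subtype.val x.2⟩
      map_add' := fun _ _ => rfl
      map_smul' := fun _ _ => rfl
      left_inv := fun _ => rfl
      right_inv := fun _ => rfl }

theorem baer_cyc {J : Ideal R} (h0 : ∀ r ∈ kill J R, r = 0) (hJ : ∀ i < n, X.Acyc (X.K J) i) :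
    Module.Baer R ↥(gam J (X.E n) ⊓ LinearMap.ker (X.δ n)) := by
  induction n with
  | zero =>
    have h : ∀ x : ↥(gam J (X.E 0) ⊓ LinearMap.ker (X.δ 0)), x = 0 := by
      rintro ⟨x, hx, hx'⟩
      obtain ⟨r, rfl⟩ := (X.exact_zero x).1 hx'
      have := eq_bot_of_kill_eq_bot J h0 r (mem_gam_of_injective X.ε X.ε_injective hx)
      exact Subtype.ext ((congrArg X.ε this).trans (map_zero _))
    exact fun t g => ⟨0, fun x hx => (h _).symm⟩
  | succ n ih =>
    have hB := baer_bd (ih fun i hi => hJ i (by omega))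
    obtain ⟨p, hp⟩ := exists_retraction_of_baer _ hB
    have hle : X.bd (X.G J) n ≤ X.cyc (X.G J) n := by
      rintro _ ⟨y, hy, rfl⟩
      exact δ_mem_gam hy
    have heq : X.bd (X.G J) n = X.cyc (X.G J) n := by
      refine le_antisymm hle fun z hz => ?_
      let N : Submodule R (X.E (n + 1)) := LinearMap.ker p ⊓ LinearMap.ker (X.δ (n + 1))
      have hN : ∀ x ∈ kill J N, x = 0 := by
        rintro ⟨x, hx1, hx2⟩ hx
        obtain ⟨y, hy, rfl⟩ := hJ n (by omega) x
          (mem_kill.2 fun r hr => congrArg Subtype.val (mem_kill.1 hx r hr)) hx2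
        have h1 : X.δ n y ∈ X.bd (X.G J) n :=
          ⟨y, kill_le_gam J 1 (by rwa [pow_one]), rfl⟩
        have h2 := hp ⟨_, h1⟩
        have h3 : p (X.δ n y) = 0 := hx1
        have h4 : X.δ n y = 0 := congrArg Subtype.val (h2.symm.trans h3)
        exact Subtype.ext h4
      have h4 : z - p z ∈ N := by
        refine ⟨?_, ?_⟩
        · change p (z - p z) = 0
          rw [map_sub, hp, sub_self]
        · exact sub_mem hz.2 (hle (p z).2).2
      have h5 := eq_bot_of_kill_eq_bot J hN ⟨_, h4⟩ (mem_gam_of_injective N.subtype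
        N.injective_subtype (sub_mem hz.1 (hle (p z).2).1))
      have h6 : z - p z = 0 := congrArg Subtype.val h5
      rw [sub_eq_zero.1 h6]
      exact (p z).2
    change Module.Baer R (X.cyc (X.G J) n)
    exact heq ▸ hB

/-- Lifting annihilated classes to annihilated cocycles. -/
theorem exists_lift {J : Ideal R} (h0 : ∀ r ∈ kill J R, r = 0) (hJ : ∀ i < n, X.Acyc (X.K J) i)
    (𝔞 : Ideal R) (c : X.hcoh (X.G J) n) (hc : c ∈ kill 𝔞 (X.hcoh (X.G J) n)) :
    ∃ c' : X.cyc (X.G J) n, (c' : X.E (n + 1)) ∈ kill 𝔞 (X.E (n + 1)) ∧ cls c' = c := by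
  obtain ⟨p, hp⟩ := exists_retraction_of_baer _ (baer_bd (baer_cyc h0 hJ))
  obtain ⟨c, rfl⟩ := cls_surjective c
  have hle : X.bd (X.G J) n ≤ X.cyc (X.G J) n := by
    rintro _ ⟨y, hy, rfl⟩
    exact δ_mem_gam hy
  refine ⟨⟨c - p c, sub_mem c.2 (hle (p c).2)⟩, mem_kill.2 fun r hr => ?_, ?_⟩
  · have h1 : r • (c : X.E (n + 1)) ∈ X.bd (X.G J) n := by
      have := mem_kill.1 hc r hr
      rw [← map_smul, cls_eq_zero] at this
      exact this
    have h2 := hp ⟨_, h1⟩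
    rw [smul_sub, sub_eq_zero]
    have h3 := congrArg Subtype.val h2
    simp only [map_smul] at h3
    exact h3.symm
  · refine cls_eq.2 ?_
    obtain ⟨y, hy, hy'⟩ := (p c).2
    refine ⟨-y, neg_mem hy, ?_⟩
    change _ = (c : X.E (n + 1)) - p c - c
    rw [map_neg, hy', sub_sub_cancel_left]

theorem not_acyc_gam {J : Ideal R} (h0 : ∀ r ∈ kill J R, r = 0) (hJ : ∀ i < n, X.Acyc (X.K J) i)
    (hn : ¬ X.Acyc (X.K J) n) : ¬ X.Acyc (X.G J) n := by
  refine fun h => hn fun c hc hc' => ?_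
  obtain ⟨p, hp⟩ := exists_retraction_of_baer _ (baer_cyc h0 hJ)
  obtain ⟨y, hy, rfl⟩ := h c (kill_le_gam J 1 (by rwa [pow_one])) hc'
  refine ⟨y - p y, mem_kill.2 fun r hr => ?_, ?_⟩
  · have h1 : r • y ∈ gam J (X.E n) ⊓ LinearMap.ker (X.δ n) :=
      ⟨Submodule.smul_mem _ _ hy, (map_smul _ _ _).trans (mem_kill.1 hc r hr)⟩
    have h3 := congrArg Subtype.val (hp ⟨_, h1⟩)
    simp only [map_smul] at h3
    rw [smul_sub, sub_eq_zero]
    exact h3.symm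
  · have h2 : X.δ n (p y) = 0 := (p y).2.2
    rw [map_sub, h2, sub_zero]

theorem isNoetherian_kill_hcoh {J : Ideal R} (h0 : ∀ r ∈ kill J R, r = 0)
    (hJ : ∀ i < n, X.Acyc (X.K J) i) (hfin : Module.Finite R (X.hcoh (X.K J) n)) :
    IsNoetherian R (kill J (X.hcoh (X.G J) n)) := by
  have hle : ∀ n, X.K J n ≤ X.G J n := fun n => by simpa using kill_le_gam (N := X.E n) J 1
  have : kill J (X.hcoh (X.G J) n) ≤ LinearMap.range (hmap hle n) := by
    intro c hc
    obtain ⟨c', hc', rfl⟩ := exists_lift h0 hJ J c hc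
    exact ⟨cls ⟨c', hc', c'.2.2⟩, rfl⟩
  have : IsNoetherian R (X.hcoh (X.K J) n) := isNoetherian_of_isNoetherianRing_of_finite R _
  have : IsNoetherian R (LinearMap.range (hmap hle n)) := inferInstance
  exact isNoetherian_of_le ‹kill J _ ≤ _›

end Torsion

variable [IsNoetherianRing R] [IsLocalRing R]

theorem isArtinian_hcoh (h0 : ∀ r ∈ kill (maximalIdeal R) R, r = 0)
    (hJ : ∀ i < n, X.Acyc (X.K (maximalIdeal R)) i)
    (hfin : Module.Finite R (X.hcoh (X.K (maximalIdeal R)) n)) :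
    IsArtinian R (X.hcoh (X.G (maximalIdeal R)) n) := by
  have := isNoetherian_kill_hcoh h0 hJ hfin
  have : Module.Finite R (kill (maximalIdeal R) (X.hcoh (X.G (maximalIdeal R)) n)) := inferInstance
  have : IsArtinian R (kill (maximalIdeal R) (X.hcoh (X.G (maximalIdeal R)) n)) :=
    isArtinian_of_finite_of_kill fun x => mem_kill.2 fun r hr =>
      Subtype.ext (mem_kill.1 x.2 r hr)
  exact isArtinian_of_kill (maximalIdeal R) (mem_gam_hcoh _)

theorem paramDivisible_hcoh : ParamDivisible R n (X.hcoh (X.G (maximalIdeal R)) n) := by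
  intro w q hw hq hwq b
  obtain ⟨c, rfl⟩ := cls_surjective b
  have hwm : Ideal.span (Set.range w) ≤ maximalIdeal R :=
    Ideal.span_le.2 (by rintro _ ⟨i, rfl⟩; exact hw i)
  have hm : ∀ {j} {x : X.E j}, x ∈ gam (Ideal.span (Set.range w)) (X.E j) →
      (∃ k, q ^ k • x = 0) → x ∈ gam (maximalIdeal R) (X.E j) := by
    intro j x h1 h2
    refine gam_anti_of_le_radical hwq ?_
    rw [gam_sup]
    exact ⟨h1, mem_gam_span_singleton.2 h2⟩
  obtain ⟨e, ⟨c0, he⟩, hec⟩ := acyc_span w le_rfl c.1 (gam_anti hwm c.2.1) c.2.2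
  obtain ⟨N, hN⟩ := exists_pow_smul_eq_of_baer (X.baer n) (Ideal.span (Set.range w) ^ c0) q
  refine ⟨c0, fun i => ?_⟩
  obtain ⟨e', he', hee'⟩ := hN i e he
  have h1 : q ^ i • e' - e ∈ gam (maximalIdeal R) (X.E n) := by
    refine hm (sub_mem (Submodule.smul_mem _ _ (kill_le_gam _ _ he')) (kill_le_gam _ _ he)) ⟨N, ?_⟩
    rw [smul_sub, smul_smul, ← pow_add, hee', sub_self]
  have h2 : X.δ n e' ∈ gam (maximalIdeal R) (X.E (n + 1)) := by
    have h3 : q ^ i • X.δ n e' ∈ gam (maximalIdeal R) (X.E (n + 1)) := by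
      have := add_mem (map_mem_gam (X.δ n) h1) c.2.1
      rwa [map_sub, hec, sub_add_cancel, map_smul] at this
    refine hm (map_mem_gam _ (kill_le_gam _ _ he')) ?_
    obtain ⟨k, hk⟩ := h3
    refine ⟨k + i, ?_⟩
    rw [pow_add, mul_smul]
    exact mem_kill.1 hk _ (Ideal.pow_mem_pow hq k)
  refine ⟨cls ⟨X.δ n e', h2, X.δ_δ n e'⟩, map_mem_kill cls (mem_kill_of_injective
    (X.cyc _ n).subtype (X.cyc _ n).injective_subtype (map_mem_kill (X.δ n) he')), ?_⟩
  rw [← map_smul]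
  refine cls_eq.2 ⟨_, h1, ?_⟩
  rw [map_sub, hec, map_smul]
  rfl

end InjRes

theorem ParamDivisible.of_surjective {R : Type u} [CommRing R] [IsLocalRing R] {n : ℕ}
    {B B' : Type u} [AddCommGroup B] [Module R B] [AddCommGroup B'] [Module R B']
    (h : ParamDivisible R n B) (f : B →ₗ[R] B') (hf : Function.Surjective f) :
    ParamDivisible R n B' := by
  intro w q hw hq hwq b
  obtain ⟨b, rfl⟩ := hf b
  obtain ⟨c, hc⟩ := h w q hw hq hwq b
  refine ⟨c, fun i => ?_⟩
  obtain ⟨b', hb', hbb⟩ := hc i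
  exact ⟨f b', map_mem_kill f hb', by rw [← map_smul, hbb]⟩

end LocCoh

namespace LocCoh

namespace InjRes

open IsLocalRing

variable {R : Type u} [CommRing R] [IsNoetherianRing R] [IsLocalRing R] {X : InjRes R} {n : ℕ}

/-- The consequences of the Cohen-Macaulay property in dimension `n + 1`, together with finiteness
of the `Ext` modules, that are used below. -/
structure CM (X : InjRes R) (n : ℕ) : Prop where
  dim : ringKrullDim R = (n + 1 : ℕ)
  kill_eq_zero : ∀ r ∈ kill (maximalIdeal R) R, r = 0
  acyc : ∀ i < n, X.Acyc (X.K (maximalIdeal R)) i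
  not_acyc : ¬ X.Acyc (X.K (maximalIdeal R)) n
  finite : ∀ (𝔞 : Ideal R) i, Module.Finite R (X.hcoh (X.K 𝔞) i)

/-- The Hartshorne-Lichtenbaum vanishing theorem. -/
theorem CM.acyc_gam [IsDomain (AdicCompletion (maximalIdeal R) R)] (h : X.CM n) {J : Ideal R}
    (hJ : J ≤ maximalIdeal R) {z : R} (hzm : z ∈ maximalIdeal R) (hz : ∀ k, z ^ k ∉ J) :
    X.Acyc (X.G J) n := by
  obtain ⟨y, hy, 𝔟, h1, h2⟩ := exists_fin_and_ideal_of_le h.dim J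
  have hyJ : Ideal.span (Set.range y) ≤ J := Ideal.span_le.2 (by rintro _ ⟨i, rfl⟩; exact hy i)
  have hle : ∀ i, X.G (maximalIdeal R) i ≤ X.G J i := fun i => gam_anti hJ
  let φ := hmap hle n
  have := isArtinian_hcoh h.kill_eq_zero h.acyc (h.finite _ _)
  have key : ∀ x : LinearMap.range φ, x = 0 := by
    refine eq_zero_of_paramDivisible h.dim (mem_gam_hcoh (maximalIdeal R)) φ.rangeRestrict
      φ.surjective_rangeRestrict (paramDivisible_hcoh.of_surjective _ φ.surjective_rangeRestrict)
      J hJ z hzm hz fun N => ?_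
    have := h.finite (J ^ N) n
    obtain ⟨k, hk⟩ := exists_kill_of_finite (gam (maximalIdeal R) (X.hcoh (X.K (J ^ N)) n))
      (IsNoetherian.noetherian _) le_rfl
    refine ⟨k, fun x hx => Subtype.ext ?_⟩
    obtain ⟨c, hc, rfl⟩ := exists_lift h.kill_eq_zero h.acyc _ x hx
    let c' : X.cyc (X.K (J ^ N)) n := ⟨c, hc, c.2.2⟩
    have h3 : cls c' ∈ gam (maximalIdeal R) (X.hcoh (X.K (J ^ N)) n) :=
      map_mem_gam cls (mem_gam_of_injective (X.cyc _ n).subtype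
        (X.cyc _ n).injective_subtype c.2.1)
    have h4 := mem_kill.1 (hk h3) _ (Ideal.pow_mem_pow hzm k)
    rw [← map_smul, cls_eq_zero] at h4
    obtain ⟨y', hy', h5⟩ := h4
    change φ (z ^ k • cls c) = 0
    rw [← map_smul, hmap_cls]
    exact cls_eq_zero.2 ⟨y', kill_le_gam J N hy', h5⟩
  intro c hc hc'
  obtain ⟨e, he, rfl⟩ := acyc_span y le_rfl c (gam_anti hyJ hc) hc'
  obtain ⟨e₁, he₁, e₂, he₂, rfl⟩ := Submodule.mem_sup.1
    (gam_inf_le_of_baer (X.baer n) J 𝔟 (gam_anti_of_le_radical h1 he))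
  have h3 : X.δ n e₂ ∈ gam (maximalIdeal R) (X.E (n + 1)) := by
    refine gam_anti_of_le_radical h2 ?_
    rw [gam_sup]
    refine ⟨?_, map_mem_gam _ he₂⟩
    have := sub_mem hc (map_mem_gam (X.δ n) he₁)
    rwa [map_add, add_sub_cancel_left] at this
  have h4 := key ⟨φ (cls ⟨_, h3, X.δ_δ n e₂⟩), _, rfl⟩
  have h5 : φ (cls ⟨_, h3, X.δ_δ n e₂⟩) = 0 := congrArg Subtype.val h4
  obtain ⟨y', hy', h6⟩ := cls_eq_zero.1 h5
  exact ⟨e₁ + y', add_mem he₁ hy', by rw [map_add, map_add, h6]; rfl⟩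

end InjRes

end LocCoh

namespace LocCoh

open IsLocalRing

section Melkersson

variable {R : Type u} [CommRing R] [IsNoetherianRing R] [IsLocalRing R] {M : Type u}
  [AddCommGroup M] [Module R M]

/-- An element of the maximal ideal whose power torsion is torsion for the maximal ideal. -/
theorem exists_gam_span_singleton_le (I : Ideal R) (hM : ∀ u : M, u ∈ gam I M)
    [IsNoetherian R (kill I M)] :
    ∃ x ∈ maximalIdeal R, gam (Ideal.span {x}) M ≤ gam (maximalIdeal R) M := by
  have hfin := associatedPrimes.finite R (kill I M)
  let S : Set (Ideal R) := associatedPrimes R (kill I M) \ {maximalIdeal R}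
  have hS : S.Finite := hfin.subset Set.sdiff_subset
  obtain ⟨x, hxm, hx⟩ : ∃ x ∈ maximalIdeal R, ∀ P ∈ S, x ∉ P := by
    by_contra! hcon
    have h1 : ((maximalIdeal R : Ideal R) : Set R) ⊆ ⋃ P ∈ (hS.toFinset : Set (Ideal R)), P := by
      intro x hx
      obtain ⟨P, hP, hxP⟩ := hcon x hx
      exact Set.mem_iUnion₂.2 ⟨P, hS.mem_toFinset.2 hP, hxP⟩
    obtain ⟨P, hP, hle⟩ := (Ideal.subset_union_prime (f := id) ⊤ ⊤
      (fun P hP _ _ => (hS.mem_toFinset.1 hP).1.isPrime)).1 h1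
    have hP' := hS.mem_toFinset.1 hP
    exact hP'.2 (((maximalIdeal.isMaximal R).eq_of_le hP'.1.isPrime.ne_top hle).symm)
  refine ⟨x, hxm, fun u hu => ?_⟩
  obtain ⟨k, hk⟩ := mem_gam_span_singleton.1 hu
  obtain ⟨k', hk'⟩ := hM u
  let N : Submodule R M := Submodule.span R {u}
  have hann : ∀ r, r ∈ Module.annihilator R N ↔ r • u = 0 := by
    intro r
    change r ∈ Submodule.annihilator N ↔ _
    rw [Submodule.mem_annihilator_span_singleton]
  have hm : maximalIdeal R ≤ (Module.annihilator R N).radical := by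
    rw [← Ideal.sInf_minimalPrimes]
    refine le_sInf fun P hP => ?_
    have hPp : P.IsPrime := hP.1.1
    have hIP : I ≤ P := fun r hr => hPp.mem_of_pow_mem k'
      (hP.1.2 ((hann _).2 (mem_kill.1 hk' _ (Ideal.pow_mem_pow hr k'))))
    have hxP : x ∈ P := hPp.mem_of_pow_mem k (hP.1.2 ((hann _).2 hk))
    have hass := Module.associatedPrimes.minimalPrimes_annihilator_subset_associatedPrimes R N hP
    obtain ⟨-, y, hy⟩ := isAssociatedPrime_iff.1 hass
    have hyP : ∀ r, r ∈ P ↔ r • y = 0 := by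
      intro r
      rw [hy, Submodule.mem_colon_singleton, Submodule.mem_bot]
    have hyI : (y : M) ∈ kill I M := mem_kill.2 fun r hr =>
      congrArg Subtype.val ((hyP r).1 (hIP hr))
    have hass' : P ∈ associatedPrimes R (kill I M) := by
      refine isAssociatedPrime_iff.2 ⟨hPp, ⟨y, hyI⟩, ?_⟩
      ext r
      rw [hyP, Submodule.mem_colon_singleton, Submodule.mem_bot, Subtype.ext_iff, Subtype.ext_iff]
      rfl
    by_contra hne
    exact hx P ⟨hass', fun h => hne (h ▸ le_rfl)⟩ hxP
  obtain ⟨j, hj⟩ := Ideal.exists_pow_le_of_le_radical_of_fg hm (IsNoetherian.noetherian _)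
  exact ⟨j, mem_kill.2 fun r hr => (hann r).1 (hj hr)⟩

theorem mem_gam_of_divisible (I : Ideal R) (hM : ∀ u : M, u ∈ gam I M)
    [IsNoetherian R (kill I M)] {x : R} (hxm : x ∈ maximalIdeal R)
    (hx : gam (Ideal.span {x}) M ≤ gam (maximalIdeal R) M)
    (hdiv : ∀ u : M, ∃ u', x • u' - u ∈ gam (maximalIdeal R) M) :
    IsArtinian R M ∧ ∀ u : M, u ∈ gam (maximalIdeal R) M := by
  have hA : ∀ a : gam (maximalIdeal R) M, a ∈ gam (maximalIdeal R) (gam (maximalIdeal R) M) :=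
    fun a => mem_gam_of_injective (Submodule.subtype _) (Submodule.injective_subtype _) a.2
  have : IsArtinian R (gam (maximalIdeal R) M) := by
    have : IsNoetherian R (kill I (gam (maximalIdeal R) M)) := by
      let f : kill I (gam (maximalIdeal R) M) →ₗ[R] kill I M :=
        ((Submodule.subtype _) ∘ₗ (Submodule.subtype _)).codRestrict _ fun a =>
          map_mem_kill (Submodule.subtype _) a.2
      refine isNoetherian_of_injective f fun a b h => ?_
      have h' : a.1.1 = b.1.1 := congrArg (fun t : kill I M => (t : M)) h
      exact Subtype.ext (Subtype.ext h')
    have : Module.Finite R (kill I (gam (maximalIdeal R) M)) := inferInstance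
    have : IsArtinian R (kill I (gam (maximalIdeal R) M)) :=
      isArtinian_of_finite_of_gam fun a => mem_gam_of_injective (Submodule.subtype _)
        (Submodule.injective_subtype _) (hA a)
    exact isArtinian_of_kill I fun a => mem_gam_of_injective (Submodule.subtype _)
      (Submodule.injective_subtype _) (hM a)
  have hle : ∃ N, ∀ u : M, (∀ r ∈ I, r • u ∈ gam (maximalIdeal R) M) →
      u ∈ gam (maximalIdeal R) M ⊔ kill (I ^ N) M := by
    obtain ⟨s, z, hsz⟩ := Submodule.fg_iff_exists_fin_generating_family.1
      (IsNoetherian.noetherian I)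
    have hzI : ∀ i, z i ∈ I := fun i => hsz ▸ Submodule.subset_span ⟨i, rfl⟩
    let K : Submodule R (Fin s → gam (maximalIdeal R) M) :=
      LinearMap.range (LinearMap.pi fun j => (LinearMap.lsmul R _ (z j) :
        gam (maximalIdeal R) M →ₗ[R] gam (maximalIdeal R) M))
    obtain ⟨N, hN⟩ := dual_artin_rees I K
    refine ⟨N + 1, fun u hu => ?_⟩
    obtain ⟨_, ⟨a, rfl⟩, t', ht', hat⟩ := Submodule.mem_sup.1
      (hN (fun j => ⟨z j • u, hu _ (hzI j)⟩) fun r hr => ⟨⟨r • u, hu r hr⟩, by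
        ext j
        change z j • r • u = r • z j • u
        rw [smul_comm]⟩)
    refine Submodule.mem_sup.2 ⟨a, a.2, u - a, ?_, by abel⟩
    have h1 : ∀ j, z j • (u - a) = (t' j : M) := by
      intro j
      have := congrArg Subtype.val (congrFun hat j)
      change z j • (a : M) + (t' j : M) = z j • u at this
      rw [smul_sub, ← this, add_sub_cancel_left]
    rw [pow_succ', mem_kill_mul]
    intro r hr
    have h2 : I ≤ Submodule.comap (LinearMap.toSpanSingleton R M (u - a)) (kill (I ^ N) M) := by
      conv_lhs => rw [← hsz]
      rw [Submodule.span_le]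
      rintro _ ⟨j, rfl⟩
      change z j • (u - (a : M)) ∈ kill (I ^ N) M
      rw [h1]
      exact map_mem_kill (Submodule.subtype _) (map_mem_kill (LinearMap.proj j) ht')
    exact h2 hr
  obtain ⟨N, hN⟩ := hle
  let A := gam (maximalIdeal R) M
  have hNoe : IsNoetherian R (kill I (M ⧸ A)) := by
    have h1 : kill I (M ⧸ A) ≤ (kill (I ^ N) M).map A.mkQ := by
      intro q hq
      obtain ⟨u, rfl⟩ := A.mkQ_surjective q
      obtain ⟨a, ha, v, hv, rfl⟩ := Submodule.mem_sup.1 (hN u fun r hr => by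
        have := mem_kill.1 hq r hr
        rw [← map_smul] at this
        exact (Submodule.Quotient.mk_eq_zero _).1 this)
      refine ⟨v, hv, ?_⟩
      rw [map_add]
      have : A.mkQ a = 0 := (Submodule.Quotient.mk_eq_zero _).2 ha
      rw [this, zero_add]
    have := isNoetherian_kill_pow (N := M) I N
    have : IsNoetherian R ((kill (I ^ N) M).map A.mkQ) := inferInstance
    exact isNoetherian_of_le h1
  have hbot : kill I (M ⧸ A) = ⊥ := by
    refine Submodule.eq_bot_of_le_smul_of_le_jacobson_bot (maximalIdeal R) _
      (isNoetherian_submodule.1 hNoe _ le_rfl) ?_ (by rw [jacobson_eq_maximalIdeal _ bot_ne_top])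
    intro q hq
    obtain ⟨u, rfl⟩ := A.mkQ_surjective q
    obtain ⟨u', hu'⟩ := hdiv u
    have h1 : x • A.mkQ u' = A.mkQ u := by
      rw [← map_smul]
      exact (Submodule.Quotient.eq _).2 hu'
    have h2 : ∀ v : M, x • A.mkQ v = 0 → A.mkQ v = 0 := by
      intro v hv
      rw [← map_smul] at hv
      obtain ⟨k, hk⟩ := (Submodule.Quotient.mk_eq_zero _).1 hv
      refine (Submodule.Quotient.mk_eq_zero _).2 (hx (mem_gam_span_singleton.2 ⟨k + 1, ?_⟩))
      rw [pow_succ, mul_smul]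
      exact mem_kill.1 hk _ (Ideal.pow_mem_pow hxm k)
    rw [← h1]
    refine Submodule.smul_mem_smul hxm (mem_kill.2 fun r hr => ?_)
    rw [← map_smul]
    refine h2 _ ?_
    rw [map_smul, smul_comm, h1, mem_kill.1 hq r hr]
  have hall : ∀ u : M, u ∈ A := by
    intro u
    refine (Submodule.Quotient.mk_eq_zero _).1 (eq_bot_of_kill_eq_bot (N := M ⧸ A) I
      (fun q hq => ?_) (A.mkQ u) (map_mem_gam _ (hM u)))
    rw [hbot] at hq
    exact hq
  refine ⟨?_, hall⟩
  have h3 : A = ⊤ := eq_top_iff.2 fun u _ => hall u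
  have h4 : IsArtinian R (⊤ : Submodule R M) := h3 ▸ this
  exact (LinearEquiv.isArtinian_iff Submodule.topEquiv).1 h4

end Melkersson

namespace InjRes

variable {R : Type u} [CommRing R] [IsNoetherianRing R] {X : InjRes R} {n : ℕ}

/-- Surjectivity of the connecting map of a Mayer-Vietoris sequence. -/
theorem exists_surjective_of_acyc {I a b J : Ideal R} (hIa : I ≤ a) (hIb : I ≤ b)
    (hab : a ⊓ b ≤ I.radical) (hJ : J ≤ (a ⊔ b).radical) (haJ : a ≤ J) (hbJ : b ≤ J)
    (ha : X.Acyc (X.G a) (n + 1)) (hb : X.Acyc (X.G b) (n + 1)) :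
    ∃ θ : X.hcoh (X.G I) n →ₗ[R] X.hcoh (X.G J) (n + 1), Function.Surjective θ := by
  have hdec : ∀ {i} {c : X.E i}, c ∈ gam I (X.E i) → ∃ ca ∈ gam a (X.E i), ∃ cb ∈ gam b (X.E i),
      ca + cb = c := fun {i c} hc => Submodule.mem_sup.1
    (gam_inf_le_of_baer (X.baer i) a b (gam_anti_of_le_radical hab hc))
  have hmem : ∀ {i} {c : X.E i}, c ∈ gam a (X.E i) → c ∈ gam b (X.E i) → c ∈ gam J (X.E i) := by
    intro i c h1 h2
    refine gam_anti_of_le_radical hJ ?_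
    rw [gam_sup]
    exact ⟨h1, h2⟩
  let Y : Submodule R (X.E (n + 1) × X.E (n + 1)) :=
    ((gam a _).prod (gam b _)) ⊓ LinearMap.ker
      ((X.δ (n + 1)) ∘ₗ LinearMap.fst R _ _ - (X.δ (n + 1)) ∘ₗ LinearMap.snd R _ _)
  have hY : ∀ y : Y, X.δ (n + 1) y.1.1 = X.δ (n + 1) y.1.2 := fun y => sub_eq_zero.1 y.2.2
  let f : Y →ₗ[R] X.hcoh (X.G I) n := cls ∘ₗ
    ((LinearMap.fst R _ _ - LinearMap.snd R _ _) ∘ₗ Y.subtype).codRestrict (X.cyc (X.G I) n)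
      (fun y => ⟨sub_mem (gam_anti hIa y.2.1.1) (gam_anti hIb y.2.1.2), by
        change X.δ (n + 1) (y.1.1 - y.1.2) = 0
        rw [map_sub, hY, sub_self]⟩)
  let g : Y →ₗ[R] X.hcoh (X.G J) (n + 1) := cls ∘ₗ
    (X.δ (n + 1) ∘ₗ LinearMap.fst R _ _ ∘ₗ Y.subtype).codRestrict (X.cyc (X.G J) (n + 1))
      (fun y => ⟨hmem (map_mem_gam (X.δ (n + 1)) y.2.1.1) (by
        change X.δ (n + 1) y.1.1 ∈ _
        rw [hY]
        exact map_mem_gam _ y.2.1.2), X.δ_δ _ _⟩)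
  have hf : Function.Surjective f := by
    intro c
    obtain ⟨⟨c, hc, hc'⟩, rfl⟩ := cls_surjective c
    obtain ⟨ca, hca, cb, hcb, rfl⟩ := hdec hc
    refine ⟨⟨(ca, -cb), ⟨hca, neg_mem hcb⟩, ?_⟩, ?_⟩
    · change X.δ (n + 1) ca - X.δ (n + 1) (-cb) = 0
      rw [map_neg, sub_neg_eq_add, ← map_add]
      exact hc'
    · change cls _ = cls _
      congr 1
      exact Subtype.ext (sub_neg_eq_add ca cb)
  have hg : Function.Surjective g := by
    intro c
    obtain ⟨⟨c, hc, hc'⟩, rfl⟩ := cls_surjective c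
    obtain ⟨ea, hea, h1⟩ := ha c (gam_anti haJ hc) hc'
    obtain ⟨eb, heb, h2⟩ := hb c (gam_anti hbJ hc) hc'
    refine ⟨⟨(ea, eb), ⟨hea, heb⟩, sub_eq_zero.2 (h1.trans h2.symm)⟩, ?_⟩
    change cls _ = cls _
    congr 1
    exact Subtype.ext h1
  have hker : LinearMap.ker f ≤ LinearMap.ker g := by
    intro y hy
    obtain ⟨e, he, h1⟩ := cls_eq_zero.1 (show cls _ = 0 from hy)
    obtain ⟨ea, hea, eb, heb, rfl⟩ := hdec he
    change X.δ n (ea + eb) = y.1.1 - y.1.2 at h1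
    refine cls_eq_zero.2 ⟨y.1.1 - X.δ n ea, hmem (sub_mem y.2.1.1 (map_mem_gam _ hea)) ?_, ?_⟩
    · have h2 : y.1.1 - X.δ n ea = y.1.2 + X.δ n eb := by
        rw [map_add] at h1
        rw [sub_eq_iff_eq_add, add_assoc, add_comm (X.δ n eb), h1, add_sub_cancel]
      rw [h2]
      exact add_mem y.2.1.2 (map_mem_gam _ heb)
    · rw [map_sub, δ_δ, sub_zero]
      rfl
  obtain ⟨θ, hθ⟩ := exists_comp_eq_of_ker_le f hf g hker
  refine ⟨θ, fun h => ?_⟩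
  obtain ⟨y, rfl⟩ := hg h
  exact ⟨f y, LinearMap.congr_fun hθ y⟩

theorem exists_smul_sub_mem_gam {I : Ideal R} {x : R}
    (h : X.Acyc (X.G (I ⊔ Ideal.span {x})) (n + 1)) (u : X.hcoh (X.G I) n) :
    ∃ u', x • u' - u ∈ gam (Ideal.span {x}) (X.hcoh (X.G I) n) := by
  obtain ⟨⟨c, ⟨k, hk⟩, hc'⟩, rfl⟩ := cls_surjective u
  obtain ⟨N, hN⟩ := exists_pow_smul_eq_of_baer (X.baer (n + 1)) (I ^ k) x
  obtain ⟨c₁, hc₁, hcc⟩ := hN 1 c hk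
  have h1 : x • c₁ - c ∈ gam (Ideal.span {x}) (X.E (n + 1)) :=
    mem_gam_span_singleton.2 ⟨N, by rw [smul_sub, smul_smul, ← pow_succ, hcc, sub_self]⟩
  have h2 : X.δ (n + 1) c₁ ∈ gam (Ideal.span {x}) (X.E (n + 1 + 1)) := by
    obtain ⟨j, hj⟩ := mem_gam_span_singleton.1 (map_mem_gam (X.δ (n + 1)) h1)
    have hc'' : X.δ (n + 1) c = 0 := hc'
    rw [map_sub, hc'', sub_zero, map_smul, smul_smul, ← pow_succ] at hj
    exact mem_gam_span_singleton.2 ⟨_, hj⟩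
  obtain ⟨f, hf, hfc⟩ := h (X.δ (n + 1) c₁) (by
    change _ ∈ gam _ _
    rw [gam_sup]
    exact ⟨map_mem_gam _ (kill_le_gam _ _ hc₁), h2⟩) (X.δ_δ _ _)
  change f ∈ gam _ _ at hf
  rw [gam_sup] at hf
  refine ⟨cls ⟨c₁ - f, sub_mem (kill_le_gam _ _ hc₁) hf.1,
    (map_sub _ _ _).trans (sub_eq_zero.2 hfc.symm)⟩, ?_⟩
  rw [← map_smul, ← map_sub]
  refine map_mem_gam cls (mem_gam_of_injective (X.cyc _ n).subtype
    (X.cyc _ n).injective_subtype ?_)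
  have h3 : x • (c₁ - f) - c = (x • c₁ - c) - x • f := by
    rw [smul_sub]
    abel
  change x • (c₁ - f) - c ∈ _
  rw [h3]
  exact sub_mem h1 (Submodule.smul_mem _ _ hf.2)

variable [IsLocalRing R]

theorem CM.not_isNoetherian_kill [IsDomain (AdicCompletion (maximalIdeal R) R)]
    (h : X.CM (n + 1)) {I a b : Ideal R} (h2 : 2 ≤ ringKrullDim (R ⧸ I)) (hI : I ≤ maximalIdeal R)
    (hIa : I ≤ a) (hIb : I ≤ b) (hab : a ⊓ b ≤ I.radical)
    (hJ : maximalIdeal R ≤ (a ⊔ b).radical) (ham : ¬ maximalIdeal R ≤ a.radical)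
    (hbm : ¬ maximalIdeal R ≤ b.radical) (ha : a ≤ maximalIdeal R) (hb : b ≤ maximalIdeal R) :
    ¬ IsNoetherian R (kill I (X.hcoh (X.G I) n)) := by
  intro hN
  have hz : ∀ {J : Ideal R}, ¬ maximalIdeal R ≤ J.radical →
      ∃ z ∈ maximalIdeal R, ∀ k, z ^ k ∉ J := by
    intro J hJ
    obtain ⟨z, hz, hz'⟩ := SetLike.not_le_iff_exists.1 hJ
    exact ⟨z, hz, fun k hk => hz' ⟨k, hk⟩⟩
  have hac : ∀ {J : Ideal R}, J ≤ maximalIdeal R → ¬ maximalIdeal R ≤ J.radical →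
      X.Acyc (X.G J) (n + 1) := by
    intro J hJ hJ'
    obtain ⟨z, hzm, hz'⟩ := hz hJ'
    exact h.acyc_gam hJ hzm hz'
  obtain ⟨θ, hθ⟩ := exists_surjective_of_acyc hIa hIb hab hJ ha hb (hac ha ham) (hac hb hbm)
  have hMI := mem_gam_hcoh (X := X) (n := n) I
  obtain ⟨x, hxm, hx⟩ := exists_gam_span_singleton_le I hMI
  have hIx := not_maximalIdeal_le_radical_sup I h2 hxm
  have hdiv := exists_smul_sub_mem_gam (n := n)
    (hac (sup_le hI (Ideal.span_le.2 (Set.singleton_subset_iff.2 hxm))) hIx)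
  obtain ⟨hArt, hall⟩ := mem_gam_of_divisible I hMI hxm hx fun u =>
    (hdiv u).imp fun _ hu => hx hu
  obtain ⟨z, hzm, hz'⟩ := hz fun hle => hIx (hle.trans (Ideal.radical_mono le_sup_left))
  refine not_acyc_gam h.kill_eq_zero h.acyc h.not_acyc (acyc_iff.2 ?_)
  refine eq_zero_of_paramDivisible h.dim hall θ hθ paramDivisible_hcoh I hI z hzm hz' fun N => ?_
  have := isNoetherian_kill_pow (N := X.hcoh (X.G I) n) I N
  obtain ⟨k, hk⟩ := exists_kill_of_finite (kill (I ^ N) (X.hcoh (X.G I) n))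
    (isNoetherian_submodule.1 this _ le_rfl) (fun u _ => hall u)
  refine ⟨k, fun u hu => ?_⟩
  rw [mem_kill.1 (hk hu) _ (Ideal.pow_mem_pow hzm k), map_zero]

end InjRes

end LocCoh

namespace LocCoh

open IsLocalRing

theorem exists_ideals_of_not_isPreconnected {R : Type u} [CommRing R] [IsLocalRing R] {I : Ideal R}
    (hdisc : ¬ _root_.IsPreconnected {p : PrimeSpectrum (R ⧸ I) |
      p.asIdeal.comap (Ideal.Quotient.mk I) ≠ maximalIdeal R}) :
    ∃ a b : Ideal R, I ≤ a ∧ I ≤ b ∧ a ⊓ b ≤ I.radical ∧ maximalIdeal R ≤ (a ⊔ b).radical ∧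
      ¬ maximalIdeal R ≤ a.radical ∧ ¬ maximalIdeal R ≤ b.radical ∧
      a ≤ maximalIdeal R ∧ b ≤ maximalIdeal R := by
  rw [isPreconnected_closed_iff] at hdisc
  push Not at hdisc
  obtain ⟨t, t', ht, ht', hcov, ⟨p, hpS, hpt⟩, ⟨q, hqS, hqt⟩, hemp⟩ := hdisc
  obtain ⟨a', rfl⟩ := (PrimeSpectrum.isClosed_iff_zeroLocus_ideal _).1 ht
  obtain ⟨b', rfl⟩ := (PrimeSpectrum.isClosed_iff_zeroLocus_ideal _).1 ht'
  have hle : ∀ J' : Ideal (R ⧸ I), I ≤ J'.comap (Ideal.Quotient.mk I) := fun J' r hr => by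
    rw [Ideal.mem_comap, Ideal.Quotient.eq_zero_iff_mem.2 hr]
    exact zero_mem _
  have hproper : ∀ (J' : Ideal (R ⧸ I)) (p : PrimeSpectrum (R ⧸ I)),
      p.asIdeal.comap (Ideal.Quotient.mk I) ≠ maximalIdeal R → J' ≤ p.asIdeal →
      ¬ maximalIdeal R ≤ (J'.comap (Ideal.Quotient.mk I)).radical ∧
        J'.comap (Ideal.Quotient.mk I) ≤ maximalIdeal R := by
    intro J' p hp hJ
    have hJ' := Ideal.comap_mono (f := Ideal.Quotient.mk I) hJ
    have hpp : (p.asIdeal.comap (Ideal.Quotient.mk I)).IsPrime := inferInstance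
    have hpm := le_maximalIdeal hpp.ne_top
    exact ⟨fun h => hp (le_antisymm hpm (h.trans (hpp.radical_le_iff.2 hJ'))), hJ'.trans hpm⟩
  have hlift : ∀ P : Ideal R, P.IsPrime → I ≤ P → ∃ p : PrimeSpectrum (R ⧸ I),
      p.asIdeal.comap (Ideal.Quotient.mk I) = P := by
    intro P hP hIP
    have hker : RingHom.ker (Ideal.Quotient.mk I) ≤ P := by rwa [Ideal.mk_ker]
    refine ⟨⟨P.map (Ideal.Quotient.mk I),
      Ideal.map_isPrime_of_surjective Ideal.Quotient.mk_surjective hker⟩, ?_⟩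
    change (P.map (Ideal.Quotient.mk I)).comap (Ideal.Quotient.mk I) = P
    rw [Ideal.comap_map_of_surjective _ Ideal.Quotient.mk_surjective, ← RingHom.ker_eq_comap_bot,
      sup_eq_left]
    exact hker
  have hpa := hproper a' p hpS hpt
  have hqb := hproper b' q hqS hqt
  refine ⟨_, _, hle a', hle b', ?_, ?_, hpa.1, hqb.1, hpa.2, hqb.2⟩
  · rw [Ideal.radical_eq_sInf]
    rintro r ⟨hra, hrb⟩
    rw [Submodule.mem_sInf]
    rintro P ⟨hIP, hP⟩
    by_cases hPm : P = maximalIdeal R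
    · exact hPm ▸ hpa.2 hra
    · obtain ⟨s, rfl⟩ := hlift P hP hIP
      rcases hcov (show s ∈ _ from hPm) with h | h
      · exact h hra
      · exact h hrb
  · rw [Ideal.radical_eq_sInf]
    refine le_sInf ?_
    rintro P ⟨hIP, hP⟩
    by_contra hPm
    obtain ⟨s, rfl⟩ := hlift P hP ((hle a').trans (le_sup_left.trans hIP))
    have hs : ∀ J' : Ideal (R ⧸ I), J'.comap (Ideal.Quotient.mk I) ≤
        s.asIdeal.comap (Ideal.Quotient.mk I) → J' ≤ s.asIdeal := fun J' h =>
      (Ideal.comap_le_comap_iff_of_surjective _ Ideal.Quotient.mk_surjective _ _).1 h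
    have : s ∈ (∅ : Set (PrimeSpectrum (R ⧸ I))) := hemp ▸
      ⟨fun h => hPm h.ge, hs _ (le_sup_left.trans hIP), hs _ (le_sup_right.trans hIP)⟩
    exact this

end LocCoh

namespace LocCoh

section Homology

variable {R : Type u} [CommRing R]

/-- The homology class of a cocycle of a cochain complex of modules. -/
def homologyCls (K : CochainComplex (ModuleCat.{u} R) ℕ) (n : ℕ) :
    LinearMap.ker (K.d n (n + 1)).hom →ₗ[R] K.homology n :=
  (K.liftCycles (ModuleCat.ofHom (LinearMap.ker (K.d n (n + 1)).hom).subtype) (n + 1) (by simp)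
    (by ext x; exact x.2) ≫ K.homologyπ n).hom

theorem iCycles_liftCycles (K : CochainComplex (ModuleCat.{u} R) ℕ) (n : ℕ)
    (x : LinearMap.ker (K.d n (n + 1)).hom) :
    K.iCycles n (K.liftCycles (ModuleCat.ofHom (LinearMap.ker (K.d n (n + 1)).hom).subtype) (n + 1)
      (by simp) (by ext x; exact x.2) x) = x := by
  rw [← ModuleCat.comp_apply, K.liftCycles_i]
  rfl

theorem homologyCls_surjective (K : CochainComplex (ModuleCat.{u} R) ℕ) (n : ℕ) :
    Function.Surjective (homologyCls K n) := by
  intro y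
  obtain ⟨z, rfl⟩ := (ModuleCat.epi_iff_surjective (K.homologyπ n)).1 inferInstance y
  have hz : K.d n (n + 1) (K.iCycles n z) = 0 := by
    rw [← ModuleCat.comp_apply, K.iCycles_d]; rfl
  refine ⟨⟨K.iCycles n z, hz⟩, ?_⟩
  change K.homologyπ n (K.liftCycles _ _ _ _ _) = _
  congr 1
  apply (ModuleCat.mono_iff_injective (K.iCycles n)).1 inferInstance
  rw [← ModuleCat.comp_apply, K.liftCycles_i]
  rfl

theorem homologyCls_eq_zero (K : CochainComplex (ModuleCat.{u} R) ℕ) (n : ℕ)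
    (x : LinearMap.ker (K.d (n + 1) (n + 1 + 1)).hom) :
    homologyCls K (n + 1) x = 0 ↔ ∃ y, K.d n (n + 1) y = x := by
  have hi := (ModuleCat.mono_iff_injective (K.iCycles (n + 1))).1 inferInstance
  change K.homologyπ (n + 1) (K.liftCycles _ _ _ _ _) = 0 ↔ _
  have hex : (ShortComplex.mk (K.toCycles n (n + 1)) (K.homologyπ (n + 1)) (by simp)).Exact :=
    ShortComplex.exact_of_g_is_cokernel _ (K.homologyIsCokernel n (n + 1) (by simp))
  have key : ∀ z : K.cycles (n + 1), K.homologyπ (n + 1) z = 0 ↔ ∃ y, K.toCycles n (n + 1) y = z :=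
    fun z => ⟨fun h => (ShortComplex.moduleCat_exact_iff _).1 hex z h, by
      rintro ⟨y, rfl⟩
      rw [← ModuleCat.comp_apply, K.toCycles_comp_homologyπ]; rfl⟩
  rw [key]
  refine exists_congr fun y => ?_
  rw [← hi.eq_iff, ← ModuleCat.comp_apply, ← ModuleCat.comp_apply, K.liftCycles_i, K.toCycles_i]
  rfl

theorem homologyMap_homologyCls {K L : CochainComplex (ModuleCat.{u} R) ℕ} (φ : K ⟶ L) (n : ℕ)
    (x : LinearMap.ker (K.d n (n + 1)).hom) (y : LinearMap.ker (L.d n (n + 1)).hom)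
    (h : φ.f n x = y) :
    HomologicalComplex.homologyMap φ n (homologyCls K n x) = homologyCls L n y := by
  have hi := (ModuleCat.mono_iff_injective (L.iCycles n)).1 inferInstance
  change HomologicalComplex.homologyMap φ n (K.homologyπ n (K.liftCycles _ _ _ _ _)) =
    L.homologyπ n (L.liftCycles _ _ _ _ _)
  rw [← ModuleCat.comp_apply, HomologicalComplex.homologyπ_naturality, ModuleCat.comp_apply]
  congr 1
  apply hi
  rw [← ModuleCat.comp_apply, HomologicalComplex.cyclesMap_i, ModuleCat.comp_apply,
    iCycles_liftCycles, iCycles_liftCycles, h]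

end Homology

section OldExt

theorem unop_square {V : Type*} [Category* V] {L L' H H' : Vᵒᵖ} {K K' : V} {a : L ≅ H}
    {b : L' ≅ H'} {g : L ⟶ L'} {γ : H ⟶ H'} (h : g ≫ b.hom = a.hom ≫ γ)
    {p : H ≅ Opposite.op K} {q : H' ≅ Opposite.op K'} {k : K' ⟶ K}
    (h' : γ ≫ q.hom = p.hom ≫ k.op) :
    g.unop ≫ (a.unop.symm ≪≫ p.unop.symm).hom = (b.unop.symm ≪≫ q.unop.symm).hom ≫ k := by
  apply Quiver.Hom.op_inj
  simp only [Iso.trans_hom, Iso.symm_hom, op_comp, Category.assoc]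
  change p.inv ≫ a.inv ≫ g = k.op ≫ q.inv ≫ b.inv
  rw [← cancel_mono b.hom, Category.assoc, Category.assoc, h, ← cancel_mono q.hom]
  simp [h']

variable {R : Type u} [CommRing R]

/-- The map induced on complexes of homomorphisms. -/
def linearYonedaMap {P Q : ChainComplex (ModuleCat.{u} R) ℕ} (φ : P ⟶ Q) (Y : ModuleCat.{u} R) :
    Q.linearYonedaObj R Y ⟶ P.linearYonedaObj R Y :=
  (HomologicalComplex.unopFunctor _ _).map
    ((((linearYoneda R (ModuleCat.{u} R)).obj Y).rightOp.mapHomologicalComplex _).map φ).op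

theorem isoExt_naturality {X X' : ModuleCat.{u} R} (f : X ⟶ X') (P : ProjectiveResolution X)
    (Q : ProjectiveResolution X') (φ : P.complex ⟶ Q.complex)
    (comm : φ.f 0 ≫ Q.π.f 0 = P.π.f 0 ≫ f) (n : ℕ) (Y : ModuleCat.{u} R) :
    ((Ext R (ModuleCat.{u} R) n).map f.op).app Y ≫ (P.isoExt n Y).hom =
      (Q.isoExt n Y).hom ≫ HomologicalComplex.homologyMap (linearYonedaMap φ Y) n := by
  have h1 := ProjectiveResolution.isoLeftDerivedObj_hom_naturality f P Q φ comm
    ((linearYoneda R (ModuleCat.{u} R)).obj Y).rightOp n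
  have h2 := HomologicalComplex.homologyOp_hom_naturality (linearYonedaMap φ Y) n
  exact unop_square h1 h2

end OldExt
end LocCoh

namespace LocCoh

section Compare

variable {R : Type u} [CommRing R]

theorem homologyCls_zero_injective (K : CochainComplex (ModuleCat.{u} R) ℕ) :
    Function.Injective (homologyCls K 0) := by
  have : IsIso (K.homologyπ 0) := K.isIso_homologyπ 0 0 (by simp) (K.shape _ _ (by simp))
  intro x y h
  have h' := (ModuleCat.mono_iff_injective (K.homologyπ 0)).1 inferInstance h
  have h'' := congrArg (K.iCycles 0) h'
  erw [iCycles_liftCycles, iCycles_liftCycles] at h''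
  exact Subtype.ext h''

variable {X Y : ModuleCat.{u} R}

/-- The cocycles computing extension modules by a projective resolution. -/
def projCyc (P : ProjectiveResolution X) (Y : ModuleCat.{u} R) (n : ℕ) :
    Submodule R (P.complex.X n ⟶ Y) :=
  LinearMap.ker (Linear.leftComp R Y (P.complex.d (n + 1) n))

theorem mem_projCyc {P : ProjectiveResolution X} {n : ℕ} {f : P.complex.X n ⟶ Y} :
    f ∈ projCyc P Y n ↔ P.complex.d (n + 1) n ≫ f = 0 := Iff.rfl

/-- Cocycles as elements of the complex of homomorphisms. -/
def projCycToKer (P : ProjectiveResolution X) (Y : ModuleCat.{u} R) (n : ℕ) :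
    projCyc P Y n →ₗ[R] LinearMap.ker ((P.complex.linearYonedaObj R Y).d n (n + 1)).hom where
  toFun x := ⟨x.1, x.2⟩
  map_add' _ _ := rfl
  map_smul' _ _ := rfl

/-- The class of a cocycle in the derived functor model of extension modules. -/
def oldCls (P : ProjectiveResolution X) (Y : ModuleCat.{u} R) (n : ℕ) :
    projCyc P Y n →ₗ[R] ((Ext R (ModuleCat.{u} R) n).obj (Opposite.op X)).obj Y :=
  (P.isoExt n Y).inv.hom ∘ₗ homologyCls (P.complex.linearYonedaObj R Y) n ∘ₗ projCycToKer P Y n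

theorem oldCls_surjective (P : ProjectiveResolution X) (n : ℕ) :
    Function.Surjective (oldCls P Y n) :=
  ((ModuleCat.epi_iff_surjective (P.isoExt n Y).inv).1 inferInstance).comp
    ((homologyCls_surjective _ n).comp fun x => ⟨⟨x.1, x.2⟩, rfl⟩)

theorem isoExt_inv_injective (P : ProjectiveResolution X) (n : ℕ) :
    Function.Injective (P.isoExt (R := R) n Y).inv :=
  (ModuleCat.mono_iff_injective _).1 inferInstance

theorem oldCls_eq_zero (P : ProjectiveResolution X) (n : ℕ) (x : projCyc P Y (n + 1)) :
    oldCls P Y (n + 1) x = 0 ↔ ∃ g : P.complex.X n ⟶ Y, P.complex.d (n + 1) n ≫ g = x :=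
  (map_eq_zero_iff _ (isoExt_inv_injective P (n + 1))).trans
    (homologyCls_eq_zero (P.complex.linearYonedaObj R Y) n (projCycToKer P Y (n + 1) x))

theorem oldCls_naturality {X X' : ModuleCat.{u} R} (f : X ⟶ X') (P : ProjectiveResolution X)
    (Q : ProjectiveResolution X') (φ : P.complex ⟶ Q.complex)
    (comm : φ.f 0 ≫ Q.π.f 0 = P.π.f 0 ≫ f) (n : ℕ) (x : projCyc Q Y n) (y : projCyc P Y n)
    (h : φ.f n ≫ x.1 = y.1) :
    ((Ext R (ModuleCat.{u} R) n).map f.op).app Y (oldCls Q Y n x) = oldCls P Y n y := by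
  apply (ModuleCat.mono_iff_injective (P.isoExt (R := R) n Y).hom).1 inferInstance
  have h1 := congrArg (fun k => k.hom (oldCls Q Y n x)) (isoExt_naturality f P Q φ comm n Y)
  refine h1.trans ?_
  have h2 : ∀ {X : ModuleCat.{u} R} (P : ProjectiveResolution X) (x : projCyc P Y n),
      (P.isoExt n Y).hom.hom (oldCls P Y n x) = homologyCls _ n (projCycToKer P Y n x) :=
    fun P x => congrArg (fun k => k.hom (homologyCls _ n (projCycToKer P Y n x)))
      (P.isoExt n Y).inv_hom_id
  refine Eq.trans ?_ (h2 P y).symm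
  refine (congrArg (HomologicalComplex.homologyMap (linearYonedaMap φ Y) n).hom (h2 Q x)).trans ?_
  exact homologyMap_homologyCls _ n _ _ h

/-- The class of a cocycle in the derived category model of extension modules. -/
def newCls (P : ProjectiveResolution X) (Y : ModuleCat.{u} R) (n : ℕ) :
    projCyc P Y n →ₗ[R] Abelian.Ext X Y n where
  toFun x := P.extMk x.1 (n + 1) rfl (mem_projCyc.1 x.2)
  map_add' x y := (P.add_extMk _ _ _ _ _ _).symm
  map_smul' r x := by
    rw [RingHom.id_apply, Abelian.Ext.smul_eq_comp_mk₀]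
    refine Eq.trans ?_ (P.extMk_comp_mk₀ x.1 _ rfl x.2 _).symm
    congr 1

theorem newCls_surjective (P : ProjectiveResolution X) (n : ℕ) :
    Function.Surjective (newCls P Y n) := fun α => by
  obtain ⟨f, hf, rfl⟩ := P.extMk_surjective α (n + 1) rfl
  exact ⟨⟨f, hf⟩, rfl⟩

theorem newCls_eq_zero (P : ProjectiveResolution X) (n : ℕ) (x : projCyc P Y (n + 1)) :
    newCls P Y (n + 1) x = 0 ↔ ∃ g : P.complex.X n ⟶ Y, P.complex.d (n + 1) n ≫ g = x :=
  P.extMk_eq_zero_iff x.1 (n + 1 + 1) rfl x.2 n rfl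

theorem ker_oldCls (P : ProjectiveResolution X) (n : ℕ) :
    LinearMap.ker (oldCls P Y (n + 1)) = LinearMap.ker (newCls P Y (n + 1)) := by
  ext x
  rw [LinearMap.mem_ker, LinearMap.mem_ker, oldCls_eq_zero, newCls_eq_zero]

/-- Linear maps with the same kernel out of a common source have isomorphic images. -/
def equivOfKer {A B C : Type*} [AddCommGroup A] [AddCommGroup B] [AddCommGroup C] [Module R A]
    [Module R B] [Module R C] (f : A →ₗ[R] B) (g : A →ₗ[R] C) (hf : Function.Surjective f)
    (hg : Function.Surjective g) (h : LinearMap.ker f = LinearMap.ker g) : B ≃ₗ[R] C :=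
  (f.quotKerEquivOfSurjective hf).symm ≪≫ₗ Submodule.quotEquivOfEq _ _ h ≪≫ₗ
    g.quotKerEquivOfSurjective hg

theorem equivOfKer_apply {A B C : Type*} [AddCommGroup A] [AddCommGroup B] [AddCommGroup C]
    [Module R A] [Module R B] [Module R C] (f : A →ₗ[R] B) (g : A →ₗ[R] C)
    (hf : Function.Surjective f) (hg : Function.Surjective g)
    (h : LinearMap.ker f = LinearMap.ker g) (a : A) : equivOfKer f g hf hg h (f a) = g a := by
  have : (f.quotKerEquivOfSurjective hf).symm (f a) = Submodule.Quotient.mk a := by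
    rw [LinearEquiv.symm_apply_eq]; rfl
  simp only [equivOfKer, LinearEquiv.trans_apply, this]
  rfl

variable (X Y) in
/-- The two models of extension modules agree in positive degrees. -/
def extCompare (n : ℕ) : ((Ext R (ModuleCat.{u} R) (n + 1)).obj (Opposite.op X)).obj Y ≃ₗ[R]
    Abelian.Ext X Y (n + 1) :=
  equivOfKer _ _ (oldCls_surjective (projectiveResolution X) _)
    (newCls_surjective _ _) (ker_oldCls _ n)

theorem extCompare_naturality {X X' : ModuleCat.{u} R} (f : X ⟶ X') (n : ℕ)
    (z : ((Ext R (ModuleCat.{u} R) (n + 1)).obj (Opposite.op X')).obj Y) :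
    extCompare X Y n (((Ext R (ModuleCat.{u} R) (n + 1)).map f.op).app Y z) =
      (Abelian.Ext.mk₀ f).comp (extCompare X' Y n z) (zero_add _) := by
  obtain ⟨x, rfl⟩ := oldCls_surjective (projectiveResolution X') (n + 1) z
  let P := projectiveResolution X
  let Q := projectiveResolution X'
  let φ : P.Hom Q f :=
    ⟨ProjectiveResolution.lift f P Q, ProjectiveResolution.lift_commutes_zero f P Q⟩
  have hy : φ.hom.f (n + 1) ≫ x.1 ∈ projCyc P Y (n + 1) := by
    rw [mem_projCyc, ← φ.hom.comm_assoc, mem_projCyc.1 x.2, Limits.comp_zero]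
  rw [oldCls_naturality f P Q φ.hom (ProjectiveResolution.lift_commutes_zero f P Q) (n + 1) x
    ⟨_, hy⟩ rfl]
  refine (equivOfKer_apply _ _ _ _ _ _).trans ?_
  refine Eq.trans ?_ (congrArg (fun w => (Abelian.Ext.mk₀ f).comp w (zero_add _))
    (equivOfKer_apply _ _ _ _ _ _).symm)
  exact (ProjectiveResolution.mk₀_comp_extMk x.1 _ rfl x.2 φ).symm

end Compare

end LocCoh

namespace LocCoh

section Kill

variable {R : Type u} [CommRing R]

/-- The elements annihilated by an ideal correspond to homomorphisms from the quotient. -/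
def killEquiv (J : Ideal R) (N : Type u) [AddCommGroup N] [Module R N] :
    kill J N ≃ₗ[R] ((R ⧸ J) →ₗ[R] N) :=
  { toFun := fun x => homOfKill x.2
    map_add' := fun x y => LinearMap.ext fun q => by
      obtain ⟨q, rfl⟩ := Ideal.Quotient.mk_surjective q
      change q • (x.1 + y.1) = q • x.1 + q • y.1
      exact smul_add _ _ _
    map_smul' := fun c x => LinearMap.ext fun q => by
      obtain ⟨q, rfl⟩ := Ideal.Quotient.mk_surjective q
      change q • c • x.1 = c • q • x.1
      exact smul_comm _ _ _
    invFun := fun f => ⟨f (Ideal.Quotient.mk J 1), mem_kill.2 fun r hr => by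
      rw [← map_smul, ← map_zero f]
      congr 1
      rw [Algebra.smul_def, map_one, mul_one]
      exact Ideal.Quotient.eq_zero_iff_mem.2 hr⟩
    left_inv := fun x => Subtype.ext (one_smul R x.1)
    right_inv := fun f => LinearMap.ext fun q => by
      obtain ⟨q, rfl⟩ := Ideal.Quotient.mk_surjective q
      change q • f (Ideal.Quotient.mk J 1) = _
      rw [← map_smul, Algebra.smul_def, map_one, mul_one]
      rfl }

theorem hom_ext_of_one {J : Ideal R} {N : Type u} [AddCommGroup N] [Module R N]
    {f g : (R ⧸ J) →ₗ[R] N} (h : f 1 = g 1) : f = g := by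
  refine LinearMap.ext fun q => ?_
  obtain ⟨q, rfl⟩ := Ideal.Quotient.mk_surjective q
  have hq : Ideal.Quotient.mk J q = q • (1 : R ⧸ J) := by
    rw [Algebra.smul_def, mul_one]; rfl
  rw [hq, map_smul, map_smul, h]

end Kill

variable {R : Type u} [CommRing R]

/-- An injective resolution in the category of modules as an injective resolution by modules. -/
def injRes (J : InjectiveResolution (ModuleCat.of R R)) : InjRes R where
  E n := J.cocomplex.X n
  δ n := (J.cocomplex.d n (n + 1)).hom
  ε := (J.ι.f 0).hom
  ε_injective := (ModuleCat.mono_iff_injective (J.ι.f 0)).1 inferInstance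
  exact_zero x := ⟨(ShortComplex.moduleCat_exact_iff _).1 J.exact₀ x, by
    rintro ⟨r, rfl⟩
    exact congrArg (fun f => f.hom r) J.ι_f_zero_comp_complex_d⟩
  exact_succ n x := ⟨(ShortComplex.moduleCat_exact_iff _).1 (J.exact_succ n) x, by
    rintro ⟨r, rfl⟩
    exact congrArg (fun f => f.hom r) (J.complex_d_comp n)⟩
  baer n := by
    have : Injective (ModuleCat.of R (J.cocomplex.X n)) := J.injective n
    exact Module.Baer.of_injective (Module.injective_module_of_injective_object R (J.cocomplex.X n))

variable (J : InjectiveResolution (ModuleCat.of R R))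

/-- The homomorphism attached to a cocycle annihilated by an ideal. -/
def cycHom {I : Ideal R} {n : ℕ} (x : (injRes J).cyc ((injRes J).K I) n) :
    ModuleCat.of R (R ⧸ I) ⟶ J.cocomplex.X (n + 1) :=
  ModuleCat.ofHom (killEquiv I (J.cocomplex.X (n + 1)) ⟨x.1, x.2.1⟩)

theorem hom_ext {I : Ideal R} {N : ModuleCat.{u} R} {f g : ModuleCat.of R (R ⧸ I) ⟶ N}
    (h : f.hom (1 : R ⧸ I) = g.hom (1 : R ⧸ I)) : f = g :=
  ModuleCat.hom_ext (hom_ext_of_one h)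

theorem cycHom_one {I : Ideal R} {n : ℕ} (x : (injRes J).cyc ((injRes J).K I) n) :
    (cycHom J x).hom (1 : R ⧸ I) = x.1 := one_smul R x.1

theorem cycHom_comp {I : Ideal R} {n : ℕ} (x : (injRes J).cyc ((injRes J).K I) n) :
    cycHom J x ≫ J.cocomplex.d (n + 1) (n + 2) = 0 :=
  hom_ext ((congrArg (J.cocomplex.d (n + 1) (n + 2)).hom (cycHom_one J x)).trans x.2.2)

/-- The class in the extension module of a cocycle annihilated by an ideal. -/
def injCls (I : Ideal R) (n : ℕ) : (injRes J).cyc ((injRes J).K I) n →ₗ[R]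
    Abelian.Ext (ModuleCat.of R (R ⧸ I)) (ModuleCat.of R R) (n + 1) where
  toFun x := J.extMk (cycHom J x) (n + 2) rfl (cycHom_comp J x)
  map_add' x y := by
    refine Eq.trans ?_ (J.add_extMk _ _ _ rfl (cycHom_comp J x) (cycHom_comp J y)).symm
    congr 1
    apply hom_ext
    refine (cycHom_one J (x + y)).trans ?_
    exact (congrArg₂ (· + ·) (cycHom_one J x) (cycHom_one J y)).symm
  map_smul' r x := by
    rw [RingHom.id_apply]
    have h1 : r • J.extMk (cycHom J x) (n + 2) rfl (cycHom_comp J x) =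
        (Abelian.Ext.mk₀ (r • 𝟙 (ModuleCat.of R (R ⧸ I)))).comp
          (J.extMk (cycHom J x) (n + 2) rfl (cycHom_comp J x)) (zero_add _) := by
      rw [Abelian.Ext.mk₀_smul, Abelian.Ext.smul_comp, Abelian.Ext.mk₀_id_comp]
    refine Eq.trans ?_ h1.symm
    refine Eq.trans ?_ (J.mk₀_comp_extMk _ _ rfl (cycHom_comp J x) _).symm
    congr 1
    apply hom_ext
    refine (cycHom_one J (r • x)).trans ?_
    refine Eq.trans ?_ ((cycHom J x).hom.map_smul r (1 : R ⧸ I)).symm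
    exact congrArg (r • ·) (cycHom_one J x).symm

theorem injCls_surjective (I : Ideal R) (n : ℕ) : Function.Surjective (injCls J I n) := fun α => by
  obtain ⟨f, hf, rfl⟩ := J.extMk_surjective α (n + 2) rfl
  let y := (killEquiv I (J.cocomplex.X (n + 1))).symm f.hom
  have hy : y.1 = f.hom (1 : R ⧸ I) := rfl
  refine ⟨⟨y.1, y.2, ?_⟩, ?_⟩
  · exact congrArg (fun g => g.hom (1 : R ⧸ I)) hf
  · change J.extMk (cycHom J _) (n + 2) rfl (cycHom_comp J _) = _
    congr 1
    exact hom_ext (cycHom_one J _)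

theorem injCls_eq_zero {I : Ideal R} {n : ℕ} (x : (injRes J).cyc ((injRes J).K I) n) :
    injCls J I n x = 0 ↔ ∃ y ∈ (injRes J).K I n, (injRes J).δ n y = x := by
  refine (J.extMk_eq_zero_iff (cycHom J x) (n + 2) rfl (cycHom_comp J x) n rfl).trans ⟨?_, ?_⟩
  · rintro ⟨g, hg⟩
    let y := (killEquiv I (J.cocomplex.X n)).symm g.hom
    exact ⟨y.1, y.2, (congrArg (fun g => g.hom (1 : R ⧸ I)) hg).trans (cycHom_one J x)⟩
  · rintro ⟨y, hy, hxy⟩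
    refine ⟨ModuleCat.ofHom (killEquiv I (J.cocomplex.X n) ⟨y, hy⟩), ?_⟩
    refine hom_ext (Eq.trans ?_ (cycHom_one J x).symm)
    refine Eq.trans ?_ hxy
    exact congrArg (J.cocomplex.d n (n + 1)).hom (one_smul R y)

theorem ker_cls (I : Ideal R) (n : ℕ) :
    LinearMap.ker (InjRes.cls : _ →ₗ[R] (injRes J).hcoh ((injRes J).K I) n) =
      LinearMap.ker (injCls J I n) := by
  ext x
  rw [LinearMap.mem_ker, LinearMap.mem_ker, InjRes.cls_eq_zero, injCls_eq_zero]

/-- The cohomology of the subcomplex annihilated by an ideal computes extension modules. -/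
def hcohExt (I : Ideal R) (n : ℕ) : (injRes J).hcoh ((injRes J).K I) n ≃ₗ[R]
    Abelian.Ext (ModuleCat.of R (R ⧸ I)) (ModuleCat.of R R) (n + 1) :=
  equivOfKer _ _ InjRes.cls_surjective (injCls_surjective J I n) (ker_cls J I n)

theorem hcohExt_cls {I : Ideal R} {n : ℕ} (x : (injRes J).cyc ((injRes J).K I) n) :
    hcohExt J I n (InjRes.cls x) = injCls J I n x := equivOfKer_apply _ _ _ _ _ _

theorem mk₀_comp_hcohExt {I I' : Ideal R} (n : ℕ)
    (f : ModuleCat.of R (R ⧸ I') ⟶ ModuleCat.of R (R ⧸ I)) (hf : f.hom (1 : R ⧸ I') = (1 : R ⧸ I))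
    (hK : ∀ n, (injRes J).K I n ≤ (injRes J).K I' n)
    (z : (injRes J).hcoh ((injRes J).K I) n) :
    (Abelian.Ext.mk₀ f).comp (hcohExt J I n z) (zero_add _) =
      hcohExt J I' n (InjRes.hmap hK n z) := by
  obtain ⟨x, rfl⟩ := InjRes.cls_surjective z
  rw [InjRes.hmap_cls, hcohExt_cls, hcohExt_cls]
  refine (J.mk₀_comp_extMk _ _ rfl (cycHom_comp J x) _).trans ?_
  change _ = J.extMk (cycHom J _) (n + 2) rfl (cycHom_comp J _)
  congr 1
  refine hom_ext (Eq.trans ?_ (cycHom_one J _).symm)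
  exact (congrArg (cycHom J x).hom hf).trans (cycHom_one J x)

end LocCoh

namespace LocCoh

section CohenMacaulay

open IsLocalRing

variable {R : Type u} [CommRing R]

theorem acyc_iff_subsingleton_ext (J : InjectiveResolution (ModuleCat.of R R)) (I : Ideal R)
    (n : ℕ) : (injRes J).Acyc ((injRes J).K I) n ↔
      Subsingleton (Abelian.Ext (ModuleCat.of R (R ⧸ I)) (ModuleCat.of R R) (n + 1)) := by
  rw [InjRes.acyc_iff, ← (hcohExt J I n).toEquiv.subsingleton_congr]
  exact ⟨fun h => ⟨fun a b => (h a).trans (h b).symm⟩, fun h x => Subsingleton.elim _ _⟩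

variable [IsLocalRing R]

theorem exists_isRegular_of_moduleDepth {n : ℕ}
    (h : moduleDepth R (maximalIdeal R) R = (n + 1 : ℕ)) :
    ∃ rs : List R, n + 1 ≤ rs.length ∧ (∀ r ∈ rs, r ∈ maximalIdeal R) ∧
      RingTheory.Sequence.IsRegular R rs := by
  have h1 : (n : ℕ∞) < moduleDepth R (maximalIdeal R) R := by
    rw [h]; exact_mod_cast Nat.lt_succ_self n
  obtain ⟨_, ⟨rs, rfl, hmem, hreg⟩, hlt⟩ := lt_sSup_iff.1 h1
  exact ⟨rs, by exact_mod_cast hlt, hmem, hreg⟩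

theorem cm_injRes [IsNoetherianRing R] [IsDomain R] (hCM : IsCMLocalRing R) {n : ℕ}
    (hd : ringKrullDim R = (n + 1 : ℕ)) (J : InjectiveResolution (ModuleCat.of R R)) :
    (injRes J).CM n := by
  have hdepth : moduleDepth R (maximalIdeal R) R = (n + 1 : ℕ) := by
    have h : ((moduleDepth R (maximalIdeal R) R : ℕ∞) : WithBot ℕ∞) = _ := hCM.trans hd
    exact_mod_cast h
  have hlt : maximalIdeal R • (⊤ : Submodule R (ModuleCat.of R R)) < ⊤ := by
    refine lt_top_iff_ne_top.2 fun h => ?_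
    have h' : maximalIdeal R • (⊤ : Ideal R) = ⊤ := h
    rw [smul_eq_mul, Ideal.mul_top] at h'
    exact (maximalIdeal.isMaximal R).ne_top h'
  have hsupp : Module.support R (ModuleCat.of R (R ⧸ maximalIdeal R)) =
      PrimeSpectrum.zeroLocus (maximalIdeal R) := by
    refine (Module.support_eq_zeroLocus (M := R ⧸ maximalIdeal R)).trans ?_
    rw [Ideal.annihilator_quotient]
  have hkill : ∀ r ∈ kill (maximalIdeal R) R, r = 0 := by
    intro r hr
    have hm : maximalIdeal R ≠ ⊥ := fun h => by
      have := ringKrullDim_eq_zero_of_isField (isField_iff_maximalIdeal_eq.2 h)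
      rw [hd] at this
      exact absurd this (by exact_mod_cast Nat.succ_ne_zero n)
    obtain ⟨s, hs, hs0⟩ := Submodule.exists_mem_ne_zero_of_ne_bot hm
    exact (mul_eq_zero.1 (mem_kill.1 hr s hs)).resolve_left hs0
  obtain ⟨rs, hlen, hmem, hreg⟩ := exists_isRegular_of_moduleDepth hdepth
  have hext := ModuleCat.subsingleton_ext_of_exists_isRegular _ _ hsupp.le (ModuleCat.of R R) hlt
    rs hmem hreg
  refine ⟨hd, hkill, fun i hi => ?_, fun h => ?_, fun 𝔞 i => ?_⟩
  · exact (acyc_iff_subsingleton_ext J _ i).2 (hext _ (by omega))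
  · obtain ⟨rs', hlen', hmem', hreg'⟩ := ModuleCat.exists_isRegular_of_exists_subsingleton_ext
      (maximalIdeal R) (n + 2) (ModuleCat.of R R) hlt _ hsupp fun i hi => by
        rcases (by omega : i < n + 1 ∨ i = n + 1) with hi | rfl
        · exact hext i (by omega)
        · exact (acyc_iff_subsingleton_ext J _ n).1 h
    have hle : ((n + 2 : ℕ) : ℕ∞) ≤ moduleDepth R (maximalIdeal R) R :=
      le_sSup ⟨rs', by rw [hlen'], hmem', hreg'⟩
    rw [hdepth] at hle
    exact absurd (show n + 2 ≤ n + 1 by exact_mod_cast hle) (by omega)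
  · exact Module.Finite.equiv (hcohExt J 𝔞 i).symm

end CohenMacaulay

end LocCoh

namespace LocCoh

section Colimit

open Limits

variable {R : Type u} [CommRing R]

/-- A module receiving jointly surjective compatible maps from a filtered diagram, such that the
elements of the kernels vanish later on, is the colimit. -/
theorem bijective_desc {A : Type} [SmallCategory A] [IsFiltered A] {F : A ⥤ ModuleCat.{u} R}
    {c : Cocone F} (hc : IsColimit c) (s : Cocone F) (hs : ∀ x : s.pt, ∃ j y, s.ι.app j y = x)
    (h0 : ∀ j y, s.ι.app j y = 0 → ∃ (k : A) (f : j ⟶ k), F.map f y = 0) :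
    Function.Bijective (hc.desc s) := by
  have : PreservesFilteredColimitsOfSize.{0, 0} (forget (ModuleCat.{u} R)) :=
    preservesFilteredColimitsOfSize_shrink.{0, u, 0, u} _
  have hfac : ∀ j y, hc.desc s (c.ι.app j y) = s.ι.app j y := fun j y =>
    congrArg (fun f => f.hom y) (hc.fac s j)
  constructor
  · refine (injective_iff_map_eq_zero (hc.desc s).hom).2 fun x hx => ?_
    obtain ⟨j, y, rfl⟩ := Concrete.isColimit_exists_rep F hc x
    obtain ⟨k, f, hf⟩ := h0 j y ((hfac j y).symm.trans hx)
    refine (congrArg (fun g => g.hom y) (c.w f)).symm.trans ?_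
    exact (congrArg (c.ι.app k) hf).trans (map_zero (c.ι.app k).hom)
  · intro x
    obtain ⟨j, y, rfl⟩ := hs x
    exact ⟨_, hfac j y⟩

end Colimit

section LocalCohomology

open Limits Opposite

variable {R : Type u} [CommRing R] (J : InjectiveResolution (ModuleCat.of R R)) (I : Ideal R)
  (n : ℕ)

theorem K_le_G (t : ℕ) (i : ℕ) : (injRes J).K (I ^ t) i ≤ (injRes J).G I i :=
  kill_le_gam I t

/-- The map from an extension module to the cohomology of the torsion subcomplex. -/
def extToG (t : ℕ) :
    ((Ext R (ModuleCat.{u} R) (n + 1)).obj (op (ModuleCat.of R (R ⧸ I ^ t)))).obj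
      (ModuleCat.of R R) →ₗ[R] (injRes J).hcoh ((injRes J).G I) n :=
  InjRes.hmap (K_le_G J I t) n ∘ₗ (hcohExt J (I ^ t) n).symm.toLinearMap ∘ₗ
    (extCompare (ModuleCat.of R (R ⧸ I ^ t)) (ModuleCat.of R R) n).toLinearMap

/-- The class in the derived functor model of a cocycle. -/
def oldExtOf (t : ℕ) : (injRes J).hcoh ((injRes J).K (I ^ t)) n ≃ₗ[R]
    ((Ext R (ModuleCat.{u} R) (n + 1)).obj (op (ModuleCat.of R (R ⧸ I ^ t)))).obj
      (ModuleCat.of R R) :=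
  hcohExt J (I ^ t) n ≪≫ₗ
    (extCompare (ModuleCat.of R (R ⧸ I ^ t)) (ModuleCat.of R R) n).symm

theorem extToG_oldExtOf (t : ℕ) (z : (injRes J).hcoh ((injRes J).K (I ^ t)) n) :
    extToG J I n t (oldExtOf J I n t z) = InjRes.hmap (K_le_G J I t) n z := by
  simp [extToG, oldExtOf]

theorem K_mono {t t' : ℕ} (h : t ≤ t') (i : ℕ) :
    (injRes J).K (I ^ t) i ≤ (injRes J).K (I ^ t') i :=
  fun _ hx => mem_kill.2 fun r hr => mem_kill.1 hx r (Ideal.pow_le_pow_right h hr)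

/-- The directed system computing local cohomology. -/
abbrev locDiagram : ℕᵒᵖᵒᵖ ⥤ ModuleCat.{u} R :=
  localCohomology.diagram (localCohomology.idealPowersDiagram I) (n + 1) ⋙
    (evaluation _ _).obj (ModuleCat.of R R)

theorem map_oldExtOf {s t : ℕᵒᵖᵒᵖ} (f : s ⟶ t)
    (h : s.unop.unop ≤ t.unop.unop)
    (z : (injRes J).hcoh ((injRes J).K (I ^ s.unop.unop)) n) :
    (locDiagram I n).map f (oldExtOf J I n s.unop.unop z) =
      oldExtOf J I n t.unop.unop (InjRes.hmap (K_mono J I h) n z) := by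
  let g := (localCohomology.ringModIdeals (localCohomology.idealPowersDiagram I)).map f.unop
  apply (extCompare (ModuleCat.of R (R ⧸ I ^ t.unop.unop)) (ModuleCat.of R R) n).injective
  refine (extCompare_naturality g n _).trans ?_
  refine (congrArg (fun w => (Abelian.Ext.mk₀ g).comp w (zero_add _))
    (LinearEquiv.apply_symm_apply _ _)).trans ?_
  refine Eq.trans ?_ (LinearEquiv.apply_symm_apply _ _).symm
  exact mk₀_comp_hcohExt J n g rfl (K_mono J I h) z

/-- The cohomology of the torsion subcomplex as a cocone. -/
def locCocone : Cocone (locDiagram I n) where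
  pt := ModuleCat.of R ((injRes J).hcoh ((injRes J).G I) n)
  ι :=
    { app := fun t => ModuleCat.ofHom (extToG J I n t.unop.unop)
      naturality := fun s t f => by
        refine ModuleCat.hom_ext (LinearMap.ext fun x => ?_)
        obtain ⟨z, rfl⟩ := (oldExtOf J I n s.unop.unop).surjective x
        have h : s.unop.unop ≤ t.unop.unop := leOfHom f.unop.unop
        refine (congrArg (extToG J I n t.unop.unop) (map_oldExtOf J I n f h z)).trans ?_
        refine (extToG_oldExtOf J I n _ _).trans ?_
        refine Eq.trans ?_ (extToG_oldExtOf J I n _ _).symm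
        obtain ⟨z, rfl⟩ := InjRes.cls_surjective z
        rfl }

theorem locCocone_surjective (x : (locCocone J I n).pt) :
    ∃ j y, (locCocone J I n).ι.app j y = x := by
  obtain ⟨x, rfl⟩ := InjRes.cls_surjective x
  obtain ⟨t, ht⟩ := x.2.1
  refine ⟨op (op t), oldExtOf J I n t (InjRes.cls ⟨x.1, ht, x.2.2⟩), ?_⟩
  exact extToG_oldExtOf J I n t _

theorem locCocone_eq_zero (j : ℕᵒᵖᵒᵖ) (y : (locDiagram I n).obj j)
    (hy : (locCocone J I n).ι.app j y = 0) :
    ∃ (k : ℕᵒᵖᵒᵖ) (f : j ⟶ k), (locDiagram I n).map f y = 0 := by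
  obtain ⟨z, rfl⟩ := (oldExtOf J I n j.unop.unop).surjective y
  obtain ⟨z, rfl⟩ := InjRes.cls_surjective z
  obtain ⟨w, ⟨t, ht⟩, hw⟩ := InjRes.cls_eq_zero.1 ((extToG_oldExtOf J I n _ _).symm.trans hy)
  have hle : j.unop.unop ≤ max j.unop.unop t := le_max_left _ _
  refine ⟨op (op (max j.unop.unop t)), (homOfLE hle).op.op, ?_⟩
  refine (map_oldExtOf J I n _ hle _).trans ?_
  have h0 : InjRes.hmap (K_mono J I hle) n (InjRes.cls z) = 0 :=
    InjRes.cls_eq_zero.2 ⟨w, K_mono J I (le_max_right _ _) n ht, hw⟩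
  exact (congrArg (oldExtOf J I n (max j.unop.unop t)) h0).trans (map_zero _)

/-- Local cohomology is the cohomology of the torsion subcomplex of an injective resolution. -/
def locEquiv : (localCohomology I (n + 1)).obj (ModuleCat.of R R) ≃ₗ[R]
    (injRes J).hcoh ((injRes J).G I) n :=
  LinearEquiv.ofBijective _ (bijective_desc
    (isColimitOfPreserves ((evaluation _ _).obj (ModuleCat.of R R))
      (colimit.isColimit (localCohomology.diagram (localCohomology.idealPowersDiagram I) (n + 1))))
    (locCocone J I n) (locCocone_surjective J I n) (locCocone_eq_zero J I n))

end LocalCohomology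

end LocCoh

namespace LocCoh

section Cofinite

variable {R : Type u} [CommRing R]

/-- Homomorphisms inject into the extension modules of degree zero. -/
def homToExt (X Y : ModuleCat.{u} R) :
    (X ⟶ Y) →ₗ[R] ((Ext R (ModuleCat.{u} R) 0).obj (Opposite.op X)).obj Y :=
  oldCls (projectiveResolution X) Y 0 ∘ₗ
    (Linear.leftComp R Y ((projectiveResolution X).π.f 0)).codRestrict _ fun f => by
      refine mem_projCyc.2 ?_
      refine (Category.assoc _ _ _).symm.trans ?_
      refine (congrArg (· ≫ f) (projectiveResolution X).complex_d_comp_π_f_zero).trans ?_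
      exact Limits.zero_comp

theorem homToExt_injective (X Y : ModuleCat.{u} R) : Function.Injective (homToExt X Y) := by
  refine (isoExt_inv_injective _ 0).comp ((homologyCls_zero_injective _).comp ?_)
  intro f g h
  exact (cancel_epi ((projectiveResolution X).π.f 0)).1 (congrArg Subtype.val h)

theorem finite_hom_of_isCofinite [IsNoetherianRing R] {I : Ideal R} {N : ModuleCat.{u} R}
    (h : IsCofinite R I N) : Module.Finite R ((R ⧸ I) →ₗ[R] N) := by
  have := h.2 0
  exact Module.Finite.of_injective (homToExt (ModuleCat.of R (R ⧸ I)) N ∘ₗ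
    (ModuleCat.homLinearEquiv (S := R) (M := ModuleCat.of R (R ⧸ I)) (N := N)).symm.toLinearMap)
    ((homToExt_injective _ _).comp (LinearEquiv.injective _))

end Cofinite

end LocCoh

theorem stmt12 (R : Type u) [CommRing R] [IsNoetherianRing R] [IsLocalRing R] [IsDomain R]
    (hCM : IsCMLocalRing R)
    [IsDomain (AdicCompletion (IsLocalRing.maximalIdeal R) R)]
    [IsIntegrallyClosed (AdicCompletion (IsLocalRing.maximalIdeal R) R)]
    (d : ℕ) (hd : ringKrullDim R = d)
    (I : Ideal R) (h2 : 2 ≤ ringKrullDim (R ⧸ I))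
    (hdisc : ¬ _root_.IsPreconnected {p : PrimeSpectrum (R ⧸ I) |
      p.asIdeal.comap (Ideal.Quotient.mk I) ≠ IsLocalRing.maximalIdeal R}) :
    ¬ Module.Finite R
      ((R ⧸ I) →ₗ[R] ((localCohomology I (d - 1)).obj (ModuleCat.of R R))) ∧
    ¬ IsCofinite R I ((localCohomology I (d - 1)).obj (ModuleCat.of R R)) := by
  have hfin : ¬ Module.Finite R
      ((R ⧸ I) →ₗ[R] ((localCohomology I (d - 1)).obj (ModuleCat.of R R))) := by
    intro hfin
    have hId : (2 : WithBot ℕ∞) ≤ d :=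
      h2.trans ((ringKrullDim_quotient_le I).trans hd.le)
    obtain ⟨n, rfl⟩ : ∃ n, d = n + 2 := ⟨d - 2, by
      have : 2 ≤ d := by exact_mod_cast hId
      omega⟩
    have hI : I ≤ IsLocalRing.maximalIdeal R := by
      refine IsLocalRing.le_maximalIdeal fun h => ?_
      have : Subsingleton (R ⧸ I) := Ideal.Quotient.subsingleton_iff.2 h
      rw [ringKrullDim_eq_bot_of_subsingleton] at h2
      exact absurd h2 (by decide)
    obtain ⟨a, b, hIa, hIb, hab, hJ, ham, hbm, ha, hb⟩ :=
      LocCoh.exists_ideals_of_not_isPreconnected hdisc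
    let J := injectiveResolution (ModuleCat.of R R)
    refine (LocCoh.cm_injRes hCM hd J).not_isNoetherian_kill h2 hI hIa hIb hab hJ ham hbm ha hb ?_
    have e : ((R ⧸ I) →ₗ[R] ((localCohomology I (n + 1)).obj (ModuleCat.of R R))) ≃ₗ[R]
        LocCoh.kill I ((LocCoh.injRes J).hcoh ((LocCoh.injRes J).G I) n) :=
      LinearEquiv.congrRight (LocCoh.locEquiv J I n) ≪≫ₗ (LocCoh.killEquiv _ _).symm
    have : Module.Finite R
        ((R ⧸ I) →ₗ[R] ((localCohomology I (n + 1)).obj (ModuleCat.of R R))) := hfin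
    have := Module.Finite.equiv e
    exact isNoetherian_of_isNoetherianRing_of_finite R _
  exact ⟨hfin, fun h => hfin (LocCoh.finite_hom_of_isCofinite h)⟩
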